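/- arXiv:1707.06536 — 3 statements merged into one kernel-verified Lean document; each statement's English description precedes it below -/
import Mathlib

section
/- Let (R, 𝔪) be a Noetherian local ring, 𝔞 an ideal, and M a nonzero finitely generated R-module with cd(𝔞, M) = 1. Then Ann_R(H^1_𝔞(M)) = Ann_R(M/T_R(𝔞, M)). -/
open CategoryTheory

/-- `HasCD a M c` : the cohomological dimension of `M` with respect to `a` is `c`,
i.e. `H^c_a(M) ≠ 0` and `H^i_a(M) = 0` for all `i > c`. -/
def HasCD {R : Type} [CommRing R] (a : Ideal R) (M : ModuleCat R) (c : ℕ) : Prop :=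
  Nontrivial ((localCohomology a c).obj M) ∧
    ∀ i, c < i → Subsingleton ((localCohomology a i).obj M)

/-- The attached primes of an `R`-module `A`: primes of the form `Ann_R(A/B)`. -/
def attachedPrimes (R : Type) [CommRing R] (A : Type) [AddCommGroup A] [Module R A] :
    Set (Ideal R) :=
  {p | p.IsPrime ∧ ∃ B : Submodule R A, p = Module.annihilator R (A ⧸ B)}

section
open CategoryTheory.Limits

namespace Stmt13

section Hom
variable {D : Type*} [Category D] [Abelian D] (K : ChainComplex D ℕ) {I : D}

noncomputable def hmk {n : ℕ} (g : K.X n ⟶ I) (hg : K.d (n+1) n ≫ g = 0) : K.homology n ⟶ I :=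
  K.homologyι n ≫ K.descOpcycles g (n+1) (by simp) hg

lemma hmk_surj [Injective I] {n : ℕ} (θ : K.homology n ⟶ I) : ∃ g hg, θ = hmk K (n := n) g hg := by
  refine ⟨K.pOpcycles n ≫ Injective.factorThru θ (K.homologyι n), by simp, ?_⟩
  rw [hmk]
  have : K.descOpcycles (K.pOpcycles n ≫ Injective.factorThru θ (K.homologyι n)) (n+1) (by simp)
      (by simp) = Injective.factorThru θ (K.homologyι n) := by
    rw [← cancel_epi (K.pOpcycles n)]; simp
  rw [this]; simp

lemma hmk_zero [Injective I] {p : ℕ} (g : K.X (p+1) ⟶ I) (hg : K.d (p+1+1) (p+1) ≫ g = 0) :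
    hmk K g hg = 0 ↔ ∃ h : K.X p ⟶ I, K.d (p+1) p ≫ h = g := by
  constructor
  · intro h0
    let S : ShortComplex D := ShortComplex.mk _ _ (K.homologyι_comp_fromOpcycles (p+1) p)
    have hS : S.Exact := S.exact_of_f_is_kernel (K.homologyIsKernel (p+1) p (by simp))
    refine ⟨hS.descToInjective (K.descOpcycles g (p+1+1) (by simp) hg) h0, ?_⟩
    have := hS.comp_descToInjective (K.descOpcycles g (p+1+1) (by simp) hg) h0
    have h2 := congrArg (fun t => K.pOpcycles (p+1) ≫ t) this
    simpa [S] using h2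
  · rintro ⟨h, rfl⟩
    exact K.homologyι_descOpcycles_eq_zero_of_boundary _ _ _ _ rfl

lemma map_hmk {K L : ChainComplex D ℕ} (φ : K ⟶ L) {n : ℕ} (g : L.X n ⟶ I)
    (hg : L.d (n+1) n ≫ g = 0) : HomologicalComplex.homologyMap φ n ≫ hmk L g hg =
      hmk K (φ.f n ≫ g) (by rw [← φ.comm_assoc, hg, comp_zero]) := by
  rw [hmk, hmk, HomologicalComplex.homologyι_naturality_assoc,
    HomologicalComplex.opcyclesMap_comp_descOpcycles]

end Hom

open Opposite
section Old
variable {R : Type} [CommRing R]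

abbrev FY (Y : ModuleCat.{0} R) : ModuleCat.{0} R ⥤ (ModuleCat.{0} R)ᵒᵖ :=
  ((linearYoneda R (ModuleCat.{0} R)).obj Y).rightOp

/-- morphism to `op R` corresponding to an element -/
noncomputable def toOp {A : ModuleCat.{0} R} (x : A) : op A ⟶ op (ModuleCat.of R R) :=
  (ModuleCat.ofHom (LinearMap.toSpanSingleton R A x)).op

lemma toOp_surj {A : ModuleCat.{0} R} (θ : op A ⟶ op (ModuleCat.of R R)) :
   ∃ x : A, θ = toOp x := by
  refine ⟨θ.unop (1 : R), ?_⟩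
  apply Quiver.Hom.unop_inj
  ext
  simp [toOp]

lemma toOp_inj {A : ModuleCat.{0} R} {x y : A} (h : toOp x = toOp y) : x = y := by
  have := congrArg (fun t => t.unop (1:R)) h
  simpa [toOp] using this

lemma map_toOp {A B : ModuleCat.{0} R} (φ : A ⟶ B) (x : A) : φ.op ≫ toOp x = toOp (φ x) := by
  apply Quiver.Hom.unop_inj
  ext
  simp [toOp]

instance : Injective (op (ModuleCat.of R R)) := by
  have : Projective (ModuleCat.of R R) := inferInstance
  infer_instance

variable {X Y : ModuleCat.{0} R} (P : ProjectiveResolution X) {n : ℕ}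

noncomputable abbrev Old (X Y : ModuleCat.{0} R) (n : ℕ) : ModuleCat.{0} R :=
  ((Ext R (ModuleCat.{0} R) n).obj (op X)).obj Y

lemma toOp_zero {A : ModuleCat.{0} R} : toOp (0 : A) = 0 := by
  apply Quiver.Hom.unop_inj
  ext
  simp [toOp]

lemma toOp_smul {A : ModuleCat.{0} R} (r : R) (x : A) :
    toOp (r • x) = toOp x ≫ (r • 𝟙 (ModuleCat.of R R)).op := by
  apply Quiver.Hom.unop_inj
  ext
  simp [toOp]

noncomputable def oTo (e : Old X Y n) :
    ((FY Y).leftDerived n).obj X ⟶ op (ModuleCat.of R R) := toOp e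

lemma oTo_surj (θ : ((FY Y).leftDerived n).obj X ⟶ op (ModuleCat.of R R)) :
    ∃ e : Old X Y n, θ = oTo e := toOp_surj (A := Old X Y n) θ

lemma oTo_eq_zero (e : Old X Y n) : oTo e = 0 ↔ e = 0 := by
  constructor
  · intro h
    exact toOp_inj (h.trans toOp_zero.symm)
  · rintro rfl
    exact toOp_zero

lemma oTo_smul (r : R) (e : Old X Y n) :
    oTo (r • e) = oTo e ≫ (r • 𝟙 (ModuleCat.of R R)).op := toOp_smul r e

lemma oTo_map {X' : ModuleCat.{0} R} (g : X' ⟶ X) (e : Old X Y n) :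
    oTo ((((Ext R (ModuleCat.{0} R) n).map g.op).app Y) e) =
      ((FY Y).leftDerived n).map g ≫ oTo e :=
  (map_toOp (((Ext R (ModuleCat.{0} R) n).map g.op).app Y) e).symm

noncomputable def cTo {A : ModuleCat.{0} R} (f : A ⟶ Y) : (FY Y).obj A ⟶ op (ModuleCat.of R R) :=
  toOp (A := ModuleCat.of R (A ⟶ Y)) f

lemma cTo_surj {A : ModuleCat.{0} R} (θ : (FY Y).obj A ⟶ op (ModuleCat.of R R)) :
    ∃ f : A ⟶ Y, θ = cTo f := toOp_surj (A := ModuleCat.of R (A ⟶ Y)) θ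

lemma cTo_inj {A : ModuleCat.{0} R} {f g : A ⟶ Y} (h : cTo f = cTo g) : f = g :=
  toOp_inj (A := ModuleCat.of R (A ⟶ Y)) h

lemma cTo_zero {A : ModuleCat.{0} R} : cTo (0 : A ⟶ Y) = 0 :=
  toOp_zero (A := ModuleCat.of R (A ⟶ Y))

lemma cTo_smul {A : ModuleCat.{0} R} (r : R) (f : A ⟶ Y) :
    cTo (r • f) = cTo f ≫ (r • 𝟙 (ModuleCat.of R R)).op :=
  toOp_smul (A := ModuleCat.of R (A ⟶ Y)) r f

lemma cTo_map {A B : ModuleCat.{0} R} (φ : A ⟶ B) (f : B ⟶ Y) :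
    (FY Y).map φ ≫ cTo f = cTo (φ ≫ f) :=
  map_toOp (A := ModuleCat.of R (B ⟶ Y)) (B := ModuleCat.of R (A ⟶ Y))
    (ModuleCat.ofHom (Linear.leftComp R Y φ)) f

abbrev KK (P : ProjectiveResolution X) (Y : ModuleCat.{0} R) : ChainComplex (ModuleCat.{0} R)ᵒᵖ ℕ :=
  ((FY Y).mapHomologicalComplex _).obj P.complex

noncomputable def cT (f : P.complex.X n ⟶ Y) : (KK P Y).X n ⟶ op (ModuleCat.of R R) := cTo f

lemma cT_d {m : ℕ} (f : P.complex.X n ⟶ Y) : (KK P Y).d m n ≫ cT P f = cT P (P.complex.d m n ≫ f) :=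
  cTo_map _ _

lemma cT_cocycle {f : P.complex.X n ⟶ Y} (hf : P.complex.d (n+1) n ≫ f = 0) :
    (KK P Y).d (n+1) n ≫ cT P f = 0 := by
  rw [cT_d, hf]
  exact cTo_zero

noncomputable def isoD (P : ProjectiveResolution X) (Y : ModuleCat.{0} R) (n : ℕ) :
    ((FY Y).leftDerived n).obj X ≅ (KK P Y).homology n := P.isoLeftDerivedObj (FY Y) n

lemma isoD_nat {X' : ModuleCat.{0} R} {P' : ProjectiveResolution X'} {g : X' ⟶ X}
    (φ : ProjectiveResolution.Hom P' P g) :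
    ((FY Y).leftDerived n).map g ≫ (isoD P Y n).hom = (isoD P' Y n).hom ≫
      HomologicalComplex.homologyMap (((FY Y).mapHomologicalComplex _).map φ.hom) n :=
  ProjectiveResolution.isoLeftDerivedObj_hom_naturality g P' P φ.hom (φ.hom_f_zero_comp_π_f_zero.trans (by simp)) (FY Y) n

/-- relation: `e : Old X Y n` is represented by the cocycle `f` -/
def Rep (f : P.complex.X n ⟶ Y) (hf : P.complex.d (n+1) n ≫ f = 0) (e : Old X Y n) : Prop :=
  oTo e = (isoD P Y n).hom ≫ hmk (KK P Y) (cT P f) (cT_cocycle P hf)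

lemma rep_smul {f : P.complex.X n ⟶ Y} {hf} {e : Old X Y n} (h : Rep P f hf e) (r : R) :
    Rep P (r • f) (by simp [hf]) (r • e) := by
  unfold Rep at *
  rw [oTo_smul, h, Category.assoc]
  congr 1
  unfold hmk
  rw [Category.assoc, HomologicalComplex.descOpcycles_comp]
  congr 1
  rw [← cancel_epi (HomologicalComplex.pOpcycles _ _)]
  rw [HomologicalComplex.p_descOpcycles, HomologicalComplex.p_descOpcycles]
  exact (cTo_smul _ _).symm

lemma rep_surj (e : Old X Y n) : ∃ f hf, Rep P f hf e := by
  obtain ⟨g, hg, h⟩ := hmk_surj (KK P Y) ((isoD P Y n).inv ≫ oTo e)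
  obtain ⟨f, rfl⟩ : ∃ f, g = cT P f := cTo_surj g
  refine ⟨f, ?_, ?_⟩
  · rw [cT_d] at hg
    exact cTo_inj (hg.trans cTo_zero.symm)
  · unfold Rep
    rw [← h, Iso.hom_inv_id_assoc]

lemma rep_unsurj (f : P.complex.X n ⟶ Y) (hf) : ∃ e : Old X Y n, Rep P f hf e := by
  obtain ⟨e, he⟩ := oTo_surj ((isoD P Y n).hom ≫
    hmk (KK P Y) (cT P f) (cT_cocycle P hf))
  exact ⟨e, he.symm⟩

lemma rep_zero {f : P.complex.X (n+1) ⟶ Y} {hf} {e : Old X Y (n+1)} (h : Rep P f hf e) :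
    e = 0 ↔ ∃ g : P.complex.X n ⟶ Y, P.complex.d (n+1) n ≫ g = f := by
  rw [← oTo_eq_zero, h, Preadditive.IsIso.comp_left_eq_zero, hmk_zero]
  constructor
  · rintro ⟨g, hg⟩
    obtain ⟨f, rfl⟩ : ∃ f, g = cT P f := cTo_surj g
    rw [cT_d] at hg
    exact ⟨f, cTo_inj hg⟩
  · rintro ⟨g, rfl⟩
    exact ⟨cT P g, cT_d P g⟩

lemma rep_map {X' : ModuleCat.{0} R} {P' : ProjectiveResolution X'} {g : X' ⟶ X}
    (φ : ProjectiveResolution.Hom P' P g)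
    {f : P.complex.X n ⟶ Y} {hf} {e : Old X Y n} (h : Rep P f hf e) :
    Rep P' (φ.hom.f n ≫ f) (by simp [← φ.hom.comm_assoc, hf])
      ((((Ext R (ModuleCat.{0} R) n).map g.op).app Y) e) := by
  unfold Rep at *
  rw [oTo_map, h]
  refine (Category.assoc _ _ _).symm.trans ?_
  rw [isoD_nat P φ, Category.assoc]
  congr 1
  refine (map_hmk (((FY Y).mapHomologicalComplex _).map φ.hom) _ (cT_cocycle P hf)).trans ?_
  congr 1

/-- The key comparison. -/
lemma rep_zero_new {f : P.complex.X (n+1) ⟶ Y} {hf} {e : Old X Y (n+1)} (h : Rep P f hf e) :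
    e = 0 ↔ P.extMk f (n+1+1) rfl hf = 0 := by
  rw [rep_zero P h, P.extMk_eq_zero_iff f _ rfl hf n rfl]

lemma smul_extMk (r : R) (f : P.complex.X n ⟶ Y) (hf : P.complex.d (n+1) n ≫ f = 0) :
    r • P.extMk f (n+1) rfl hf = P.extMk (r • f) (n+1) rfl (by simp [hf]) := by
  rw [Abelian.Ext.smul_eq_comp_mk₀, ProjectiveResolution.extMk_comp_mk₀]
  congr 1

end Old

section Bridge
variable {R : Type} [CommRing R] (a : Ideal R)

/-- `R/a^n` -/
abbrev Xn (n : ℕ) : ModuleCat.{0} R := ModuleCat.of R (R ⧸ a ^ n)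

/-- transition maps -/
def tr {n m : ℕ} (h : n ≤ m) : Xn a m ⟶ Xn a n :=
  ModuleCat.ofHom (Submodule.mapQ _ _ LinearMap.id (Ideal.pow_le_pow_right h))

/-- the class of `e` vanishes in the colimit -/
def Dies {N : ModuleCat.{0} R} {i n : ℕ} (e : Abelian.Ext (Xn a n) N i) : Prop :=
  ∃ (m : ℕ) (h : n ≤ m), (Abelian.Ext.mk₀ (tr a h)).comp e (zero_add i) = 0

theorem bridge (N : ModuleCat.{0} R) (i : ℕ) (r : R) :
    r ∈ Module.annihilator R ((localCohomology a (i+1)).obj N) ↔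
      ∀ (n : ℕ) (e : Abelian.Ext (Xn a n) N (i+1)), Dies a (r • e) := by
  let F := localCohomology.diagram (localCohomology.idealPowersDiagram a) (i+1)
  have hc : IsColimit (((evaluation _ _).obj N).mapCocone (colimit.cocone F)) :=
    isColimitOfPreserves _ (colimit.isColimit F)
  let G := F ⋙ (evaluation _ _).obj N
  let c : Cocone G := ((evaluation _ _).obj N).mapCocone (colimit.cocone F)
  have hpt : (localCohomology a (i+1)).obj N = c.pt := rfl
  rw [hpt, Module.mem_annihilator]
  have hfil : IsFiltered (ℕᵒᵖᵒᵖ) := inferInstance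
  have key : ∀ (n : ℕ) (o : Old (Xn a n) N (i+1)) (m : ℕ) (h : n ≤ m),
     (G.map ((homOfLE h).op.op : op (op n) ⟶ op (op m))) o =
       (((Ext R (ModuleCat.{0} R) (i+1)).map (tr a h).op).app N) o := fun _ _ _ _ => rfl
  have zero_iff : ∀ (n : ℕ) (o : Old (Xn a n) N (i+1)), (c.ι.app (op (op n))) o = 0 ↔
      ∃ (m : ℕ) (h : n ≤ m), (((Ext R (ModuleCat.{0} R) (i+1)).map (tr a h).op).app N) o = 0 := by
    intro n o
    constructor
    · intro h0
      have h1 : (c.ι.app (op (op n))) o = (c.ι.app (op (op n))) (0 : Old (Xn a n) N (i+1)) := by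
        rw [h0]; exact (map_zero _).symm
      obtain ⟨k, f, g, hfg⟩ := Concrete.isColimit_exists_of_rep_eq G hc _ _ h1
      refine ⟨k.unop.unop, leOfHom f.unop.unop, ?_⟩
      rw [← key]
      refine Eq.trans hfg ?_
      exact map_zero _
    · rintro ⟨m, h, hm⟩
      rw [← key] at hm
      have := congrArg (fun t => t o) (congrArg ModuleCat.Hom.hom (c.w ((homOfLE h).op.op : op (op n) ⟶ op (op m))))
      refine Eq.trans this.symm ?_
      refine (congrArg (c.ι.app (op (op m))) hm).trans ?_
      exact map_zero _
  have stage : ∀ (n : ℕ) (P : ProjectiveResolution (Xn a n)) (f : P.complex.X (i+1) ⟶ N) (hf)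
      (o : Old (Xn a n) N (i+1)), Rep P f hf o →
      ((c.ι.app (op (op n))) (r • o) = 0 ↔ Dies a (r • P.extMk f _ rfl hf)) := by
    intro n P f hf o ho
    rw [zero_iff]
    unfold Dies
    refine exists_congr fun m => exists_congr fun h => ?_
    let Q := projectiveResolution (Xn a m)
    let φ : ProjectiveResolution.Hom Q P (tr a h) :=
      ⟨ProjectiveResolution.lift (tr a h) Q P, (ProjectiveResolution.lift_commutes_zero (tr a h) Q P).trans (by simp)⟩
    have h1 := rep_map P φ (rep_smul P ho r)
    rw [rep_zero_new Q h1, smul_extMk, ProjectiveResolution.mk₀_comp_extMk _ _ _ _ φ]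
  constructor
  · intro hr n e
    obtain ⟨f, hf, rfl⟩ := (projectiveResolution (Xn a n)).extMk_surjective e _ rfl
    obtain ⟨o, ho⟩ := rep_unsurj _ f hf
    rw [← stage n _ f hf o ho]
    exact (map_smul (c.ι.app (op (op n))).hom r o).trans (hr _)
  · intro hr z
    obtain ⟨j, o, rfl⟩ := Concrete.isColimit_exists_rep G hc z
    obtain ⟨f, hf, ho⟩ := rep_surj (projectiveResolution (Xn a j.unop.unop)) o
    refine (map_smul (c.ι.app j).hom r o).symm.trans ?_
    exact (stage j.unop.unop _ f hf o ho).2 (hr _ _)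

theorem bridge_sub (N : ModuleCat.{0} R) (i : ℕ) :
    Subsingleton ((localCohomology a (i+1)).obj N) ↔
      ∀ (n : ℕ) (e : Abelian.Ext (Xn a n) N (i+1)), Dies a e := by
  have := bridge a N i 1
  simp only [one_smul] at this
  rw [← this, ← Ideal.eq_top_iff_one, Module.annihilator_eq_top_iff]

end Bridge
end Stmt13

namespace Stmt13
section Calc
variable {R : Type} [CommRing R] (a : Ideal R)

/-- `Ext^i(R/a^n, N)` -/
abbrev EE (n : ℕ) (N : Type) [AddCommGroup N] [Module R N] (i : ℕ) :=
  Abelian.Ext (Xn a n) (ModuleCat.of R N) i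

variable {a}
variable {A B C : Type} [AddCommGroup A] [Module R A] [AddCommGroup B] [Module R B]
  [AddCommGroup C] [Module R C]

/-- functoriality in the module -/
noncomputable def push {n i : ℕ} (f : A →ₗ[R] B) (e : EE a n A i) : EE a n B i :=
  e.comp (Abelian.Ext.mk₀ (ModuleCat.ofHom f)) (add_zero i)

/-- restriction along the transition maps -/
noncomputable def res {n m i : ℕ} (h : n ≤ m) (e : EE a n A i) : EE a m A i :=
  (Abelian.Ext.mk₀ (tr a h)).comp e (zero_add i)

lemma dies_iff {n i : ℕ} (e : EE a n A i) : Dies a e ↔ ∃ m, ∃ h : n ≤ m, res h e = 0 := Iff.rfl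

lemma push_push {n i : ℕ} (f : A →ₗ[R] B) (g : B →ₗ[R] C) (e : EE a n A i) :
    push g (push f e) = push (g ∘ₗ f) e := by
  unfold push
  rw [Abelian.Ext.comp_assoc_of_second_deg_zero, Abelian.Ext.mk₀_comp_mk₀]
  rfl

lemma push_res {n m i : ℕ} (h : n ≤ m) (f : A →ₗ[R] B) (e : EE a n A i) :
    push f (res h e) = res h (push f e) := by
  unfold push res
  rw [Abelian.Ext.comp_assoc_of_third_deg_zero]

lemma tr_tr {n m k : ℕ} (h : n ≤ m) (h' : m ≤ k) : tr a h' ≫ tr a h = tr a (h.trans h') := by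
  ext
  rfl

lemma res_res {n m k i : ℕ} (h : n ≤ m) (h' : m ≤ k) (e : EE a n A i) :
    res h' (res h e) = res (h.trans h') e := by
  unfold res
  rw [← tr_tr h h', ← Abelian.Ext.mk₀_comp_mk₀, Abelian.Ext.comp_assoc_of_second_deg_zero]

lemma push_zero {n i : ℕ} (f : A →ₗ[R] B) : push f (0 : EE a n A i) = 0 := by
  simp [push]

lemma zero_push {n i : ℕ} (e : EE a n A i) : push (0 : A →ₗ[R] B) e = 0 := by
  have : ModuleCat.ofHom (0 : A →ₗ[R] B) = 0 := rfl
  simp [push, this]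

lemma res_zero {n m i : ℕ} (h : n ≤ m) : res h (0 : EE a n A i) = 0 := by
  simp [res]

lemma push_smul {n i : ℕ} (f : A →ₗ[R] B) (r : R) (e : EE a n A i) :
    push f (r • e) = r • push f e := by
  simp [push]

lemma res_smul {n m i : ℕ} (h : n ≤ m) (r : R) (e : EE a n A i) :
    res h (r • e) = r • res h e := by
  simp [res]

lemma smul_push {n i : ℕ} (f : A →ₗ[R] B) (r : R) (e : EE a n A i) :
    push (r • f) e = r • push f e := by
  have : ModuleCat.ofHom (r • f) = r • ModuleCat.ofHom f := rfl
  simp [push, this, Abelian.Ext.mk₀_smul]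

lemma push_id {n i : ℕ} (e : EE a n A i) : push LinearMap.id e = e := by
  have : ModuleCat.ofHom (LinearMap.id : A →ₗ[R] A) = 𝟙 _ := rfl
  simp [push, this]

lemma push_lsmul {n i : ℕ} (r : R) (e : EE a n A i) : push (r • LinearMap.id) e = r • e := by
  rw [smul_push, push_id]

lemma smul_eq_zero_of_mem {n i : ℕ} {x : R} (hx : x ∈ a ^ n) (e : EE a n A i) : x • e = 0 := by
  have h1 : (x • 𝟙 (Xn a n)) = 0 := by
    ext
    change x • (Submodule.Quotient.mk (1 : R) : R ⧸ a ^ n) = 0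
    rw [← Submodule.Quotient.mk_smul, Submodule.Quotient.mk_eq_zero]
    simpa using hx
  have h2 : (Abelian.Ext.mk₀ (x • 𝟙 (Xn a n))).comp e (zero_add i) = x • e := by
    rw [Abelian.Ext.mk₀_smul, Abelian.Ext.smul_comp, Abelian.Ext.mk₀_id_comp]
  rw [← h2, h1]
  simp

lemma dies_of_res {n m i : ℕ} {h : n ≤ m} {e : EE a n A i} (H : Dies a (res h e)) : Dies a e := by
  rw [dies_iff] at *
  obtain ⟨k, hk, h0⟩ := H
  exact ⟨k, h.trans hk, by rw [← res_res h hk, h0]⟩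

lemma dies_res {n m i : ℕ} {h : n ≤ m} {e : EE a n A i} (H : Dies a e) : Dies a (res h e) := by
  rw [dies_iff] at *
  obtain ⟨k, hk, h0⟩ := H
  refine ⟨max m k, le_max_left _ _, ?_⟩
  rw [res_res, ← res_res hk (le_max_right _ _), h0, res_zero]

lemma dies_push {n i : ℕ} {e : EE a n A i} (f : A →ₗ[R] B) (H : Dies a e) : Dies a (push f e) := by
  rw [dies_iff] at *
  obtain ⟨k, hk, h0⟩ := H
  exact ⟨k, hk, by rw [← push_res, h0, push_zero]⟩

lemma dies_smul {n i : ℕ} {e : EE a n A i} (r : R) (H : Dies a e) : Dies a (r • e) := by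
  rw [← push_lsmul]
  exact dies_push _ H

lemma dies_zero {n i : ℕ} : Dies a (0 : EE a n A i) :=
  ⟨n, le_rfl, by simp⟩

variable {f : A →ₗ[R] B} {g : B →ₗ[R] C}

/-- the short complex -/
abbrev sc (hfg : Function.Exact f g) : ShortComplex (ModuleCat.{0} R) :=
  ShortComplex.mk (ModuleCat.ofHom f) (ModuleCat.ofHom g)
    (by ext x; exact (hfg _).2 ⟨x, rfl⟩)

lemma sc_exact (hf : Function.Injective f) (hg : Function.Surjective g)
    (hfg : Function.Exact f g) : (sc hfg).ShortExact :=
  ModuleCat.shortComplex_shortExact _ hfg hf hg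

lemma ex2 (hf : Function.Injective f) (hg : Function.Surjective g) (hfg : Function.Exact f g)
    {n i : ℕ} (x : EE a n B i) (hx : push g x = 0) : ∃ y, push f y = x :=
  Abelian.Ext.covariant_sequence_exact₂ (Xn a n) (sc_exact hf hg hfg) x hx

/-- connecting map -/
noncomputable def del (hf : Function.Injective f) (hg : Function.Surjective g)
    (hfg : Function.Exact f g) {n i : ℕ} (x : EE a n C i) : EE a n A (i+1) :=
  x.comp (sc_exact hf hg hfg).extClass rfl

lemma ex1 (hf : Function.Injective f) (hg : Function.Surjective g) (hfg : Function.Exact f g)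
    {n i : ℕ} (x : EE a n A (i+1)) (hx : push f x = 0) : ∃ y, del hf hg hfg y = x :=
  Abelian.Ext.covariant_sequence_exact₁ (Xn a n) (sc_exact hf hg hfg) x hx rfl

lemma ex3 (hf : Function.Injective f) (hg : Function.Surjective g) (hfg : Function.Exact f g)
    {n i : ℕ} (x : EE a n C i) (hx : del hf hg hfg x = 0) : ∃ y, push g y = x :=
  Abelian.Ext.covariant_sequence_exact₃ (Xn a n) (sc_exact hf hg hfg) x rfl hx

lemma del_res (hf : Function.Injective f) (hg : Function.Surjective g) (hfg : Function.Exact f g)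
    {n m i : ℕ} (h : n ≤ m) (x : EE a n C i) :
    del hf hg hfg (res h x) = res h (del hf hg hfg x) := by
  unfold del res
  rw [Abelian.Ext.comp_assoc]
  omega

lemma del_zero (hf : Function.Injective f) (hg : Function.Surjective g) (hfg : Function.Exact f g)
    {n i : ℕ} : del hf hg hfg (0 : EE a n C i) = 0 := by
  simp [del]

lemma del_smul (hf : Function.Injective f) (hg : Function.Surjective g) (hfg : Function.Exact f g)
    {n i : ℕ} (r : R) (x : EE a n C i) : del hf hg hfg (r • x) = r • del hf hg hfg x := by
  simp [del]

lemma push_del (hf : Function.Injective f) (hg : Function.Surjective g) (hfg : Function.Exact f g)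
    {n i : ℕ} (x : EE a n C i) : push f (del hf hg hfg x) = 0 := by
  unfold del push
  rw [Abelian.Ext.comp_assoc_of_third_deg_zero, (sc_exact hf hg hfg).extClass_comp,
    Abelian.Ext.comp_zero]

lemma del_push (hf : Function.Injective f) (hg : Function.Surjective g) (hfg : Function.Exact f g)
    {n i : ℕ} (x : EE a n B i) : del hf hg hfg (push g x) = 0 := by
  unfold del push
  rw [Abelian.Ext.comp_assoc_of_second_deg_zero, (sc_exact hf hg hfg).comp_extClass,
    Abelian.Ext.comp_zero]

lemma dies_del (hf : Function.Injective f) (hg : Function.Surjective g) (hfg : Function.Exact f g)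
    {n i : ℕ} {x : EE a n C i} (H : Dies a x) : Dies a (del hf hg hfg x) := by
  rw [dies_iff] at *
  obtain ⟨k, hk, h0⟩ := H
  exact ⟨k, hk, by rw [← del_res, h0, del_zero]⟩

/-- vanishing of local cohomology -/
def VV (a : Ideal R) (i : ℕ) (N : Type) [AddCommGroup N] [Module R N] : Prop :=
  ∀ (n : ℕ) (e : EE a n N i), Dies a e

/-- killing of local cohomology -/
def Kill (a : Ideal R) (r : R) (i : ℕ) (N : Type) [AddCommGroup N] [Module R N] : Prop :=
  ∀ (n : ℕ) (e : EE a n N i), Dies a (r • e)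

lemma d2 (hf : Function.Injective f) (hg : Function.Surjective g) (hfg : Function.Exact f g)
    {n i : ℕ} {x : EE a n B i} (hx : Dies a (push g x)) :
    ∃ m, ∃ h : n ≤ m, ∃ y, push f y = res h x := by
  obtain ⟨m, h, h0⟩ := (dies_iff _).1 hx
  rw [← push_res] at h0
  exact ⟨m, h, ex2 hf hg hfg _ h0⟩

lemma d1 (hf : Function.Injective f) (hg : Function.Surjective g) (hfg : Function.Exact f g)
    {n i : ℕ} {x : EE a n A (i+1)} (hx : Dies a (push f x)) :
    ∃ m, ∃ h : n ≤ m, ∃ y, del hf hg hfg y = res h x := by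
  obtain ⟨m, h, h0⟩ := (dies_iff _).1 hx
  rw [← push_res] at h0
  exact ⟨m, h, ex1 hf hg hfg _ h0⟩

lemma d3 (hf : Function.Injective f) (hg : Function.Surjective g) (hfg : Function.Exact f g)
    {n i : ℕ} {x : EE a n C i} (hx : Dies a (del hf hg hfg x)) :
    ∃ m, ∃ h : n ≤ m, ∃ y, push g y = res h x := by
  obtain ⟨m, h, h0⟩ := (dies_iff _).1 hx
  rw [← del_res] at h0
  exact ⟨m, h, ex3 hf hg hfg _ h0⟩

lemma F1 (hf : Function.Injective f) (hg : Function.Surjective g) (hfg : Function.Exact f g)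
    {i : ℕ} (hA : VV a i A) (hC : VV a i C) : VV a i B := by
  intro n x
  obtain ⟨m, h, y, hy⟩ := d2 hf hg hfg (hC _ (push g x))
  have := dies_push f (hA _ y)
  rw [hy] at this
  exact dies_of_res this

lemma F2 (hf : Function.Injective f) (hg : Function.Surjective g) (hfg : Function.Exact f g)
    {i : ℕ} (hA : VV a (i+1) A) (hB : VV a i B) : VV a i C := by
  intro n x
  obtain ⟨m, h, y, hy⟩ := d3 hf hg hfg (hA _ (del hf hg hfg x))
  have := dies_push g (hB _ y)
  rw [hy] at this
  exact dies_of_res this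

/-- `Kill` passes to quotients -/
lemma F2k (hf : Function.Injective f) (hg : Function.Surjective g) (hfg : Function.Exact f g)
    {i : ℕ} {r : R} (hA : VV a (i+1) A) (hB : Kill a r i B) : Kill a r i C := by
  intro n x
  obtain ⟨m, h, y, hy⟩ := d3 hf hg hfg (hA _ (del hf hg hfg x))
  have := dies_push g (hB _ y)
  rw [push_smul, hy, ← res_smul] at this
  exact dies_of_res this

lemma F3 (hf : Function.Injective f) (hg : Function.Surjective g) (hfg : Function.Exact f g)
    {i : ℕ} (hC : VV a i C) (hB : VV a (i+1) B) : VV a (i+1) A := by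
  intro n x
  obtain ⟨m, h, y, hy⟩ := d1 hf hg hfg (hB _ (push f x))
  have := dies_del hf hg hfg (hC _ y)
  rw [hy] at this
  exact dies_of_res this

lemma F6 (φ : A ≃ₗ[R] B) {i : ℕ} (h : VV a i A) : VV a i B := by
  intro n e
  have := dies_push φ.toLinearMap (h _ (push φ.symm.toLinearMap e))
  rw [push_push] at this
  have h2 : φ.toLinearMap ∘ₗ φ.symm.toLinearMap = LinearMap.id := by ext; simp
  rwa [h2, push_id] at this

lemma F6k (φ : A ≃ₗ[R] B) {r : R} {i : ℕ} (h : Kill a r i A) : Kill a r i B := by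
  intro n e
  have := dies_push φ.toLinearMap (h _ (push φ.symm.toLinearMap e))
  rw [push_smul, push_push] at this
  have h2 : φ.toLinearMap ∘ₗ φ.symm.toLinearMap = LinearMap.id := by ext; simp
  rwa [h2, push_id] at this

lemma VV_subsingleton [Subsingleton A] (i : ℕ) : VV a i A := by
  intro n e
  rw [← push_id e, Subsingleton.elim (LinearMap.id : A →ₗ[R] A) 0, zero_push]
  exact dies_zero

lemma dies_of_smul {x : R} (hx : x ∈ a) {i : ℕ} (H : ∀ n (e : EE a n A i), Dies a (x • e) → Dies a e) :
    VV a i A := by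
  intro n e
  have : ∀ k, Dies a (x ^ k • e) → Dies a e := by
    intro k
    induction k with
    | zero => simp
    | succ k ih =>
      intro h
      rw [pow_succ', mul_smul] at h
      exact ih (H _ _ h)
  apply this n
  rw [smul_eq_zero_of_mem (Ideal.pow_mem_pow hx n)]
  exact dies_zero

lemma F4 {x : R} (hx : x ∈ a) (hf : Function.Injective (x • LinearMap.id : A →ₗ[R] A))
    {g : A →ₗ[R] C} (hg : Function.Surjective g)
    (hfg : Function.Exact (x • LinearMap.id : A →ₗ[R] A) g) {i : ℕ} (hC : VV a i C) :
    VV a (i+1) A := by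
  refine dies_of_smul hx fun n e he => ?_
  rw [← push_lsmul] at he
  obtain ⟨m, h, y, hy⟩ := d1 hf hg hfg he
  have := dies_del hf hg hfg (hC _ y)
  rw [hy] at this
  exact dies_of_res this

end Calc
end Stmt13

namespace Stmt13
section Torsion
variable {R : Type} [CommRing R] {a : Ideal R}
variable {A B C : Type} [AddCommGroup A] [Module R A] [AddCommGroup B] [Module R B]
  [AddCommGroup C] [Module R C]

/-- degree zero classes -/
noncomputable def e0 {n : ℕ} (φ : (R ⧸ a ^ n) →ₗ[R] A) : EE a n A 0 :=
  Abelian.Ext.mk₀ (ModuleCat.ofHom φ)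

lemma e0_surj {n : ℕ} (y : EE a n A 0) : ∃ φ : (R ⧸ a ^ n) →ₗ[R] A, y = e0 φ :=
  ⟨(Abelian.Ext.addEquiv₀ y).hom, (Abelian.Ext.mk₀_addEquiv₀_apply y).symm⟩

lemma push_e0 {n : ℕ} (f : A →ₗ[R] B) (φ : (R ⧸ a ^ n) →ₗ[R] A) : push f (e0 φ) = e0 (f ∘ₗ φ) :=
  Abelian.Ext.mk₀_comp_mk₀ _ _

lemma res_e0 {n m : ℕ} (h : n ≤ m) (φ : (R ⧸ a ^ n) →ₗ[R] A) :
    res h (e0 φ) = e0 (φ ∘ₗ (tr a h).hom) :=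
  Abelian.Ext.mk₀_comp_mk₀ _ _

lemma smul_e0 {n : ℕ} (r : R) (φ : (R ⧸ a ^ n) →ₗ[R] A) : r • e0 φ = e0 (r • φ) :=
  (Abelian.Ext.mk₀_smul r _).symm

lemma e0_zero {n : ℕ} : e0 (0 : (R ⧸ a ^ n) →ₗ[R] A) = 0 :=
  Abelian.Ext.mk₀_zero _ _

/-- the torsion submodule -/
def Gam (a : Ideal R) (A : Type) [AddCommGroup A] [Module R A] : Submodule R A where
  carrier := {x | ∃ k : ℕ, ∀ r ∈ a ^ k, r • x = 0}
  zero_mem' := ⟨0, by simp⟩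
  add_mem' := by
    rintro x y ⟨k, hk⟩ ⟨l, hl⟩
    refine ⟨max k l, fun r hr => ?_⟩
    rw [smul_add, hk r (Ideal.pow_le_pow_right (le_max_left _ _) hr),
      hl r (Ideal.pow_le_pow_right (le_max_right _ _) hr), add_zero]
  smul_mem' := by
    rintro c x ⟨k, hk⟩
    exact ⟨k, fun r hr => by rw [smul_comm, hk r hr, smul_zero]⟩

lemma mem_Gam {x : A} : x ∈ Gam a A ↔ ∃ k : ℕ, ∀ r ∈ a ^ k, r • x = 0 := Iff.rfl

lemma Gam_bound [IsNoetherianRing R] {N : Submodule R A} (hN : N.FG) (h : N ≤ Gam a A) :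
    ∃ k : ℕ, ∀ r ∈ a ^ k, ∀ x ∈ N, r • x = 0 := by
  induction N, hN using Submodule.fg_induction with
  | singleton x =>
    obtain ⟨k, hk⟩ := h (Submodule.mem_span_singleton_self x)
    refine ⟨k, fun r hr y hy => ?_⟩
    obtain ⟨c, rfl⟩ := Submodule.mem_span_singleton.1 hy
    rw [smul_comm, hk r hr, smul_zero]
  | sup N₁ N₂ _ _ h1 h2 =>
    obtain ⟨k, hk⟩ := h1 (le_sup_left.trans h)
    obtain ⟨l, hl⟩ := h2 (le_sup_right.trans h)
    refine ⟨max k l, fun r hr y hy => ?_⟩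
    obtain ⟨u, hu, v, hv, rfl⟩ := Submodule.mem_sup.1 hy
    rw [smul_add, hk r (Ideal.pow_le_pow_right (le_max_left _ _) hr) u hu,
      hl r (Ideal.pow_le_pow_right (le_max_right _ _) hr) v hv, add_zero]

lemma Gam_injective [IsNoetherianRing R] [Module.Injective R A] :
    Module.Injective R (Gam a A) := by
  apply Module.Baer.injective
  intro I g
  obtain ⟨k, hk⟩ := Gam_bound (a := a) (N := LinearMap.range ((Gam a A).subtype ∘ₗ g))
    (by
      have : Module.Finite R I := inferInstance
      rw [← Submodule.map_top]
      exact Module.Finite.fg_top.map _) (by rintro _ ⟨x, rfl⟩; exact (g x).2)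
  obtain ⟨c, hc⟩ := Ideal.exists_pow_inf_eq_pow_smul a (M := R) I
  have hker : ∀ x : I, (x : R) ∈ a ^ (c + k) → g x = 0 := by
    intro x hx
    have h1 : (x : R) ∈ a ^ (c + k - c) • (a ^ c • ⊤ ⊓ I) := by
      rw [← hc (c + k) (by simp)]
      exact ⟨by simpa using hx, x.2⟩
    rw [Nat.add_sub_cancel_left] at h1
    have h2 : (x : R) ∈ (a ^ k • (⊤ : Submodule R I)).map I.subtype := by
      rw [Submodule.map_smul'', Submodule.map_subtype_top]
      exact Submodule.smul_mono le_rfl inf_le_right h1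
    obtain ⟨y, hy, hxy⟩ := h2
    have : y = x := Subtype.ext hxy
    subst this
    have h3 : g y ∈ a ^ k • LinearMap.range g := by
      have := Submodule.mem_map_of_mem (f := g) hy
      rwa [Submodule.map_smul'', Submodule.map_top] at this
    refine Submodule.smul_induction_on (p := fun z => z = 0) h3 ?_ ?_
    · rintro r hr _ ⟨z, rfl⟩
      exact Subtype.ext (hk r hr _ ⟨z, rfl⟩)
    · rintro _ _ rfl rfl
      simp
  let q : I →ₗ[R] (R ⧸ a ^ (c + k)) := (a ^ (c + k)).mkQ ∘ₗ I.subtype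
  have hq : LinearMap.ker q ≤ LinearMap.ker ((Gam a A).subtype ∘ₗ g) := by
    intro x hx
    rw [LinearMap.mem_ker] at hx ⊢
    have : (x : R) ∈ a ^ (c + k) := by
      rw [← Submodule.Quotient.mk_eq_zero]
      exact hx
    simp [hker x this]
  obtain ⟨h, hh⟩ := Module.Injective.out ((LinearMap.ker q).liftQ q le_rfl)
    (LinearMap.ker_eq_bot.1 (Submodule.ker_liftQ_eq_bot _ _ _ le_rfl))
    ((LinearMap.ker q).liftQ ((Gam a A).subtype ∘ₗ g) hq)
  refine ⟨(h ∘ₗ (a ^ (c + k)).mkQ).codRestrict _ fun x => ⟨c + k, fun r hr => ?_⟩, fun x mem => ?_⟩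
  · rw [← map_smul]
    have : r • x ∈ a ^ (c + k) := Ideal.mul_mem_right _ _ hr
    have h0 : (a ^ (c + k)).mkQ (r • x) = 0 := by
      rwa [Submodule.mkQ_apply, Submodule.Quotient.mk_eq_zero]
    rw [LinearMap.comp_apply, h0, map_zero]
  · apply Subtype.ext
    exact hh (Submodule.Quotient.mk ⟨x, mem⟩)

lemma exists_torsion_hull [IsNoetherianRing R] (hA : Gam a A = ⊤) :
    ∃ (G : Type) (_ : AddCommGroup G) (_ : Module R G) (f : A →ₗ[R] G),
      Module.Injective R G ∧ Gam a G = ⊤ ∧ Function.Injective f := by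
  let E := Injective.under (ModuleCat.of R A)
  have : Module.Injective R E := Module.injective_iff_injective_object R E |>.2
    (inferInstanceAs (Injective (Injective.under (ModuleCat.of R A))))
  let ι : A →ₗ[R] E := (Injective.ι (ModuleCat.of R A)).hom
  have hι : Function.Injective ι :=
    (ModuleCat.mono_iff_injective (Injective.ι (ModuleCat.of R A))).1 inferInstance
  refine ⟨Gam a E, inferInstance, inferInstance, ι.codRestrict (Gam a E) fun x => ?_,
    Gam_injective, ?_, ?_⟩
  · have hx : x ∈ Gam a A := hA ▸ Submodule.mem_top
    obtain ⟨k, hk⟩ := hx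
    exact ⟨k, fun r hr => by rw [← map_smul, hk r hr, map_zero]⟩
  · rw [eq_top_iff]
    rintro ⟨x, k, hk⟩ -
    exact ⟨k, fun r hr => Subtype.ext (hk r hr)⟩
  · intro x y h
    exact hι (congrArg Subtype.val h)

lemma Gam_of_surj {g : B →ₗ[R] C} (hg : Function.Surjective g) (hB : Gam a B = ⊤) :
    Gam a C = ⊤ := by
  rw [eq_top_iff]
  intro x _
  obtain ⟨y, rfl⟩ := hg x
  have hy : y ∈ Gam a B := hB ▸ Submodule.mem_top
  obtain ⟨k, hk⟩ := hy
  exact ⟨k, fun r hr => by rw [← map_smul, hk r hr, map_zero]⟩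

lemma F5 [IsNoetherianRing R] (i : ℕ) : ∀ (A : Type) [AddCommGroup A] [Module R A],
    Gam a A = ⊤ → VV a (i+1) A := by
  induction i with
  | zero =>
    intro A _ _ hA n x
    obtain ⟨G, _, _, f, hGi, hG, hf⟩ := exists_torsion_hull hA
    have hg := (LinearMap.range f).mkQ_surjective
    have hfg : Function.Exact f (LinearMap.range f).mkQ := by
      rw [LinearMap.exact_iff, Submodule.ker_mkQ]
    have : Injective (ModuleCat.of R G) := (Module.injective_iff_injective_object R G).1 hGi
    obtain ⟨y, rfl⟩ := ex1 hf hg hfg x (Abelian.Ext.eq_zero_of_injective _)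
    obtain ⟨φ, rfl⟩ := e0_surj y
    obtain ⟨z, hz⟩ := hg (φ (Submodule.Quotient.mk 1))
    have hzG : z ∈ Gam a G := hG ▸ Submodule.mem_top
    obtain ⟨k, hk⟩ := hzG
    have hl : a ^ (max n k) ≤ LinearMap.ker (LinearMap.toSpanSingleton R G z) := by
      intro r hr
      rw [LinearMap.mem_ker, LinearMap.toSpanSingleton_apply]
      exact hk r (Ideal.pow_le_pow_right (le_max_right _ _) hr)
    let ψ : (R ⧸ a ^ (max n k)) →ₗ[R] G :=
      Submodule.liftQ _ (LinearMap.toSpanSingleton R G z) hl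
    rw [dies_iff]
    refine ⟨max n k, le_max_left _ _, ?_⟩
    have key : φ ∘ₗ (tr a (le_max_left n k)).hom = (LinearMap.range f).mkQ ∘ₗ ψ := by
      apply Submodule.linearMap_qext
      ext
      change φ (Submodule.Quotient.mk 1) = (LinearMap.range f).mkQ ((1 : R) • z)
      rw [one_smul, hz]
    rw [← del_res, res_e0, key, ← push_e0, del_push]
  | succ i ih =>
    intro A _ _ hA
    obtain ⟨G, _, _, f, hGi, hG, hf⟩ := exists_torsion_hull hA
    have hg := (LinearMap.range f).mkQ_surjective
    have hfg : Function.Exact f (LinearMap.range f).mkQ := by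
      rw [LinearMap.exact_iff, Submodule.ker_mkQ]
    have : Injective (ModuleCat.of R G) := (Module.injective_iff_injective_object R G).1 hGi
    refine F3 hf hg hfg (ih _ (Gam_of_surj hg hG)) ?_
    intro n e
    rw [Abelian.Ext.eq_zero_of_injective e]
    exact dies_zero

end Torsion
end Stmt13

namespace Stmt13
section Supp
variable {R : Type} [CommRing R] [IsNoetherianRing R] {a : Ideal R}

lemma F7 {i : ℕ} (N : Type) [AddCommGroup N] [Module R N] [hN : Module.Finite R N]
    (H : ∀ q ∈ Module.support R N, VV a i (R ⧸ q.asIdeal)) : VV a i N := by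
  revert H
  refine IsNoetherianRing.induction_on_isQuotientEquivQuotientPrime R hN
    (motive := fun N _ _ _ => (∀ q ∈ Module.support R N, VV a i (R ⧸ q.asIdeal)) → VV a i N)
    ?_ ?_ ?_
  · intro N _ _ _ _ _
    exact VV_subsingleton i
  · intro N _ _ _ p e H
    refine F6 e.symm (H p ?_)
    rw [Module.mem_support_iff_of_finite, e.annihilator_eq, Ideal.annihilator_quotient]
  · intro N₁ _ _ _ N₂ _ _ _ N₃ _ _ _ f g hf hg hfg h1 h3 H
    exact F1 hf hg hfg (h1 fun q hq => H q (Module.support_subset_of_injective f hf hq))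
      (h3 fun q hq => H q (Module.support_subset_of_surjective g hg hq))

lemma lt_of_mem_support_quot {p q : PrimeSpectrum R} {J : Submodule R (R ⧸ p.asIdeal)}
    (hJ : J ≠ ⊥) (hq : q ∈ Module.support R ((R ⧸ p.asIdeal) ⧸ J)) : p < q := by
  rw [Module.mem_support_iff_of_finite] at hq
  obtain ⟨z, hz, hz0⟩ := Submodule.exists_mem_ne_zero_of_ne_bot hJ
  obtain ⟨x, rfl⟩ := Submodule.Quotient.mk_surjective _ z
  have hxp : x ∉ p.asIdeal := fun h => hz0 ((Submodule.Quotient.mk_eq_zero _).2 h)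
  have hxq : x ∈ q.asIdeal := by
    apply hq
    rw [Module.mem_annihilator]
    intro m
    obtain ⟨m, rfl⟩ := Submodule.Quotient.mk_surjective _ m
    obtain ⟨m, rfl⟩ := Submodule.Quotient.mk_surjective _ m
    rw [← Submodule.Quotient.mk_smul, Submodule.Quotient.mk_eq_zero, ← Submodule.Quotient.mk_smul,
      smul_eq_mul, mul_comm, ← smul_eq_mul, Submodule.Quotient.mk_smul]
    exact J.smul_mem _ hz
  refine lt_of_le_of_ne ?_ ?_
  · intro y hy
    apply hq
    rw [Module.mem_annihilator]
    intro m
    obtain ⟨m, rfl⟩ := Submodule.Quotient.mk_surjective _ m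
    obtain ⟨m, rfl⟩ := Submodule.Quotient.mk_surjective _ m
    rw [← Submodule.Quotient.mk_smul, ← Submodule.Quotient.mk_smul]
    have : (Submodule.Quotient.mk (y • m) : R ⧸ p.asIdeal) = 0 := by
      rw [Submodule.Quotient.mk_eq_zero]
      exact Ideal.mul_mem_right _ _ hy
    rw [this, Submodule.Quotient.mk_zero]
  · rintro rfl
    exact hxp hxq

lemma S1 (n : ℕ) : ∀ p : PrimeSpectrum R, Order.coheight p < n → ∀ i ≥ n, VV a i (R ⧸ p.asIdeal) := by
  induction n with
  | zero => simp
  | succ n ih =>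
    intro p hp i hi
    obtain ⟨i, rfl⟩ : ∃ j, i = j + 1 := ⟨i - 1, by omega⟩
    by_cases hap : a ≤ p.asIdeal
    · apply F5
      rw [eq_top_iff]
      intro z _
      refine ⟨1, fun r hr => ?_⟩
      obtain ⟨m, rfl⟩ := Submodule.Quotient.mk_surjective _ z
      rw [← Submodule.Quotient.mk_smul, Submodule.Quotient.mk_eq_zero]
      exact Ideal.mul_mem_right _ _ (hap (by simpa using hr))
    · obtain ⟨x, hxa, hxp⟩ := Set.not_subset.1 hap
      set f : (R ⧸ p.asIdeal) →ₗ[R] (R ⧸ p.asIdeal) := x • LinearMap.id with hfdef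
      have hf : Function.Injective f := by
        rw [← LinearMap.ker_eq_bot, eq_bot_iff]
        intro z hz
        obtain ⟨m, rfl⟩ := Submodule.Quotient.mk_surjective _ z
        have hz : x • (Submodule.Quotient.mk m : R ⧸ p.asIdeal) = 0 := hz
        rw [← Submodule.Quotient.mk_smul, Submodule.Quotient.mk_eq_zero] at hz
        refine (Submodule.Quotient.mk_eq_zero _).2 ?_
        exact (p.isPrime.mem_or_mem hz).resolve_left hxp
      refine F4 hxa hf (LinearMap.range f).mkQ_surjective
        (by rw [LinearMap.exact_iff, Submodule.ker_mkQ]) (F7 _ fun q hq => ?_)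
      have hlt : p < q := by
        refine lt_of_mem_support_quot ?_ hq
        intro h0
        have h1 : f (Submodule.Quotient.mk 1) = 0 := by
          have : f (Submodule.Quotient.mk 1) ∈ LinearMap.range f := ⟨_, rfl⟩
          rw [h0] at this
          exact this
        apply hxp
        have h1 : x • (Submodule.Quotient.mk 1 : R ⧸ p.asIdeal) = 0 := h1
        rw [← Submodule.Quotient.mk_smul, Submodule.Quotient.mk_eq_zero] at h1
        simpa using h1
      refine ih q ?_ i (by omega)
      have := (Order.coheight_add_one_le hlt).trans_lt hp
      push_cast at this
      exact lt_of_add_lt_add_right this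

lemma coheight_bound [IsLocalRing R] : ∃ D : ℕ, ∀ p : PrimeSpectrum R, Order.coheight p < D := by
  obtain ⟨D, hD⟩ : ∃ D : ℕ, ringKrullDim R < D := by
    have h := ringKrullDim_lt_top (R := R)
    have h2 := ringKrullDim_ne_bot (R := R)
    obtain ⟨d, hd⟩ := WithBot.ne_bot_iff_exists.1 h2
    rw [← hd] at h ⊢
    have : d ≠ ⊤ := by rintro rfl; exact absurd h (lt_irrefl _)
    obtain ⟨k, rfl⟩ := ENat.ne_top_iff_exists.1 this
    exact ⟨k + 1, by exact_mod_cast Nat.lt_succ_self k⟩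
  refine ⟨D, fun p => ?_⟩
  have := (Order.coheight_le_krullDim p).trans_lt hD
  exact_mod_cast this

lemma exists_hom {M : Type} [AddCommGroup M] [Module R M] [Module.Finite R M]
    {p : PrimeSpectrum R} (hp : p ∈ Module.support R M) : ∃ g : M →ₗ[R] (R ⧸ p.asIdeal), g ≠ 0 := by
  rw [Module.mem_support_iff_nontrivial_residueField_tensorProduct] at hp
  let κ := p.asIdeal.ResidueField
  obtain ⟨v, hv⟩ := exists_ne (0 : TensorProduct R κ M)
  have h1 : ∃ φ : Module.Dual κ (TensorProduct R κ M), φ v ≠ 0 := by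
    by_contra! h
    exact hv ((Module.forall_dual_apply_eq_zero_iff κ v).1 h)
  obtain ⟨φ, hφ⟩ := h1
  let l : M →ₗ[R] κ := (φ.restrictScalars R) ∘ₗ (TensorProduct.mk R κ M 1)
  have hl : l ≠ 0 := by
    intro h0
    apply hφ
    clear hφ hv
    induction v using TensorProduct.induction_on with
    | zero => simp
    | tmul c m =>
      have : φ (1 ⊗ₜ[R] m) = 0 := LinearMap.congr_fun h0 m
      have h2 : c ⊗ₜ[R] m = c • ((1 : κ) ⊗ₜ[R] m) := by simp [TensorProduct.smul_tmul']
      rw [h2, map_smul, this, smul_zero]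
    | add x y hx hy => rw [map_add, hx, hy, add_zero]
  obtain ⟨s, hs⟩ := Module.Finite.fg_top (R := R) (M := M)
  classical
  obtain ⟨b, hb⟩ := IsLocalization.exist_integer_multiples_of_finset
    (nonZeroDivisors (R ⧸ p.asIdeal)) (s.image l)
  let ι : (R ⧸ p.asIdeal) →ₗ[R] κ := (IsScalarTower.toAlgHom R (R ⧸ p.asIdeal) κ).toLinearMap
  have hι : Function.Injective ι := IsFractionRing.injective (R ⧸ p.asIdeal) κ
  obtain ⟨c, hc⟩ := Ideal.Quotient.mk_surjective (b : R ⧸ p.asIdeal)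
  let l' : M →ₗ[R] κ := c • l
  have hl' : ∀ m, l' m = (b : R ⧸ p.asIdeal) • l m := by
    intro m
    change c • l m = _
    rw [← hc]
    exact (algebraMap_smul (R ⧸ p.asIdeal) c (l m)).symm
  have hr : ∀ m, l' m ∈ LinearMap.range ι := by
    intro m
    have : (⊤ : Submodule R M) ≤ (LinearMap.range ι).comap l' := by
      rw [← hs, Submodule.span_le]
      intro x hx
      obtain ⟨y, hy⟩ := hb (l x) (Finset.mem_image_of_mem _ hx)
      exact ⟨y, hy.trans (hl' x).symm⟩
    exact this trivial
  refine ⟨(LinearEquiv.ofInjective ι hι).symm.toLinearMap ∘ₗ l'.codRestrict _ hr, fun h0 => hl ?_⟩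
  ext m
  have h2 := LinearMap.congr_fun h0 m
  have h3 : l'.codRestrict _ hr m = 0 := by simpa using h2
  have h4 : l' m = 0 := congrArg Subtype.val h3
  rw [hl', Algebra.smul_def, mul_eq_zero] at h4
  refine h4.resolve_left fun h5 => ?_
  have := hι (h5.trans (map_zero ι).symm)
  exact nonZeroDivisors.ne_zero b.2 this

lemma S3 [IsLocalRing R] {M : Type} [AddCommGroup M] [Module R M] [Module.Finite R M]
    (hM : ∀ i ≥ 2, VV a i M) {i : ℕ} (hi : 2 ≤ i) (N : Type) [AddCommGroup N] [Module R N]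
    [Module.Finite R N] (hN : Module.support R N ⊆ Module.support R M) : VV a i N := by
  obtain ⟨D, hD⟩ := coheight_bound (R := R)
  have main : ∀ j i : ℕ, 2 ≤ i → D ≤ i + j → ∀ p ∈ Module.support R M, VV a i (R ⧸ p.asIdeal) := by
    intro j
    induction j with
    | zero =>
      intro i _ hi p _
      exact S1 D p (hD p) i hi
    | succ j ihj =>
      intro i hi hij
      have hs : ∀ (K : Type) [AddCommGroup K] [Module R K] [Module.Finite R K],
          Module.support R K ⊆ Module.support R M → VV a (i+1) K := fun K _ _ _ hK =>
        F7 K fun q hq => ihj (i+1) (by omega) (by omega) q (hK hq)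
      have : ∀ n : ℕ, ∀ p : PrimeSpectrum R, Order.coheight p < n → p ∈ Module.support R M →
          VV a i (R ⧸ p.asIdeal) := by
        intro n
        induction n with
        | zero => simp
        | succ n ih =>
          intro p hpn hp
          obtain ⟨g, hg⟩ := exists_hom hp
          have hJ : VV a i (LinearMap.range g) := by
            refine F2 (f := (LinearMap.ker g).subtype) (g := g.rangeRestrict)
              (LinearMap.ker g).injective_subtype g.surjective_rangeRestrict ?_ (hs _ ?_) (hM i hi)
            · rw [LinearMap.exact_iff, LinearMap.ker_rangeRestrict, Submodule.range_subtype]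
            · exact Module.support_subset_of_injective _ (LinearMap.ker g).injective_subtype
          refine F1 (f := (LinearMap.range g).subtype) (g := (LinearMap.range g).mkQ)
            (Submodule.injective_subtype _) (Submodule.mkQ_surjective _) ?_ hJ ?_
          · rw [LinearMap.exact_iff, Submodule.ker_mkQ, Submodule.range_subtype]
          · refine F7 _ fun q hq => ?_
            have hlt : p < q := lt_of_mem_support_quot (by rwa [Ne, LinearMap.range_eq_bot]) hq
            refine ih q ?_ ?_
            · have := (Order.coheight_add_one_le hlt).trans_lt hpn
              push_cast at this
              exact lt_of_add_lt_add_right this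
            · rw [Module.mem_support_iff_of_finite] at hp ⊢
              exact hp.trans hlt.le
      exact fun p hp => this D p (hD p) hp
  exact F7 N fun q hq => main D i hi (by omega) q (hN hq)

end Supp
end Stmt13

namespace Stmt13
section Final
variable {R : Type} [CommRing R] {a : Ideal R}

/-- the image of multiplication by `c` -/
abbrev img (c : R) (M : Type) [AddCommGroup M] [Module R M] : Submodule R M :=
  LinearMap.range (c • LinearMap.id : M →ₗ[R] M)

lemma lemA {M : Type} [AddCommGroup M] [Module R M] {c : R} (hc : Kill a c 1 M)
    (hK : VV a 2 (LinearMap.ker (c • LinearMap.id : M →ₗ[R] M))) {n : ℕ}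
    (x : EE a n (img c M) 1) : Dies a (push (img c M).subtype x) := by
  set μ : M →ₗ[R] M := c • LinearMap.id with hμ
  have hf := (LinearMap.ker μ).injective_subtype
  have hg := μ.surjective_rangeRestrict
  have hfg : Function.Exact (LinearMap.ker μ).subtype μ.rangeRestrict := by
    rw [LinearMap.exact_iff, LinearMap.ker_rangeRestrict, Submodule.range_subtype]
  obtain ⟨m, h, y, hy⟩ := d3 hf hg hfg (hK _ (del hf hg hfg x))
  have h1 : push (img c M).subtype (push μ.rangeRestrict y) = c • y := by
    rw [push_push, ← push_lsmul]
    rfl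
  have h2 := hc _ y
  rw [← h1, hy, push_res] at h2
  exact dies_of_res h2

lemma sub_exact {M : Type} [AddCommGroup M] [Module R M] (N : Submodule R M) :
    Function.Exact N.subtype N.mkQ := by
  rw [LinearMap.exact_iff, Submodule.ker_mkQ, Submodule.range_subtype]

variable [IsNoetherianRing R]

lemma kill_img {M : Type} [AddCommGroup M] [Module R M] [Module.Finite R M] {r : R}
    (hc : Kill a r 1 M) (hK : VV a 2 (LinearMap.ker (r • LinearMap.id : M →ₗ[R] M))) :
    ∃ k : ℕ, ∀ c ∈ a ^ k, Kill a c 1 (img r M) := by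
  obtain ⟨k, hk⟩ := Gam_bound (a := a) (N := Gam a (M ⧸ img r M)) (IsNoetherian.noetherian _) le_rfl
  refine ⟨k, fun c hca n x => ?_⟩
  obtain ⟨m, h, y, hy⟩ := d1 (Submodule.injective_subtype _) (Submodule.mkQ_surjective _)
    (sub_exact _) (lemA hc hK x)
  obtain ⟨φ, rfl⟩ := e0_surj y
  have h0 : c • φ = 0 := by
    ext
    refine hk c hca _ ⟨m, fun s hs => ?_⟩
    rw [← map_smul]
    have : s • (Submodule.Quotient.mk 1 : R ⧸ a ^ m) = 0 := by
      rw [← Submodule.Quotient.mk_smul, Submodule.Quotient.mk_eq_zero]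
      simpa using hs
    exact (congrArg φ this).trans (map_zero φ)
  refine dies_of_res (h := h) ?_
  rw [res_smul, ← hy, ← del_smul, smul_e0, h0, e0_zero, del_zero]
  exact dies_zero

lemma S5 {N : Type} [AddCommGroup N] [Module R N] [Module.Finite R N]
    (hV : ∀ (K : Type) [AddCommGroup K] [Module R K] [Module.Finite R K],
      Module.support R K ⊆ Module.support R N → VV a 2 K)
    {k : ℕ} (hk : ∀ c ∈ a ^ k, Kill a c 1 N) : VV a 1 N := by
  have main : ∀ (L : Submodule R N) (Q : Type) [AddCommGroup Q] [Module R Q] (π : N →ₗ[R] Q),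
      Function.Surjective π → LinearMap.ker π = L → VV a 1 Q := by
    intro L
    induction L using WellFoundedGT.induction with
    | ind L ih =>
    intro Q _ _ π hπ hL
    have hfin : Module.Finite R Q := Module.Finite.of_surjective π hπ
    have hkQ : ∀ c ∈ a ^ k, Kill a c 1 Q := by
      intro c hc
      refine F2k (f := (LinearMap.ker π).subtype) (g := π) (Submodule.injective_subtype _) hπ ?_
        (hV _ ?_) (hk c hc)
      · rw [LinearMap.exact_iff, Submodule.range_subtype]
      · exact Module.support_subset_of_injective _ (Submodule.injective_subtype _)
    by_cases hx : ∀ x ∈ a, x ^ k ∈ Module.annihilator R Q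
    · obtain ⟨l, hl⟩ := Ideal.exists_pow_le_of_le_radical_of_fg
        (I := a) (J := Module.annihilator R Q) (fun x hxa => ⟨k, hx x hxa⟩)
        (IsNoetherian.noetherian a)
      apply F5
      rw [eq_top_iff]
      intro z _
      exact ⟨l, fun r hr => Module.mem_annihilator.1 (hl hr) z⟩
    · push Not at hx
      obtain ⟨x, hxa, hx⟩ := hx
      have hQP : VV a 1 (Q ⧸ img (x ^ k) Q) := by
        refine ih (LinearMap.ker ((img (x ^ k) Q).mkQ ∘ₗ π)) ?_ _ ((img (x ^ k) Q).mkQ ∘ₗ π)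
          ((Submodule.mkQ_surjective _).comp hπ) rfl
        rw [← hL]
        refine lt_of_le_of_ne (LinearMap.ker_le_ker_comp _ _) fun heq => hx ?_
        rw [Module.mem_annihilator]
        intro z
        obtain ⟨y, hy⟩ := hπ (x ^ k • z)
        have h1 : y ∈ LinearMap.ker ((img (x ^ k) Q).mkQ ∘ₗ π) := by
          rw [LinearMap.mem_ker, LinearMap.comp_apply, hy, Submodule.mkQ_apply,
            Submodule.Quotient.mk_eq_zero]
          exact ⟨z, rfl⟩
        rw [← heq, LinearMap.mem_ker, hy] at h1
        exact h1
      intro n e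
      obtain ⟨m, h, y, hy⟩ := d2 (Submodule.injective_subtype _) (Submodule.mkQ_surjective _)
        (sub_exact _) (hQP _ (push (img (x ^ k) Q).mkQ e))
      have hd := lemA (hkQ _ (Ideal.pow_mem_pow hxa k)) (hV _ ?_) y
      · rw [hy] at hd
        exact dies_of_res hd
      · exact (Module.support_subset_of_injective _ (Submodule.injective_subtype _)).trans
          (Module.support_subset_of_surjective π hπ)
  exact main _ N LinearMap.id Function.surjective_id rfl

lemma LC_iff (N : Type) [AddCommGroup N] [Module R N] (i : ℕ) :
    Subsingleton ((localCohomology a (i+1)).obj (ModuleCat.of R N)) ↔ VV a (i+1) N :=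
  bridge_sub a (ModuleCat.of R N) i

theorem final [IsLocalRing R] (M : Type) [AddCommGroup M] [Module R M] [Module.Finite R M]
    (hcd : ∀ i, 1 < i → Subsingleton ((localCohomology a i).obj (ModuleCat.of R M)))
    (T : Submodule R M)
    (hT : IsGreatest {N : Submodule R M |
      ∀ i, 1 ≤ i → Subsingleton ((localCohomology a i).obj (ModuleCat.of R N))} T) :
    Module.annihilator R ((localCohomology a 1).obj (ModuleCat.of R M)) =
      Module.annihilator R (M ⧸ T) := by
  have hM : ∀ i ≥ 2, VV a i M := by
    intro i hi
    obtain ⟨i, rfl⟩ : ∃ j, i = j + 1 := ⟨i - 1, by omega⟩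
    exact (LC_iff M i).1 (hcd _ (by omega))
  have hV : ∀ i ≥ 2, ∀ (K : Type) [AddCommGroup K] [Module R K] [Module.Finite R K],
      Module.support R K ⊆ Module.support R M → VV a i K := fun i hi K _ _ _ hK => S3 hM hi K hK
  ext r
  have hb : r ∈ Module.annihilator R ((localCohomology a 1).obj (ModuleCat.of R M)) ↔
      Kill a r 1 M := bridge a (ModuleCat.of R M) 0 r
  rw [hb]
  have hsub : ∀ N : Submodule R M, Module.support R N ⊆ Module.support R M := fun N =>
    Module.support_subset_of_injective _ N.injective_subtype
  constructor
  · intro hr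
    have hle : img r M ≤ T := by
      apply hT.2
      intro i hi
      obtain ⟨i, rfl⟩ : ∃ j, i = j + 1 := ⟨i - 1, by omega⟩
      rw [LC_iff]
      rcases Nat.eq_zero_or_pos i with rfl | hi0
      · obtain ⟨k, hk⟩ := kill_img hr (hV 2 le_rfl _ (hsub _))
        exact S5 (fun K _ _ _ hK => hV 2 le_rfl K (hK.trans (hsub _))) hk
      · exact hV _ (by omega) _ (hsub _)
    rw [Module.mem_annihilator]
    intro z
    obtain ⟨z, rfl⟩ := Submodule.Quotient.mk_surjective _ z
    rw [← Submodule.Quotient.mk_smul, Submodule.Quotient.mk_eq_zero]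
    exact hle ⟨z, rfl⟩
  · intro hr n e
    have hm : ∀ z, (r • LinearMap.id : M →ₗ[R] M) z ∈ T := by
      intro z
      have := Module.mem_annihilator.1 hr (Submodule.Quotient.mk z)
      rwa [← Submodule.Quotient.mk_smul, Submodule.Quotient.mk_eq_zero] at this
    have hT1 : VV a 1 T := (LC_iff T 0).1 (hT.1 1 le_rfl)
    have := dies_push T.subtype (hT1 _ (push (LinearMap.codRestrict T _ hm) e))
    rwa [push_push, LinearMap.subtype_comp_codRestrict, push_lsmul] at this

end Final
end Stmt13

end

theorem stmt13 {R : Type} [CommRing R] [IsNoetherianRing R] [IsLocalRing R]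
    (a : Ideal R) (M : ModuleCat R) [Module.Finite R M] (hM : Nontrivial M)
    (hcd : HasCD a M 1)
    (T : Submodule R M)
    (hT : IsGreatest {N : Submodule R M |
      ∀ i, 1 ≤ i → Subsingleton ((localCohomology a i).obj (ModuleCat.of R N))} T) :
    Module.annihilator R ((localCohomology a 1).obj M) =
      Module.annihilator R (M ⧸ T) :=
  Stmt13.final M hcd.2 T hT
end

section
/- Let (R, 𝔪) be a Noetherian local ring, 𝔞 an ideal, and M a relative Cohen-Macaulay R-module with respect to 𝔞 with cd(𝔞, M) = c. Then Ass_R(R/Ann_R M) ⊆ { 𝔭 ∈ Ass_R(M) : cd(𝔞, R/𝔭) = c }. -/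
open CategoryTheory

section
open CategoryTheory
set_option maxHeartbeats 1000000

noncomputable section
namespace LCB
variable {R : Type} [CommRing R]

/-- the map of Hom complexes induced by a chain map -/
def yMap {P P' : ChainComplex (ModuleCat.{0} R) ℕ} (φ : P' ⟶ P) (Y : ModuleCat.{0} R) :
    P.linearYonedaObj R Y ⟶ P'.linearYonedaObj R Y :=
  (HomologicalComplex.unopFunctor (ModuleCat.{0} R) (ComplexShape.down ℕ)).map
    ((((linearYoneda R (ModuleCat.{0} R)).obj Y).rightOp.mapHomologicalComplex _).map φ).op

lemma yMap_f {P P' : ChainComplex (ModuleCat.{0} R) ℕ} (φ : P' ⟶ P) (Y : ModuleCat.{0} R) (n : ℕ)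
    (f : P.X n ⟶ Y) : ((yMap φ Y).f n).hom f = (φ.f n ≫ f : P'.X n ⟶ Y) := rfl

lemma aux_comp {C : Type*} [Category C] {A B D A' B' D' : C} (u : A ⟶ B) (v : B ⟶ D) (w : D ⟶ D')
    (m : B ⟶ B') (v' : B' ⟶ D') (k : A ⟶ A') (u' : A' ⟶ B')
    (h1 : v ≫ w = m ≫ v') (h2 : u ≫ m = k ≫ u') : (u ≫ v) ≫ w = k ≫ (u' ≫ v') := by
  rw [Category.assoc, h1, ← Category.assoc, h2, Category.assoc]

lemma isoExt_nat {X X' : ModuleCat.{0} R} (g : X' ⟶ X) (Y : ModuleCat.{0} R) (n : ℕ)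
    (P : ProjectiveResolution X) (P' : ProjectiveResolution X') (φ : P'.complex ⟶ P.complex)
    (comm : φ.f 0 ≫ P.π.f 0 = P'.π.f 0 ≫ g) :
    (P.isoExt (R := R) n Y).inv ≫ ((Ext R (ModuleCat.{0} R) n).map g.op).app Y =
      HomologicalComplex.homologyMap (yMap φ Y) n ≫ (P'.isoExt (R := R) n Y).inv := by
  have h1 := ProjectiveResolution.isoLeftDerivedObj_hom_naturality g P' P φ comm
    ((linearYoneda R (ModuleCat.{0} R)).obj Y).rightOp n
  have h2 := HomologicalComplex.homologyOp_hom_naturality (yMap φ Y) n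
  have h1' := congrArg Quiver.Hom.unop h1
  have h2' := congrArg Quiver.Hom.unop h2
  exact aux_comp _ _ _ _ _ _ _ h1' h2'

lemma exists_hom {X X' : ModuleCat.{0} R} (g : X' ⟶ X) 
    (P : ProjectiveResolution X) (P' : ProjectiveResolution X') :
    Nonempty (ProjectiveResolution.Hom P' P g) := 
  ⟨⟨ProjectiveResolution.lift g P' P, by
    have := ProjectiveResolution.lift_commutes g P' P
    exact congrArg (fun f => HomologicalComplex.Hom.f f 0) this⟩⟩

/-- `f` is a cocycle representing `u` -/
def Rep {X Y : ModuleCat.{0} R} {n : ℕ} (P : ProjectiveResolution X) (f : P.complex.X n ⟶ Y)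
    (u : ((Ext R (ModuleCat.{0} R) n).obj (Opposite.op X)).obj Y) : Prop :=
  ∃ z : (P.complex.linearYonedaObj R Y).cycles n, 
    ((P.complex.linearYonedaObj R Y).iCycles n).hom z = f ∧
    (P.isoExt (R := R) n Y).inv.hom (((P.complex.linearYonedaObj R Y).homologyπ n).hom z) = u

lemma Rep.cocycle {X Y : ModuleCat.{0} R} {n : ℕ} {P : ProjectiveResolution X} 
    {f : P.complex.X n ⟶ Y} {u} (h : Rep P f u) : P.complex.d (n+1) n ≫ f = 0 := by
  obtain ⟨z, rfl, -⟩ := h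
  have := (P.complex.linearYonedaObj R Y).iCycles_d n (n+1)
  have := congrArg (fun t => t.hom z) this
  exact this

lemma exists_rep {X Y : ModuleCat.{0} R} {n : ℕ} (P : ProjectiveResolution X) (u) :
   ∃ f : P.complex.X n ⟶ Y, Rep P f u := by
  have hs : Function.Surjective ((P.complex.linearYonedaObj R Y).homologyπ n).hom := 
    (ModuleCat.epi_iff_surjective _).1 inferInstance
  obtain ⟨z, hz⟩ := hs ((P.isoExt (R := R) n Y).hom.hom u)
  refine ⟨_, z, rfl, ?_⟩
  rw [hz]
  simp 

lemma exists_rep' {X Y : ModuleCat.{0} R} {n : ℕ} (P : ProjectiveResolution X) 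
   (f : P.complex.X n ⟶ Y) (hf : P.complex.d (n+1) n ≫ f = 0) : ∃ u, Rep P f u := by
  let K := P.complex.linearYonedaObj R Y
  have hz : ∃ z : K.cycles n, (K.iCycles n).hom z = f := by
    have hex := ShortComplex.exact_of_f_is_kernel (ShortComplex.mk _ _ (K.iCycles_d n (n+1))) 
      (K.cyclesIsKernel n (n+1) (by simp))
    rw [ShortComplex.moduleCat_exact_iff] at hex
    exact hex f hf
  obtain ⟨z, hz⟩ := hz
  exact ⟨_, z, hz, rfl⟩ 

lemma extMk_zero_iff0 {X Y : ModuleCat.{0} R} (P : ProjectiveResolution X) 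
   (f : P.complex.X 0 ⟶ Y) (hf : P.complex.d 1 0 ≫ f = 0) : 
   P.extMk f 1 rfl hf = 0 ↔ f = 0 := by
  constructor
  · intro h
    simp only [← P.extEquivCohomologyClass.apply_eq_iff_eq,
      ProjectiveResolution.extEquivCohomologyClass_extMk, 
      ProjectiveResolution.extEquivCohomologyClass_zero,
      CochainComplex.HomComplex.CohomologyClass.mk_eq_zero_iff] at h
    rw [CochainComplex.HomComplex.Cocycle.toSingleMk_mem_coboundaries_iff _ _ _ _ _ 1 (by simp)] at h
    obtain ⟨g, hg⟩ := h
    have h0 : P.cochainComplex.d (-((0:ℕ):ℤ)) 1 = 0 := by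
      apply Limits.IsZero.eq_of_tgt
      exact P.cochainComplex.isZero_of_isStrictlyLE 0 1 (by simp)
    rw [h0, Limits.zero_comp] at hg
    rw [← cancel_epi (P.cochainComplexXIso (-((0:ℕ):ℤ)) 0 rfl).hom, ← hg, Limits.comp_zero]
  · rintro rfl; simp

lemma rep_zero_iff {X Y : ModuleCat.{0} R} {n : ℕ} {P : ProjectiveResolution X} 
    {f : P.complex.X n ⟶ Y} {u} (h : Rep P f u) : 
    u = 0 ↔ P.extMk f (n+1) rfl h.cocycle = 0 := by
  have hc := h.cocycle
  obtain ⟨z, hz, hu⟩ := h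
  let K := P.complex.linearYonedaObj R Y
  have h1 : u = 0 ↔ (K.homologyπ n).hom z = 0 := by
    rw [← hu]
    have hinj : Function.Injective (P.isoExt (R := R) n Y).inv.hom := 
      (ModuleCat.mono_iff_injective _).1 inferInstance
    exact map_eq_zero_iff _ hinj
  have iinj : Function.Injective (K.iCycles n).hom := 
      (ModuleCat.mono_iff_injective _).1 inferInstance
  rw [h1]
  cases n with
  | zero => 
    rw [extMk_zero_iff0]
    have hex := ShortComplex.exact_of_g_is_cokernel (ShortComplex.mk _ _ (K.toCycles_comp_homologyπ 0 0)) 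
      (K.homologyIsCokernel 0 0 (by simp))
    rw [ShortComplex.moduleCat_exact_iff] at hex
    constructor
    · intro h
      obtain ⟨w, hw⟩ := hex z h
      have h0 : K.toCycles 0 0 = 0 := by
        rw [← cancel_mono (K.iCycles 0), K.toCycles_i, Limits.zero_comp]
        exact K.shape _ _ (by simp)
      change (K.toCycles 0 0).hom w = z at hw
      rw [h0] at hw
      rw [← hz, ← hw]; 
      exact map_zero _
    · intro h
      have : z = 0 := by
        apply iinj
        rw [map_zero]; exact hz.trans h
      rw [this]; exact map_zero _
  | succ m =>
    rw [P.extMk_eq_zero_iff _ _ _ _ m rfl]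
    have hex := ShortComplex.exact_of_g_is_cokernel (ShortComplex.mk _ _ (K.toCycles_comp_homologyπ m (m+1))) 
      (K.homologyIsCokernel m (m+1) (by simp))
    rw [ShortComplex.moduleCat_exact_iff] at hex
    have key : ∀ w : (P.complex.X m ⟶ Y), (K.iCycles (m+1)).hom ((K.toCycles m (m+1)).hom w) = P.complex.d (m+1) m ≫ w := by
      intro w
      exact congrArg (fun t => t.hom w) (K.toCycles_i m (m+1))
    constructor
    · intro h
      obtain ⟨w, hw⟩ := hex z h
      refine ⟨w, ?_⟩
      exact (key w).symm.trans ((congrArg _ hw).trans hz)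
    · rintro ⟨w, hw⟩
      have : z = (K.toCycles m (m+1)).hom w := by
        apply iinj
        rw [key]; exact hz.trans hw.symm
      rw [this]
      exact congrArg (fun t => t.hom w) (K.toCycles_comp_homologyπ m (m+1))

lemma Rep.map {X X' Y : ModuleCat.{0} R} {n : ℕ} {P : ProjectiveResolution X} 
    {f : P.complex.X n ⟶ Y} {u} (h : Rep P f u) (g : X' ⟶ X) (P' : ProjectiveResolution X')
    (φ : ProjectiveResolution.Hom P' P g) :
    Rep P' (φ.hom.f n ≫ f) ((((Ext R (ModuleCat.{0} R) n).map g.op).app Y).hom u) := by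
  obtain ⟨z, rfl, rfl⟩ := h
  have comm : φ.hom.f 0 ≫ P.π.f 0 = P'.π.f 0 ≫ g := φ.hom_f_zero_comp_π_f_zero
  refine ⟨(HomologicalComplex.cyclesMap (yMap φ.hom Y) n).hom z, ?_, ?_⟩
  · have := congrArg (fun t => t.hom z) (HomologicalComplex.cyclesMap_i (yMap φ.hom Y) n)
    exact this
  · have h1 := congrArg (fun t => t.hom z) (HomologicalComplex.homologyπ_naturality (yMap φ.hom Y) n)
    have h2 := congrArg (fun t => t.hom (((P.complex.linearYonedaObj R Y).homologyπ n).hom z)) 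
      (isoExt_nat g Y n P P' φ.hom comm)
    refine Eq.trans ?_ h2.symm
    exact congrArg _ h1.symm

/-- transition map -/
def tr (a : Ideal R) {s t : ℕ} (h : t ≤ s) : ModuleCat.of R (R ⧸ a ^ s) ⟶ ModuleCat.of R (R ⧸ a ^ t) :=
  ModuleCat.ofHom (Submodule.mapQ _ _ LinearMap.id (Ideal.pow_le_pow_right h))

/-- vanishing of local cohomology in terms of `Abelian.Ext` -/
def V (a : Ideal R) (i : ℕ) (N : ModuleCat.{0} R) : Prop :=
  ∀ (t : ℕ) (x : Abelian.Ext (ModuleCat.of R (R ⧸ a ^ t)) N i), ∃ (s : ℕ) (h : t ≤ s), 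
    (Abelian.Ext.mk₀ (tr a h)).comp x (zero_add i) = 0

def ev (a : Ideal R) (i : ℕ) (N : ModuleCat.{0} R) : (localCohomology a i).obj N ≅
    Limits.colimit ((localCohomology.diagram (localCohomology.idealPowersDiagram a) i).flip.obj N) := 
  Limits.colimitObjIsoColimitCompEvaluation _ N

lemma subsingleton_iff_V (a : Ideal R) (i : ℕ) (N : ModuleCat.{0} R) :
    Subsingleton ((localCohomology a i).obj N) ↔ V a i N := by
  let F := (localCohomology.diagram (localCohomology.idealPowersDiagram a) i).flip.obj N
  have h1 : Subsingleton ((localCohomology a i).obj N) ↔ Subsingleton (Limits.colimit F : ModuleCat R) :=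
    (ev a i N).toLinearEquiv.toEquiv.subsingleton_congr
  rw [h1]
  have hrep := Limits.Concrete.colimit_exists_rep F
  let j : ℕ → ℕᵒᵖᵒᵖ := fun t => Opposite.op (Opposite.op t)
  let P (t : ℕ) := projectiveResolution (ModuleCat.of R (R ⧸ a ^ t))
  have Fmap : ∀ {t s : ℕ} (h : t ≤ s) (w : j t ⟶ j s), (F.map w) = 
    (((Ext R (ModuleCat.{0} R) i).map (tr a h).op).app N) := fun _ _ => rfl
  constructor
  · intro hsub t x
    obtain ⟨f, hf, rfl⟩ := (P t).extMk_surjective x (i+1) rfl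
    obtain ⟨u, hu⟩ := exists_rep' (P t) f hf
    obtain ⟨j', w, hw⟩ := Limits.Concrete.colimit_rep_eq_zero R F (j t) u (Subsingleton.elim _ _)
    have hts : t ≤ j'.unop.unop := w.unop.unop.le
    refine ⟨j'.unop.unop, hts, ?_⟩
    obtain ⟨φ⟩ := exists_hom (tr a hts) (P t) (P j'.unop.unop)
    rw [ProjectiveResolution.mk₀_comp_extMk _ _ _ _ φ]
    have h3 := hu.map _ _ φ
    rw [← rep_zero_iff h3]
    exact hw
  · intro hV
    refine ⟨fun x y => ?_⟩
    have : ∀ x : (Limits.colimit F : ModuleCat R), x = 0 := by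
      intro x
      obtain ⟨j', u, rfl⟩ := hrep x
      obtain ⟨f, hf⟩ := exists_rep (P j'.unop.unop) u
      obtain ⟨s, h, hs⟩ := hV j'.unop.unop ((P j'.unop.unop).extMk f (i+1) rfl hf.cocycle)
      obtain ⟨φ⟩ := exists_hom (tr a h) (P j'.unop.unop) (P s)
      rw [ProjectiveResolution.mk₀_comp_extMk _ _ _ _ φ] at hs
      have h3 := hf.map _ _ φ
      rw [← rep_zero_iff h3] at hs
      let w : j' ⟶ j s := (homOfLE h).op.op
      have h4 : (F.map w).hom u = 0 := hs
      rw [← Limits.colimit.w F w]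
      change (Limits.colimit.ι F (j s)).hom ((F.map w).hom u) = 0
      rw [h4, map_zero]
    rw [this x, this y]
end LCB
end
end

section
open CategoryTheory
set_option maxHeartbeats 1000000
noncomputable section
namespace LCB
variable {R : Type} [CommRing R]

lemma tr_comp (a : Ideal R) {r s t : ℕ} (h : t ≤ s) (h' : s ≤ r) :
    tr a h' ≫ tr a h = tr a (h.trans h') := by
  apply ModuleCat.hom_ext
  apply LinearMap.ext
  intro x
  obtain ⟨x, rfl⟩ := Submodule.Quotient.mk_surjective _ x
  rfl

/-- pullback of an Ext class -/
def pull {X Y Z : ModuleCat.{0} R} (g : X ⟶ Y) {n : ℕ} (x : Abelian.Ext Y Z n) : Abelian.Ext X Z n :=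
  (Abelian.Ext.mk₀ g).comp x (zero_add n)

section
variable {X Y Z W : ModuleCat.{0} R} (g : X ⟶ Y) {n m k : ℕ}

lemma pull_comp (x : Abelian.Ext Y Z n) (y : Abelian.Ext Z W m) (h : n + m = k) :
    pull g (x.comp y h) = (pull g x).comp y h := by
  unfold pull
  rw [Abelian.Ext.comp_assoc _ _ _ (zero_add n) h (by lia)]

lemma pull_pull (f : Y ⟶ Z) (x : Abelian.Ext Z W n) : pull g (pull f x) = pull (g ≫ f) x :=
  Abelian.Ext.mk₀_comp_mk₀_assoc _ _ _

lemma pull_zero : pull g (0 : Abelian.Ext Y Z n) = 0 := Abelian.Ext.comp_zero _ _ _ _ _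

lemma zero_pull (x : Abelian.Ext Y Z n) : pull (0 : X ⟶ Y) x = 0 := by
  unfold pull
  rw [Abelian.Ext.mk₀_zero, Abelian.Ext.zero_comp]

lemma id_pull (x : Abelian.Ext Y Z n) : pull (𝟙 Y) x = x := Abelian.Ext.mk₀_id_comp _

lemma pull_smul (r : R) (x : Abelian.Ext Y Z n) : pull g (r • x) = r • pull g x := 
  Abelian.Ext.comp_smul _ _ _ _

lemma smul_pull (r : R) (x : Abelian.Ext Y Z n) : pull (r • g) x = r • pull g x := by
  unfold pull
  rw [Abelian.Ext.mk₀_smul, Abelian.Ext.smul_comp]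
end

lemma V_def {a : Ideal R} {i : ℕ} {N : ModuleCat.{0} R} : V a i N ↔ 
  ∀ (t : ℕ) (x : Abelian.Ext (ModuleCat.of R (R ⧸ a ^ t)) N i), ∃ (s : ℕ) (h : t ≤ s), 
    pull (tr a h) x = 0 := Iff.rfl

section LES
variable {a : Ideal R} {S : ShortComplex (ModuleCat.{0} R)}

lemma V_mid (hS : S.ShortExact) {i : ℕ} (h1 : V a i S.X₁) (h3 : V a i S.X₃) : V a i S.X₂ := by
  rw [V_def] at *
  intro t x
  obtain ⟨s, h, hs⟩ := h3 t (x.comp (Abelian.Ext.mk₀ S.g) (add_zero i))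
  rw [pull_comp] at hs
  obtain ⟨y, hy⟩ := Abelian.Ext.covariant_sequence_exact₂ _ hS _ hs
  obtain ⟨s', h', hs'⟩ := h1 s y
  refine ⟨s', h.trans h', ?_⟩
  rw [← tr_comp a h h', ← pull_pull, ← hy, pull_comp, hs', Abelian.Ext.zero_comp]

lemma V_right (hS : S.ShortExact) {i : ℕ} (h2 : V a i S.X₂) (h1 : V a (i+1) S.X₁) : V a i S.X₃ := by
  rw [V_def] at *
  intro t x
  obtain ⟨s, h, hs⟩ := h1 t (x.comp hS.extClass rfl)
  rw [pull_comp] at hs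
  obtain ⟨y, hy⟩ := Abelian.Ext.covariant_sequence_exact₃ _ hS _ _ hs
  obtain ⟨s', h', hs'⟩ := h2 s y
  refine ⟨s', h.trans h', ?_⟩
  rw [← tr_comp a h h', ← pull_pull, ← hy, pull_comp, hs', Abelian.Ext.zero_comp]

lemma V_left (hS : S.ShortExact) {i : ℕ} (h3 : V a i S.X₃) (h2 : V a (i+1) S.X₂) : V a (i+1) S.X₁ := by
  rw [V_def] at *
  intro t x
  obtain ⟨s, h, hs⟩ := h2 t (x.comp (Abelian.Ext.mk₀ S.f) (add_zero _))
  rw [pull_comp] at hs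
  obtain ⟨y, hy⟩ := Abelian.Ext.covariant_sequence_exact₁ _ hS _ hs rfl
  obtain ⟨s', h', hs'⟩ := h3 s y
  refine ⟨s', h.trans h', ?_⟩
  rw [← tr_comp a h h', ← pull_pull, ← hy, pull_comp, hs', Abelian.Ext.zero_comp]
end LES

lemma V_iso {a : Ideal R} {i : ℕ} {N N' : ModuleCat.{0} R} (e : N ≅ N') (h : V a i N) : V a i N' := by
  rw [V_def] at *
  intro t x
  obtain ⟨s, h, hs⟩ := h t (x.comp (Abelian.Ext.mk₀ e.inv) (add_zero _))
  refine ⟨s, h, ?_⟩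
  rw [pull_comp] at hs
  have := congrArg (fun z => Abelian.Ext.comp z (Abelian.Ext.mk₀ e.hom) (add_zero i)) hs
  simpa using this

lemma V_equiv {a : Ideal R} {i : ℕ} {N N' : Type} [AddCommGroup N] [Module R N] [AddCommGroup N'] 
    [Module R N'] (e : N ≃ₗ[R] N') (h : V a i (ModuleCat.of R N)) : V a i (ModuleCat.of R N') :=
  V_iso e.toModuleIso h

lemma V_subsingleton {a : Ideal R} {i : ℕ} {N : ModuleCat.{0} R} [Subsingleton N] : V a i N := by
  intro t x
  refine ⟨t, le_rfl, ?_⟩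
  have : 𝟙 N = 0 := by
    apply ModuleCat.hom_ext; apply LinearMap.ext; intro x; exact Subsingleton.elim _ _
  have : x = 0 := by
    rw [← Abelian.Ext.comp_mk₀_id x, this]; simp
  rw [this, Abelian.Ext.comp_zero]

lemma V_top {a : Ideal R} (ha : a = ⊤) {i : ℕ} {N : ModuleCat.{0} R} : V a i N := by
  intro t x
  refine ⟨t, le_rfl, ?_⟩
  have : tr a (le_refl t) = 0 := by
    apply ModuleCat.hom_ext; apply LinearMap.ext; intro x; 
    have : Subsingleton (R ⧸ a ^ t) := by
      rw [Ideal.Quotient.subsingleton_iff, ha]; simp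
    exact Subsingleton.elim (α := R ⧸ a ^ t) _ _
  rw [this]; simp

lemma V_injective {a : Ideal R} {i : ℕ} {N : ModuleCat.{0} R} [Injective N] : V a (i+1) N := by
  intro t x
  refine ⟨t, le_rfl, ?_⟩
  rw [x.eq_zero_of_injective, Abelian.Ext.comp_zero]

/-- the short complex of an exact pair -/
abbrev SC {A B C : Type} [AddCommGroup A] [Module R A] [AddCommGroup B] [Module R B] [AddCommGroup C] 
    [Module R C] (f : A →ₗ[R] B) (g : B →ₗ[R] C) (h : Function.Exact f g) : ShortComplex (ModuleCat.{0} R) :=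
  ShortComplex.mk (ModuleCat.ofHom f) (ModuleCat.ofHom g) (by
    apply ModuleCat.hom_ext; exact h.linearMap_comp_eq_zero)

lemma SC_ex {A B C : Type} [AddCommGroup A] [Module R A] [AddCommGroup B] [Module R B] [AddCommGroup C] 
    [Module R C] (f : A →ₗ[R] B) (g : B →ₗ[R] C) (h : Function.Exact f g) (hf : Function.Injective f)
    (hg : Function.Surjective g) : (SC f g h).ShortExact := 
  ModuleCat.shortComplex_shortExact _ h hf hg

lemma ann_dies {a : Ideal R} {t : ℕ} {i : ℕ} {N : ModuleCat.{0} R} 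
    (y : Abelian.Ext (ModuleCat.of R (R ⧸ a ^ t)) N i) (r : R) (hr : r ∈ a ^ t) : r • y = 0 := by
  have : r • 𝟙 (ModuleCat.of R (R ⧸ a ^ t)) = 0 := by
    apply ModuleCat.hom_ext; apply LinearMap.ext; intro x
    obtain ⟨x, rfl⟩ := Submodule.Quotient.mk_surjective _ x
    change Submodule.Quotient.mk (r • x) = 0
    rw [Submodule.Quotient.mk_eq_zero]
    exact Ideal.mul_mem_right _ _ hr
  rw [← id_pull y, ← smul_pull, this, zero_pull]

lemma V_mul {a : Ideal R} {i : ℕ} {N C : Type} [AddCommGroup N] [Module R N] [AddCommGroup C] [Module R C]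
    (x : R) (hx : x ∈ a) (hinj : Function.Injective (fun n : N => x • n)) (g : N →ₗ[R] C) 
    (hg : Function.Surjective g)
    (hex : Function.Exact (x • (LinearMap.id : N →ₗ[R] N)) g) (hC : V a i (ModuleCat.of R C)) : 
    V a (i+1) (ModuleCat.of R N) := by
  have hS := SC_ex _ g hex hinj hg
  have main : ∀ k t (y : Abelian.Ext (ModuleCat.of R (R ⧸ a ^ t)) (ModuleCat.of R N) (i+1)), 
     x ^ k • y = 0 → ∃ (s : ℕ) (h : t ≤ s), pull (tr a h) y = 0 := by
    intro k
    induction k with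
    | zero => 
      intro t y hy
      refine ⟨t, le_rfl, ?_⟩
      rw [pow_zero, one_smul] at hy
      rw [hy, pull_zero]
    | succ k ih =>
      intro t y hy
      have h1 : (x ^ k • y).comp (Abelian.Ext.mk₀ (SC _ g hex).f) (add_zero _) = 0 := by
        have : (SC _ g hex).f = x • 𝟙 (ModuleCat.of R N) := rfl
        rw [this, ← Abelian.Ext.smul_eq_comp_mk₀, smul_smul, ← pow_succ', hy]
      obtain ⟨z, hz⟩ := Abelian.Ext.covariant_sequence_exact₁ _ hS _ h1 rfl
      obtain ⟨s, h, hs⟩ := (V_def.1 hC) t z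
      have h2 : x ^ k • pull (tr a h) y = 0 := by
        rw [← pull_smul, ← hz, pull_comp]
        exact (congrArg (fun w => Abelian.Ext.comp w hS.extClass rfl) hs).trans (by simp)
      obtain ⟨s', h', hs'⟩ := ih _ _ h2
      refine ⟨s', h.trans h', ?_⟩
      rw [← tr_comp a h h', ← pull_pull, hs']
  intro t y
  exact main t t y (ann_dies y _ (Ideal.pow_mem_pow hx t))

/-- torsion submodule -/
def Ga (a : Ideal R) (N : Type) [AddCommGroup N] [Module R N] : Submodule R N where
  carrier := {x | ∃ n, ∀ r ∈ a ^ n, r • x = 0}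
  add_mem' := by
    rintro x y ⟨n, hn⟩ ⟨m, hm⟩
    refine ⟨n + m, fun r hr => ?_⟩
    rw [smul_add, hn r (Ideal.pow_le_pow_right (by lia) hr), 
      hm r (Ideal.pow_le_pow_right (by lia) hr), add_zero]
  zero_mem' := ⟨0, by simp⟩
  smul_mem' := by
    rintro c x ⟨n, hn⟩
    exact ⟨n, fun r hr => by rw [smul_comm, hn r hr, smul_zero]⟩

lemma mem_Ga {a : Ideal R} {N : Type} [AddCommGroup N] [Module R N] {x : N} : 
  x ∈ Ga a N ↔ ∃ n, ∀ r ∈ a ^ n, r • x = 0 := Iff.rfl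

lemma V_zero_iff {a : Ideal R} {N : Type} [AddCommGroup N] [Module R N] : 
    V a 0 (ModuleCat.of R N) ↔ Ga a N = ⊥ := by
  rw [V_def]
  constructor
  · intro h
    rw [eq_bot_iff]
    rintro x ⟨n, hn⟩
    let f : (R ⧸ a ^ n) →ₗ[R] N := Submodule.liftQ _ (LinearMap.toSpanSingleton R N x) (by
      intro r hr; simpa using hn r hr)
    obtain ⟨s, h, hs⟩ := h n (Abelian.Ext.mk₀ (ModuleCat.ofHom f))
    unfold pull at hs
    rw [Abelian.Ext.mk₀_comp_mk₀, Abelian.Ext.mk₀_eq_zero_iff] at hs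
    have := congrArg (fun (t : ModuleCat.of R (R ⧸ a ^ s) ⟶ ModuleCat.of R N) => t.hom (Submodule.Quotient.mk 1)) hs
    change f (Submodule.Quotient.mk 1) = 0 at this
    have e : f (Submodule.Quotient.mk 1) = (1 : R) • x := rfl
    rw [e, one_smul] at this
    simpa using this
  · intro h t x
    refine ⟨t, le_rfl, ?_⟩
    obtain ⟨f, rfl⟩ := (Abelian.Ext.mk₀_bijective _ _).2 x
    have : f = 0 := by
      apply ModuleCat.hom_ext; apply LinearMap.ext; intro z
      have h1 : f.hom z ∈ Ga a N := by
        refine ⟨t, fun r hr => ?_⟩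
        rw [← map_smul]
        obtain ⟨z, rfl⟩ := Submodule.Quotient.mk_surjective _ z
        have : r • (Submodule.Quotient.mk z : R ⧸ a ^ t) = 0 := by
          rw [← Submodule.Quotient.mk_smul, Submodule.Quotient.mk_eq_zero]
          exact Ideal.mul_mem_right _ _ hr
        exact (congrArg _ this).trans (map_zero _)
      rw [h] at h1
      exact h1
    rw [this, Abelian.Ext.mk₀_zero, pull_zero]

end LCB
end
end

section
open CategoryTheory
set_option maxHeartbeats 1000000
noncomputable section
namespace LCB
variable {R : Type} [CommRing R]

lemma exists_kill [IsNoetherianRing R] (a : Ideal R) {J N : Type} [AddCommGroup J] [Module R J] [Module.Finite R J] 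
    [AddCommGroup N] [Module R N] (g : J →ₗ[R] N) (hg : ∀ x, g x ∈ Ga a N) : 
    ∃ n, ∀ x, ∀ r ∈ a ^ n, r • g x = 0 := by
  obtain ⟨s, hs⟩ := Module.Finite.fg_top (R := R) (M := J)
  choose f hf using hg
  refine ⟨s.sup f, fun x => ?_⟩
  have hx : x ∈ Submodule.span R (s : Set J) := by rw [hs]; trivial
  induction hx using Submodule.span_induction with
  | mem x hx => 
    intro r hr
    exact hf x r (Ideal.pow_le_pow_right (Finset.le_sup hx) hr)
  | zero => simp
  | add x y _ _ h1 h2 => intro r hr; rw [map_add, smul_add, h1 r hr, h2 r hr, add_zero]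
  | smul c x _ h => intro r hr; rw [map_smul, smul_comm, h r hr, smul_zero]

lemma Ga_injective [IsNoetherianRing R] (a : Ideal R) (I : Type) [AddCommGroup I] [Module R I] 
    [hI : Module.Injective R I] : Module.Injective R (Ga a I) := by
  apply Module.Baer.injective
  intro J g
  obtain ⟨n, hn⟩ := exists_kill a ((Ga a I).subtype ∘ₗ g) (fun x => (g x).2)
  obtain ⟨k, hk⟩ := Ideal.exists_pow_inf_eq_pow_smul (M := R) a J
  have hk' := hk (n + k) (by lia)
  have hsub : Submodule.comap J.subtype (a ^ (n+k)) ≤ LinearMap.ker ((Ga a I).subtype ∘ₗ g) := by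
    intro x hx
    have h1 : (x : R) ∈ a ^ (n+k) • (⊤ : Submodule R R) ⊓ J := ⟨by simpa using hx, x.2⟩
    rw [hk', Nat.add_sub_cancel] at h1
    have h2 : (x : R) ∈ a ^ n • J := Submodule.smul_mono le_rfl inf_le_right h1
    have h3 : x ∈ a ^ n • (⊤ : Submodule R J) := by
      have : (x : R) ∈ Submodule.map J.subtype (a ^ n • (⊤ : Submodule R J)) := by
        rw [Submodule.map_smul'']; simpa using h2
      obtain ⟨y, hy, hyx⟩ := this
      have : y = x := Subtype.ext hyx
      rwa [← this]
    clear h1 h2 hx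
    induction h3 using Submodule.smul_induction_on' with
    | smul r hr m _ => 
      rw [LinearMap.mem_ker, map_smul]; exact hn m r hr
    | add x _ y _ h1 h2 => exact add_mem h1 h2
  let X := J ⧸ Submodule.comap J.subtype (a ^ (n+k))
  let f : X →ₗ[R] (R ⧸ a ^ (n+k)) := Submodule.mapQ _ _ J.subtype le_rfl
  have hf : Function.Injective f := by
    rw [← LinearMap.ker_eq_bot, Submodule.ker_mapQ]
    rw [eq_bot_iff, Submodule.map_le_iff_le_comap]
    intro x hx
    simpa using hx
  obtain ⟨h, hh⟩ := hI.out f hf (Submodule.liftQ _ ((Ga a I).subtype ∘ₗ g) hsub)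
  refine ⟨LinearMap.codRestrict _ (h ∘ₗ Submodule.mkQ _) ?_, ?_⟩
  · intro x
    refine ⟨n + k, fun r hr => ?_⟩
    rw [← map_smul]
    change h (Submodule.Quotient.mk (r • x)) = 0
    rw [(Submodule.Quotient.mk_eq_zero _).2 (show r • x ∈ a ^ (n+k) from Ideal.mul_mem_right _ _ hr), map_zero]
  · intro x hx
    apply Subtype.ext
    exact hh (Submodule.Quotient.mk ⟨x, hx⟩)

/-- torsion module -/
def Tors (a : Ideal R) (N : Type) [AddCommGroup N] [Module R N] : Prop := ∀ x : N, x ∈ Ga a N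

lemma exists_inj (N : Type) [AddCommGroup N] [Module R N] : 
    ∃ (I : Type) (_ : AddCommGroup I) (_ : Module R I) (_ : Module.Injective R I) (f : N →ₗ[R] I), 
      Function.Injective f := by
  let I := Injective.under (ModuleCat.of R N)
  refine ⟨I, inferInstance, inferInstance, ?_, (Injective.ι (ModuleCat.of R N)).hom, ?_⟩
  · rw [Module.injective_iff_injective_object]
    exact inferInstanceAs (Injective I)
  · exact (ModuleCat.mono_iff_injective _).1 (inferInstanceAs (Mono (Injective.ι (ModuleCat.of R N))))

lemma Ga_map {a : Ideal R} {N I : Type} [AddCommGroup N] [Module R N] [AddCommGroup I] [Module R I] 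
    (f : N →ₗ[R] I) {x : N} (hx : x ∈ Ga a N) : f x ∈ Ga a I := by
  obtain ⟨n, hn⟩ := hx
  exact ⟨n, fun r hr => by rw [← map_smul, hn r hr, map_zero]⟩

lemma Ga_of_inj {a : Ideal R} {N I : Type} [AddCommGroup N] [Module R N] [AddCommGroup I] [Module R I] 
    (f : N →ₗ[R] I) (hf : Function.Injective f) {x : N} (hx : f x ∈ Ga a I) : x ∈ Ga a N := by
  obtain ⟨n, hn⟩ := hx
  exact ⟨n, fun r hr => hf (by rw [map_smul, hn r hr, map_zero])⟩

lemma exists_inj_tf [IsNoetherianRing R] (a : Ideal R) (N : Type) [AddCommGroup N] [Module R N] (hN : Ga a N = ⊥) : 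
    ∃ (I : Type) (_ : AddCommGroup I) (_ : Module R I) (_ : Module.Injective R I) (f : N →ₗ[R] I), 
      Function.Injective f ∧ Ga a I = ⊥ := by
  obtain ⟨I, _, _, hI, f, hf⟩ := exists_inj (R := R) N
  have hJ := Ga_injective a I
  obtain ⟨ρ, hρ⟩ := hJ.out (Ga a I).subtype (Submodule.subtype_injective _) LinearMap.id
  let E := LinearMap.ker ρ
  let π : I →ₗ[R] E := LinearMap.codRestrict E (LinearMap.id - (Ga a I).subtype ∘ₗ ρ) (by
    intro x
    rw [LinearMap.mem_ker]
    simp only [LinearMap.sub_apply, LinearMap.id_apply, map_sub]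
    rw [sub_eq_zero]
    exact (hρ (ρ x)).symm)
  have hπ : ∀ x : I, (π x : I) = x - ρ x := fun x => rfl
  have hπE : ∀ x : E, π x = x := by
    intro x
    apply Subtype.ext
    rw [hπ, LinearMap.mem_ker.1 x.2]; simp
  refine ⟨E, inferInstance, inferInstance, ⟨?_⟩, π ∘ₗ f, ?_, ?_⟩
  · intro X Y _ _ _ _ f hf g
    obtain ⟨h, hh⟩ := hI.out f hf (E.subtype ∘ₗ g)
    refine ⟨π ∘ₗ h, fun x => ?_⟩
    rw [LinearMap.comp_apply, hh]
    exact hπE _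
  · rw [← LinearMap.ker_eq_bot, eq_bot_iff, ← hN]
    intro x hx
    apply Ga_of_inj f hf
    have : (π (f x) : I) = 0 := congrArg Subtype.val (LinearMap.mem_ker.1 hx)
    rw [hπ, sub_eq_zero] at this
    rw [this]
    exact (ρ (f x)).2
  · rw [eq_bot_iff]
    intro x hx
    have h1 : (x : I) ∈ Ga a I := Ga_map E.subtype hx
    have h2 := hρ ⟨x, h1⟩
    have h3 : ρ (x : I) = 0 := x.2
    have h4 : (⟨x, h1⟩ : Ga a I) = 0 := h2.symm.trans h3
    have h5 : (x : I) = 0 := congrArg (fun z : Ga a I => (z : I)) h4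
    exact Subtype.ext h5

lemma inj_obj (I : Type) [AddCommGroup I] [Module R I] [Module.Injective R I] : Injective (ModuleCat.of R I) :=
  (Module.injective_iff_injective_object R I).1 inferInstance

lemma V_inj {a : Ideal R} (I : Type) [AddCommGroup I] [Module R I] [Module.Injective R I] (h : Ga a I = ⊥) (i : ℕ) :
    V a i (ModuleCat.of R I) := by
  cases i with
  | zero => exact V_zero_iff.2 h
  | succ i => 
    have := inj_obj (R := R) I
    exact V_injective

/-- cokernel sequence of an injection -/
lemma mkQ_ex {A B : Type} [AddCommGroup A] [Module R A] [AddCommGroup B] [Module R B] (f : A →ₗ[R] B) : 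
    Function.Exact f (LinearMap.range f).mkQ := by
  rw [LinearMap.exact_iff]; simp

lemma SQ {A B : Type} [AddCommGroup A] [Module R A] [AddCommGroup B] [Module R B] (f : A →ₗ[R] B) 
    (hf : Function.Injective f) : (SC f _ (mkQ_ex f)).ShortExact := 
  SC_ex _ _ _ hf (Submodule.mkQ_surjective _)

lemma Tors.quot {a : Ideal R} {A B : Type} [AddCommGroup A] [Module R A] [AddCommGroup B] [Module R B]
    (f : A →ₗ[R] B) (hf : Function.Surjective f) (h : Tors a A) : Tors a B := by
  intro x
  obtain ⟨x, rfl⟩ := hf x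
  exact Ga_map f (h x)

lemma Tors.sub {a : Ideal R} {A B : Type} [AddCommGroup A] [Module R A] [AddCommGroup B] [Module R B]
    (f : A →ₗ[R] B) (hf : Function.Injective f) (h : Tors a B) : Tors a A := 
  fun _ => Ga_of_inj f hf (h _)

lemma Tors_Ga (a : Ideal R) (A : Type) [AddCommGroup A] [Module R A] : Tors a (Ga a A) := 
  fun x => Ga_of_inj _ (Submodule.subtype_injective _) x.2

lemma V_tors [IsNoetherianRing R] (a : Ideal R) (i : ℕ) : ∀ (N : Type) [AddCommGroup N] [Module R N], Tors a N → 
    V a (i+1) (ModuleCat.of R N) := by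
  induction i with
  | zero =>
    intro N _ _ hN
    obtain ⟨I, _, _, hI, f, hf⟩ := exists_inj (R := R) N
    have hJ := Ga_injective a I
    let f' : N →ₗ[R] Ga a I := LinearMap.codRestrict _ f (fun x => Ga_map f (hN x))
    have hf' : Function.Injective f' := fun x y h => hf (congrArg Subtype.val h)
    have hS := SQ f' hf'
    have hT := Tors_Ga a I
    have := inj_obj (R := R) (Ga a I)
    rw [V_def]
    intro t x
    have hx0 : x.comp (Abelian.Ext.mk₀ (SC f' _ (mkQ_ex f')).f) (add_zero _) = 0 := 
      Abelian.Ext.eq_zero_of_injective _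
    obtain ⟨z, hz⟩ := Abelian.Ext.covariant_sequence_exact₁ _ hS _ hx0 rfl
    obtain ⟨z, rfl⟩ := (Abelian.Ext.mk₀_bijective _ _).2 z
    obtain ⟨j, hj⟩ := Submodule.mkQ_surjective _ (z.hom (Submodule.Quotient.mk 1))
    obtain ⟨n, hn⟩ := hT j
    refine ⟨t + n, by lia, ?_⟩
    let w : (R ⧸ a ^ (t + n)) →ₗ[R] Ga a I := Submodule.liftQ _ (LinearMap.toSpanSingleton R _ j) (by
      intro r hr; simpa using hn r (Ideal.pow_le_pow_right (by lia) hr))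
    have e : tr a (show t ≤ t + n by lia) ≫ z = ModuleCat.ofHom w ≫ (SC f' _ (mkQ_ex f')).g := by
      apply ModuleCat.hom_ext; apply LinearMap.ext; intro r
      obtain ⟨r, rfl⟩ := Submodule.Quotient.mk_surjective _ r
      change z.hom (Submodule.Quotient.mk r) = Submodule.mkQ _ (r • j)
      rw [map_smul, hj, ← map_smul]
      congr 1
      change _ = Submodule.Quotient.mk (r • 1)
      simp
    rw [← hz, pull_comp, pull, Abelian.Ext.mk₀_comp_mk₀, e, ← Abelian.Ext.mk₀_comp_mk₀, 
      Abelian.Ext.comp_assoc_of_second_deg_zero, hS.comp_extClass, Abelian.Ext.comp_zero]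
  | succ i ih =>
    intro N _ _ hN
    obtain ⟨I, _, _, hI, f, hf⟩ := exists_inj (R := R) N
    have hJ := Ga_injective a I
    let f' : N →ₗ[R] Ga a I := LinearMap.codRestrict _ f (fun x => Ga_map f (hN x))
    have hf' : Function.Injective f' := fun x y h => hf (congrArg Subtype.val h)
    have hS := SQ f' hf'
    have hT := Tors_Ga a I
    have := inj_obj (R := R) (Ga a I)
    exact V_left hS (ih _ (hT.quot _ (Submodule.mkQ_surjective _))) V_injective

lemma ext_tors [IsNoetherianRing R] (a : Ideal R) (c : ℕ) : ∀ (M : Type) [AddCommGroup M] [Module R M], 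
    (∀ j < c, V a j (ModuleCat.of R M)) → ∀ (Y : Type) [AddCommGroup Y] [Module R Y], Tors a Y → 
    ∀ j < c, ∀ x : Abelian.Ext (ModuleCat.of R Y) (ModuleCat.of R M) j, x = 0 := by
  induction c with
  | zero => intro M _ _ _ Y _ _ _ j hj; lia
  | succ c ih =>
    intro M _ _ hM Y _ _ hY j hj x
    have hG := V_zero_iff.1 (hM 0 (by lia))
    cases j with
    | zero =>
      obtain ⟨f, rfl⟩ := (Abelian.Ext.mk₀_bijective _ _).2 x
      rw [Abelian.Ext.mk₀_eq_zero_iff]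
      apply ModuleCat.hom_ext; apply LinearMap.ext; intro y
      have : f.hom y ∈ Ga a M := Ga_map f.hom (hY y)
      rw [hG] at this
      exact this
    | succ j =>
      obtain ⟨I, _, _, hI, f, hf, hI0⟩ := exists_inj_tf a M hG
      have hS := SQ f hf
      have := inj_obj (R := R) I
      have hx0 : x.comp (Abelian.Ext.mk₀ (SC f _ (mkQ_ex f)).f) (add_zero _) = 0 := 
        Abelian.Ext.eq_zero_of_injective _
      obtain ⟨z, hz⟩ := Abelian.Ext.covariant_sequence_exact₁ _ hS _ hx0 rfl
      have hV : ∀ k < c, V a k (ModuleCat.of R (I ⧸ LinearMap.range f)) := 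
        fun k hk => V_right hS (V_inj I hI0 k) (hM _ (by lia))
      have := ih _ hV Y hY j (by lia) z
      rw [← hz, this, Abelian.Ext.zero_comp]

end LCB
end
end

section
open CategoryTheory
set_option maxHeartbeats 1000000
noncomputable section
namespace LCB
variable {R : Type} [CommRing R]

lemma exists_hom_quot [IsNoetherianRing R] (M : Type) [AddCommGroup M] [Module R M] [Module.Finite R M]
    (p : PrimeSpectrum R) (hp : p ∈ Module.support R M) : ∃ f : M →ₗ[R] (R ⧸ p.asIdeal), f ≠ 0 := by
  let P : Set (Submodule R M) := {K | p.asIdeal • ⊤ ≤ K ∧ p ∈ Module.support R (M ⧸ K)}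
  have hne : P.Nonempty := ⟨p.asIdeal • ⊤, le_rfl, by 
    rw [Module.support_quotient]; exact ⟨hp, by simp⟩⟩
  obtain ⟨K, ⟨hpK, hK⟩, hmax⟩ := (wellFounded_gt (α := Submodule R M)).has_min P hne
  have hnt : Nontrivial (M ⧸ K) := by
    by_contra h
    rw [not_nontrivial_iff_subsingleton] at h
    rw [Module.support_eq_empty] at hK
    exact hK
  obtain ⟨n, hn⟩ := exists_ne (0 : M ⧸ K)
  obtain ⟨n, rfl⟩ := Submodule.mkQ_surjective _ n
  let n' : M ⧸ K := K.mkQ n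
  have hnK : n ∉ K := by
    intro h; apply hn; simpa using h
  let L := K ⊔ Submodule.span R {n}
  have hL : K < L := by
    apply lt_of_le_of_ne le_sup_left
    intro h; apply hnK; rw [h]; exact Submodule.mem_sup_right (Submodule.mem_span_singleton_self n)
  have hLP : p ∉ Module.support R (M ⧸ L) := by
    intro h
    exact hmax L ⟨hpK.trans hL.le, h⟩ hL
  rw [Module.mem_support_iff_of_finite] at hLP
  obtain ⟨s, hs, hsp⟩ := Set.not_subset.1 hLP
  have hs' : ∀ m : M, s • m ∈ L := by
    intro m
    have := Module.mem_annihilator.1 hs (Submodule.Quotient.mk m)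
    rwa [← Submodule.Quotient.mk_smul, Submodule.Quotient.mk_eq_zero] at this
  let g : R →ₗ[R] M ⧸ K := LinearMap.toSpanSingleton R _ n'
  have hg : ∀ r, g r = r • n' := fun r => rfl
  have h1 : ∀ m : M, s • (K.mkQ m) ∈ LinearMap.range g := by
    intro m
    obtain ⟨k, hk, y, hy, hky⟩ := Submodule.mem_sup.1 (hs' m)
    obtain ⟨r, rfl⟩ := Submodule.mem_span_singleton.1 hy
    refine ⟨r, ?_⟩
    rw [← map_smul, ← hky, map_add]
    have : K.mkQ k = 0 := by simpa using hk
    rw [this, zero_add, map_smul]; rfl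
  have hker : LinearMap.ker g = p.asIdeal := by
    apply le_antisymm
    · intro r hr
      by_contra hrp
      have hr0 : r • n' = 0 := hr
      have : s * r ∈ Module.annihilator R (M ⧸ K) := by
        rw [Module.mem_annihilator]
        intro m
        obtain ⟨m, rfl⟩ := Submodule.mkQ_surjective _ m
        obtain ⟨q, hq⟩ := h1 m
        rw [mul_comm, mul_smul, ← hq, hg, smul_comm, hr0, smul_zero]
      have := (Module.mem_support_iff_of_finite.1 hK) this
      rcases p.2.mem_or_mem this with h | h
      · exact hsp h
      · exact hrp h
    · intro r hr
      change r • K.mkQ n = 0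
      rw [← map_smul]
      have : r • n ∈ K := hpK (Submodule.smul_mem_smul hr trivial)
      exact (Submodule.Quotient.mk_eq_zero _).2 this
  let e : (R ⧸ p.asIdeal) ≃ₗ[R] LinearMap.range g := 
    (Submodule.quotEquivOfEq _ _ hker.symm).trans g.quotKerEquivRange
  let f : M →ₗ[R] LinearMap.range g := LinearMap.codRestrict _ (s • K.mkQ) h1
  refine ⟨e.symm.toLinearMap ∘ₗ f, fun h0 => ?_⟩
  have h2 : f n = 0 := by
    have := LinearMap.congr_fun h0 n
    simpa using this
  have h3 : s • n' = 0 := congrArg Subtype.val h2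
  have h4 : s ∈ LinearMap.ker g := h3
  rw [hker] at h4
  exact hsp h4

lemma V_filt [IsNoetherianRing R] (a : Ideal R) (i : ℕ) (N : Type) [AddCommGroup N] [Module R N] [hN : Module.Finite R N]
    (h : ∀ p : PrimeSpectrum R, p ∈ Module.support R N → V a i (ModuleCat.of R (R ⧸ p.asIdeal))) : 
    V a i (ModuleCat.of R N) := by
  revert h
  refine IsNoetherianRing.induction_on_isQuotientEquivQuotientPrime R hN 
    (motive := fun N _ _ _ => (∀ p : PrimeSpectrum R, p ∈ Module.support R N → 
      V a i (ModuleCat.of R (R ⧸ p.asIdeal))) → V a i (ModuleCat.of R N)) ?_ ?_ ?_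
  · intro N _ _ _ hs h
    have : Subsingleton (ModuleCat.of R N) := hs
    exact V_subsingleton
  · intro N _ _ _ p e h
    refine V_equiv e.symm (h p ?_)
    rw [e.support_eq, Module.mem_support_iff_of_finite, Ideal.annihilator_quotient]
  · intro N₁ _ _ _ N₂ _ _ _ N₃ _ _ _ f g hf hg hfg h1 h3 h
    rw [Module.support_of_exact hfg hf hg] at h
    exact V_mid (SC_ex f g hfg hf hg) (h1 fun p hp => h p (Or.inl hp)) (h3 fun p hp => h p (Or.inr hp))

lemma Tors_quot {a p : Ideal R} (h : a ≤ p) : Tors a (R ⧸ p) := by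
  intro x
  refine ⟨1, fun r hr => ?_⟩
  rw [pow_one] at hr
  obtain ⟨x, rfl⟩ := Submodule.Quotient.mk_surjective _ x
  rw [← Submodule.Quotient.mk_smul, Submodule.Quotient.mk_eq_zero]
  exact Ideal.mul_mem_right _ _ (h hr)

lemma supp_quot_aux [IsNoetherianRing R] (p : PrimeSpectrum R) (K : Submodule R (R ⧸ p.asIdeal)) (x : R) (hx : x ∉ p.asIdeal)
    (hxK : Submodule.Quotient.mk x ∈ K) (q : PrimeSpectrum R) (hq : q ∈ Module.support R ((R ⧸ p.asIdeal) ⧸ K)) : p < q := by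
  rw [Module.mem_support_iff_of_finite] at hq
  have h1 : p.asIdeal ≤ q.asIdeal := by
    refine le_trans ?_ hq
    intro r hr
    rw [Module.mem_annihilator]
    intro m
    obtain ⟨m, rfl⟩ := Submodule.Quotient.mk_surjective _ m
    obtain ⟨m, rfl⟩ := Submodule.Quotient.mk_surjective _ m
    rw [← Submodule.Quotient.mk_smul, ← Submodule.Quotient.mk_smul, 
      (Submodule.Quotient.mk_eq_zero p.asIdeal).2 (show r • m ∈ p.asIdeal from Ideal.mul_mem_right m _ hr)]
    simp
  have h2 : x ∈ q.asIdeal := by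
    apply hq
    rw [Module.mem_annihilator]
    intro m
    obtain ⟨m, rfl⟩ := Submodule.Quotient.mk_surjective _ m
    obtain ⟨m, rfl⟩ := Submodule.Quotient.mk_surjective _ m
    rw [← Submodule.Quotient.mk_smul, ← Submodule.Quotient.mk_smul, Submodule.Quotient.mk_eq_zero]
    have := K.smul_mem m hxK
    rw [← Submodule.Quotient.mk_smul, smul_eq_mul, mul_comm] at this
    exact this
  refine lt_of_le_of_ne h1 ?_
  rintro rfl
  exact hx h2

lemma V_dim [IsNoetherianRing R] (a : Ideal R) (d : ℕ) : ∀ p : PrimeSpectrum R, Order.coheight p < d → ∀ i, d ≤ i → 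
    V a i (ModuleCat.of R (R ⧸ p.asIdeal)) := by
  induction d with
  | zero => intro p hp; simp at hp
  | succ d ih =>
    intro p hp i hi
    obtain ⟨i, rfl⟩ : ∃ j, i = j + 1 := ⟨i - 1, by lia⟩
    by_cases hap : a ≤ p.asIdeal
    · exact V_tors a i _ (Tors_quot hap)
    · obtain ⟨x, hxa, hxp⟩ := Set.not_subset.1 hap
      let f : (R ⧸ p.asIdeal) →ₗ[R] (R ⧸ p.asIdeal) := x • LinearMap.id
      refine V_mul x hxa ?_ (LinearMap.range f).mkQ (Submodule.mkQ_surjective _) (mkQ_ex f) ?_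
      · change Function.Injective f
        rw [← LinearMap.ker_eq_bot, eq_bot_iff]
        intro m hm
        obtain ⟨m, rfl⟩ := Submodule.Quotient.mk_surjective _ m
        have h1 : x • (Submodule.Quotient.mk m : R ⧸ p.asIdeal) = 0 := hm
        rw [← Submodule.Quotient.mk_smul, Submodule.Quotient.mk_eq_zero] at h1
        rw [Submodule.mem_bot, Submodule.Quotient.mk_eq_zero]
        exact (p.2.mem_or_mem h1).resolve_left hxp
      · apply V_filt
        intro q hq
        have hpq := supp_quot_aux p (LinearMap.range f) x hxp ⟨Submodule.Quotient.mk 1, by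
          change x • (Submodule.Quotient.mk 1 : R ⧸ p.asIdeal) = _
          rw [← Submodule.Quotient.mk_smul]; simp⟩ q hq
        refine ih q ?_ i (by lia)
        have h1 := Order.coheight_add_one_le hpq
        have h2 : Order.coheight q + 1 < (d : ℕ∞) + 1 := lt_of_le_of_lt h1 (by simpa using hp)
        exact (ENat.add_lt_add_iff_right (by simp)).1 h2

lemma exists_bound [IsNoetherianRing R] [IsLocalRing R] (a : Ideal R) : ∃ n : ℕ, ∀ p : PrimeSpectrum R, ∀ i, n ≤ i → 
    V a i (ModuleCat.of R (R ⧸ p.asIdeal)) := by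
  obtain ⟨n, hn⟩ : ∃ n : ℕ, ∀ p : PrimeSpectrum R, Order.coheight p < n := by
    have h1 : ringKrullDim R < ⊤ := ringKrullDim_lt_top
    have h2 : ringKrullDim R ≠ ⊥ := ringKrullDim_ne_bot
    obtain ⟨m, hm⟩ := WithBot.ne_bot_iff_exists.1 h2
    have h3 : m ≠ ⊤ := by
      rintro rfl
      rw [← hm] at h1
      exact lt_irrefl _ h1
    obtain ⟨k, rfl⟩ := ENat.ne_top_iff_exists.1 h3
    refine ⟨k + 1, fun p => ?_⟩
    have h4 := Order.coheight_le_krullDim p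
    change _ ≤ ringKrullDim R at h4
    rw [← hm] at h4
    have h5 : Order.coheight p ≤ (k : ℕ∞) := by exact_mod_cast h4
    refine lt_of_le_of_lt h5 ?_
    exact_mod_cast Nat.lt_succ_self k
  exact ⟨n, fun p i hi => V_dim a n p (hn p) i hi⟩

/-- the upper bound -/
lemma upper [IsNoetherianRing R] [IsLocalRing R] (a : Ideal R) (M : Type) [AddCommGroup M] [Module R M] [Module.Finite R M]
    (c : ℕ) (hM : ∀ i, c < i → V a i (ModuleCat.of R M)) (p : PrimeSpectrum R) (hp : p ∈ Module.support R M) (i : ℕ) 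
    (hi : c < i) : V a i (ModuleCat.of R (R ⧸ p.asIdeal)) := by
  obtain ⟨n, hn⟩ := exists_bound a
  suffices H : ∀ k i, c < i → n ≤ i + k → ∀ p : PrimeSpectrum R, p ∈ Module.support R M → 
      V a i (ModuleCat.of R (R ⧸ p.asIdeal)) from H n i hi (by lia) p hp
  clear hp hi p i
  intro k
  induction k with
  | zero => intro i _ hni p _; exact hn p i hni
  | succ k ih =>
    intro i hi hni p
    have wf : WellFoundedGT (PrimeSpectrum R) := by
      refine ⟨?_⟩
      exact (InvImage.wf (fun p : PrimeSpectrum R => p.asIdeal) (wellFounded_gt (α := Ideal R)))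
    induction p using WellFoundedGT.induction with
    | ind p ihp =>
    intro hp
    obtain ⟨f, hf⟩ := exists_hom_quot M p hp
    have hex : Function.Exact (LinearMap.ker f).subtype f.rangeRestrict := by
      rw [LinearMap.exact_iff]; simp
    have hS := SC_ex _ _ hex (Submodule.subtype_injective _) f.surjective_rangeRestrict
    have hr : V a i (ModuleCat.of R (LinearMap.range f)) := by
      refine V_right hS (hM i hi) ?_
      apply V_filt
      intro q hq
      exact ih (i+1) (by lia) (by lia) q (Module.support_subset_of_injective _ (Submodule.subtype_injective _) hq)
    have hx : ∃ x, x ∉ p.asIdeal ∧ Submodule.Quotient.mk x ∈ LinearMap.range f := by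
      by_contra! h
      apply hf
      apply LinearMap.ext
      intro m
      obtain ⟨x, hx⟩ := Submodule.Quotient.mk_surjective _ (f m)
      have : x ∈ p.asIdeal := by
        by_contra h'
        exact h x h' ⟨m, hx.symm⟩
      rw [← hx, (Submodule.Quotient.mk_eq_zero _).2 this]; rfl
    obtain ⟨x, hxp, hxf⟩ := hx
    have hex2 : Function.Exact (LinearMap.range f).subtype (LinearMap.range f).mkQ := by
      rw [LinearMap.exact_iff]; simp
    refine V_mid (SC_ex _ _ hex2 (Submodule.subtype_injective _) (Submodule.mkQ_surjective _)) hr ?_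
    apply V_filt
    intro q hq
    have hpq := supp_quot_aux p _ x hxp hxf q hq
    exact ihp q hpq (Module.mem_support_mono hpq.le hp)

end LCB
end
end

section
open CategoryTheory
set_option maxHeartbeats 1000000
noncomputable section
set_option linter.unusedSectionVars false
namespace LCB

section tri
open Limits Pretriangulated
variable {R : Type} [CommRing R]
variable {𝒟 : Type*} [Category 𝒟] [HasZeroObject 𝒟] [HasShift 𝒟 ℤ] [Preadditive 𝒟]
  [∀ n : ℤ, (shiftFunctor 𝒟 n).Additive] [Pretriangulated 𝒟]
  [Linear R 𝒟] [∀ n : ℤ, (shiftFunctor 𝒟 n).Linear R]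

variable (R) in
def shiftHomEquiv (A B : 𝒟) (m n k : ℤ) (h : n + -m = k) :
    (A⟦m⟧ ⟶ B⟦n⟧) ≃ₗ[R] (A ⟶ B⟦k⟧) :=
  (LinearEquiv.ofBijective ((shiftFunctor 𝒟 (-m)).mapLinearMap R) 
    ⟨(shiftFunctor 𝒟 (-m)).map_injective, (shiftFunctor 𝒟 (-m)).map_surjective⟩).trans
    (Linear.homCongr R ((shiftFunctorCompIsoId 𝒟 m (-m) (by lia)).app A) 
      ((shiftFunctorAdd' 𝒟 n (-m) k h).symm.app B))


def orth (A X : 𝒟) : Prop := ∀ n : ℤ, ∀ f : A ⟶ X⟦n⟧, f = 0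

lemma orth.shift {A X : 𝒟} (h : orth A X) (m : ℤ) : orth A (X⟦m⟧) := by
  intro n f
  have := h (m + n) (f ≫ (shiftFunctorAdd 𝒟 m n).inv.app X)
  exact (cancel_mono ((shiftFunctorAdd 𝒟 m n).inv.app X)).1 (by rw [this, zero_comp])

lemma orth.shift' {A X : 𝒟} (h : orth A X) (m n : ℤ) (f : A⟦m⟧ ⟶ X⟦n⟧) : f = 0 := by
  apply (shiftHomEquiv ℤ A X m n _ rfl).injective
  rw [map_zero]
  exact h _ _

lemma tri_inj₁ {T : Triangle 𝒟} (hT : T ∈ distTriang 𝒟) {X : 𝒟} (hX : ∀ f : T.obj₃ ⟶ X, f = 0)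
    (f : T.obj₂ ⟶ X) (hf : T.mor₁ ≫ f = 0) : f = 0 := by
  obtain ⟨g, rfl⟩ := Triangle.yoneda_exact₂ T hT f hf
  rw [hX g, comp_zero]

lemma tri_surj₁ {T : Triangle 𝒟} (hT : T ∈ distTriang 𝒟) {X : 𝒟} 
    (hX : ∀ f : T.obj₃ ⟶ X⟦(1 : ℤ)⟧, f = 0)
    (f : T.obj₁ ⟶ X) : ∃ g, f = T.mor₁ ≫ g := by
  obtain ⟨g, hg⟩ := Triangle.yoneda_exact₃ T.rotate (rot_of_distTriang _ hT) (f⟦(1 : ℤ)⟧') (hX _)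
  change T.obj₂⟦(1 : ℤ)⟧ ⟶ X⟦(1 : ℤ)⟧ at g
  obtain ⟨g, rfl⟩ := (shiftFunctor 𝒟 (1 : ℤ)).map_surjective g
  refine ⟨-g, (shiftFunctor 𝒟 (1 : ℤ)).map_injective ?_⟩
  refine hg.trans ?_
  change (-T.mor₁⟦(1 : ℤ)⟧') ≫ _ = _
  simp

lemma tri_inj₂ {T : Triangle 𝒟} (hT : T ∈ distTriang 𝒟) {X : 𝒟} 
    (hX : ∀ f : T.obj₁⟦(1 : ℤ)⟧ ⟶ X, f = 0)
    (f : T.obj₃ ⟶ X) (hf : T.mor₂ ≫ f = 0) : f = 0 := by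
  obtain ⟨g, rfl⟩ := Triangle.yoneda_exact₃ T hT f hf
  rw [hX g, comp_zero]

lemma tri_surj₂ {T : Triangle 𝒟} (hT : T ∈ distTriang 𝒟) {X : 𝒟} 
    (hX : ∀ f : T.obj₁ ⟶ X, f = 0)
    (f : T.obj₂ ⟶ X) : ∃ g, f = T.mor₂ ≫ g := 
  Triangle.yoneda_exact₂ T hT f (hX _)

/-- The cone of `x` on `X` is right orthogonal to `A` if `x` is bijective on homs. -/
lemma orth_cone {A X C : 𝒟} (x : R) {g : X ⟶ C} {h : C ⟶ X⟦(1 : ℤ)⟧} 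
    (hT : Triangle.mk (x • 𝟙 X) g h ∈ distTriang 𝒟)
    (hA : ∀ n : ℤ, Function.Bijective (fun f : A ⟶ X⟦n⟧ => x • f)) : orth A C := by
  have hA' : ∀ m n : ℤ, Function.Bijective (fun f : A⟦m⟧ ⟶ X⟦n⟧ => x • f) := by
    intro m n
    let e := shiftHomEquiv R A X m n _ rfl
    have := hA (n + -m)
    constructor
    · intro a b hab
      apply e.injective
      apply (hA _).1
      change x • e a = x • e b
      rw [← map_smul, ← map_smul]
      exact congrArg e hab
    · intro b
      obtain ⟨a, ha⟩ := (hA _).2 (e b)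
      refine ⟨e.symm a, e.injective ?_⟩
      change e (x • e.symm a) = _
      rw [map_smul, e.apply_symm_apply]
      exact ha
  have key : ∀ m : ℤ, ∀ f : A⟦m⟧ ⟶ C, f = 0 := by
    intro m f
    have h1 : f ≫ h = 0 := by
      apply (hA' m 1).1
      have := comp_distTriang_mor_zero₃₁ _ hT
      change h ≫ (x • 𝟙 X)⟦(1 : ℤ)⟧' = 0 at this
      rw [Functor.map_smul, CategoryTheory.Functor.map_id, Linear.comp_smul, Category.comp_id] at this
      change x • (f ≫ h) = x • 0
      rw [← Linear.comp_smul, this, comp_zero, smul_zero]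
    obtain ⟨k, hk⟩ := Triangle.coyoneda_exact₃ _ hT f h1
    change A⟦m⟧ ⟶ X at k
    obtain ⟨k', hk'⟩ := (hA' m 0).2 (k ≫ (shiftFunctorZero 𝒟 ℤ).inv.app X)
    have h2 : k = x • (k' ≫ (shiftFunctorZero 𝒟 ℤ).hom.app X) := by
      rw [← Linear.smul_comp]
      change k = (x • k') ≫ _
      change x • k' = _ at hk'
      rw [hk', Category.assoc, Iso.inv_hom_id_app]
      exact (Category.comp_id _).symm
    rw [hk, h2]
    have h3 := comp_distTriang_mor_zero₁₂ _ hT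
    change (x • 𝟙 X) ≫ g = 0 at h3
    change (x • (k' ≫ (shiftFunctorZero 𝒟 ℤ).hom.app X)) ≫ g = 0
    have h4 : x • g = 0 := by rw [← h3, Linear.smul_comp, Category.id_comp]
    rw [Linear.smul_comp, ← Linear.comp_smul, h4, comp_zero]
  intro n f
  obtain ⟨e⟩ : Nonempty ((A⟦-n⟧ ⟶ C⟦(0:ℤ)⟧) ≃ₗ[ℤ] (A ⟶ C⟦n⟧)) := ⟨shiftHomEquiv ℤ A C (-n) 0 n (by simp)⟩
  obtain ⟨f, rfl⟩ := e.surjective f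
  have : f = 0 := by
    have := key _ (f ≫ (shiftFunctorZero 𝒟 ℤ).hom.app C)
    exact (cancel_mono ((shiftFunctorZero 𝒟 ℤ).hom.app C)).1 (by rw [this, zero_comp])
  rw [this, map_zero]

end tri
end LCB
end
end

section
open CategoryTheory
set_option maxHeartbeats 1000000
noncomputable section
namespace LCB
section der
open Limits Pretriangulated ZeroObject
universe w
variable {R : Type} [CommRing R] [HasDerivedCategory.{w} (ModuleCat.{0} R)]

lemma isZero_of_orth (X : DerivedCategory (ModuleCat.{0} R))
    (h : orth ((DerivedCategory.singleFunctor (ModuleCat.{0} R) 0).obj (ModuleCat.of R R)) X) :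
    IsZero X := by
  let K := DerivedCategory.Q.objPreimage X
  let e : DerivedCategory.Q.obj K ≅ X := DerivedCategory.Q.objObjPreimageIso X
  have hK : ∀ i : ℤ, IsZero (K.homology i) := by
    intro i
    have hπ : K.homologyπ i = 0 := by
      apply ModuleCat.hom_ext; apply LinearMap.ext; intro z
      let g : ModuleCat.of R R ⟶ K.cycles i := ModuleCat.ofHom (LinearMap.toSpanSingleton R _ z)
      let φ : (HomologicalComplex.single (ModuleCat.{0} R) (ComplexShape.up ℤ) i).obj (ModuleCat.of R R) ⟶ K := 
        HomologicalComplex.mkHomFromSingle (g ≫ K.iCycles i) (by intro k _; simp)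
      have h0 : DerivedCategory.Q.map φ = 0 := by
        let s := ((DerivedCategory.singleFunctors (ModuleCat.{0} R)).shiftIso (-i) i 0 (by simp)).app (ModuleCat.of R R)
        have h1 := h.shift' (-i) 0 (s.hom ≫ DerivedCategory.Q.map φ ≫ e.hom ≫ (shiftFunctorZero _ ℤ).inv.app X)
        have h2 : DerivedCategory.Q.map φ ≫ e.hom ≫ (shiftFunctorZero _ ℤ).inv.app X = 0 := 
          (cancel_epi s.hom).1 (h1.trans comp_zero.symm)
        have h3 : Mono (e.hom ≫ (shiftFunctorZero _ ℤ).inv.app X) := inferInstance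
        exact (cancel_mono (e.hom ≫ (shiftFunctorZero _ ℤ).inv.app X)).1 (h2.trans zero_comp.symm)
      have h4 : HomologicalComplex.homologyMap φ i = 0 := by
        have := (DerivedCategory.homologyFunctorFactors (ModuleCat.{0} R) i).hom.naturality φ
        have h5 : (DerivedCategory.Q ⋙ DerivedCategory.homologyFunctor (ModuleCat.{0} R) i).map φ = 0 := by
          rw [Functor.comp_map, h0, Functor.map_zero]
        rw [h5, zero_comp] at this
        exact (cancel_epi ((DerivedCategory.homologyFunctorFactors (ModuleCat.{0} R) i).hom.app _)).1 
          (this.symm.trans comp_zero.symm)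
      have h6 : (HomologicalComplex.singleObjCyclesSelfIso (ComplexShape.up ℤ) i (ModuleCat.of R R)).inv ≫ 
          HomologicalComplex.cyclesMap φ i = g := by
        rw [← cancel_mono (K.iCycles i)]
        rw [Category.assoc, HomologicalComplex.cyclesMap_i]
        rw [HomologicalComplex.singleObjCyclesSelfIso_inv_iCycles_assoc]
        rw [HomologicalComplex.mkHomFromSingle_f]
        simp
      have h7 : g ≫ K.homologyπ i = 0 := by
        rw [← h6, Category.assoc, ← HomologicalComplex.homologyπ_naturality, h4, comp_zero, comp_zero]
      have h8 := congrArg (fun f => f.hom (1 : R)) h7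
      have h9 : g.hom (1 : R) = z := one_smul _ _
      rw [← h9]
      exact h8
    rw [IsZero.iff_id_eq_zero, ← cancel_epi (K.homologyπ i), hπ, zero_comp, zero_comp]
  have h0 : ∀ i, IsZero ((DerivedCategory.homologyFunctor (ModuleCat.{0} R) i).obj X) := by
    intro i
    apply (hK i).of_iso
    exact ((DerivedCategory.homologyFunctor (ModuleCat.{0} R) i).mapIso e).symm ≪≫ 
      (DerivedCategory.homologyFunctorFactors (ModuleCat.{0} R) i).app K
  have : IsIso (0 : X ⟶ 0) := by
    rw [DerivedCategory.isIso_iff]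
    intro n
    have hz := Functor.map_isZero (DerivedCategory.homologyFunctor (ModuleCat.{0} R) n) (isZero_zero (DerivedCategory (ModuleCat.{0} R)))
    exact ⟨0, (h0 n).eq_of_src _ _, hz.eq_of_src _ _⟩
  exact (isZero_zero _).of_iso (asIso (0 : X ⟶ 0))

abbrev SF (Y : Type) [AddCommGroup Y] [Module R Y] : DerivedCategory (ModuleCat.{0} R) :=
  (DerivedCategory.singleFunctor (ModuleCat.{0} R) 0).obj (ModuleCat.of R Y)

def LT (l : List R) (Y : Type) [AddCommGroup Y] [Module R Y] : Prop :=
  ∀ y : Y, ∀ x ∈ l, ∃ n : ℕ, x ^ n • y = 0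

lemma x_bij (x : R) (l : List R) (X : DerivedCategory (ModuleCat.{0} R))
    (hX : ∀ (Y : Type) [AddCommGroup Y] [Module R Y], LT (x :: l) Y → orth (SF (R := R) Y) X)
    (Y : Type) [AddCommGroup Y] [Module R Y] (hY : LT l Y) (n : ℤ) :
    Function.Bijective (fun f : SF (R := R) Y ⟶ X⟦n⟧ => x • f) := by
  let m : Y →ₗ[R] Y := x • LinearMap.id
  let q := m.rangeRestrict
  let j := (LinearMap.range m).subtype
  have h1 := SC_ex (LinearMap.ker q).subtype q (LinearMap.exact_subtype_ker_map q) 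
    (Submodule.subtype_injective _) m.surjective_rangeRestrict
  have h2 := SC_ex j (LinearMap.range m).mkQ (LinearMap.exact_subtype_mkQ _) 
    (Submodule.subtype_injective _) (Submodule.mkQ_surjective _)
  have t1 : LT (x :: l) (LinearMap.ker q) := by
    intro y z hz
    rcases List.mem_cons.1 hz with rfl | hz
    · refine ⟨1, ?_⟩
      apply Subtype.ext
      have : q y = 0 := y.2
      have := congrArg Subtype.val this
      have h : z • (y : Y) = 0 := this
      simpa using h
    · obtain ⟨n, hn⟩ := hY y z hz
      exact ⟨n, Subtype.ext hn⟩
  have t2 : LT (x :: l) (Y ⧸ LinearMap.range m) := by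
    intro y z hz
    obtain ⟨y, rfl⟩ := Submodule.mkQ_surjective _ y
    rcases List.mem_cons.1 hz with rfl | hz
    · refine ⟨1, ?_⟩
      rw [← map_smul]
      exact (Submodule.Quotient.mk_eq_zero _).2 ⟨y, by simp [m]⟩
    · obtain ⟨n, hn⟩ := hY y z hz
      exact ⟨n, by rw [← map_smul, hn, map_zero]⟩
  have o1 := hX _ t1
  have o2 := hX _ t2
  have d1 := h1.singleTriangle_distinguished
  have d2 := h2.singleTriangle_distinguished
  let S := DerivedCategory.singleFunctor (ModuleCat.{0} R) 0
  have e : S.map (ModuleCat.ofHom q) ≫ S.map (ModuleCat.ofHom j) = x • 𝟙 (SF (R := R) Y) := by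
    rw [← Functor.map_comp]
    have : ModuleCat.ofHom q ≫ ModuleCat.ofHom j = x • 𝟙 (ModuleCat.of R Y) := rfl
    rw [this, Functor.map_smul, CategoryTheory.Functor.map_id]
  have hf : ∀ f : SF (R := R) Y ⟶ X⟦n⟧, x • f = S.map (ModuleCat.ofHom q) ≫ S.map (ModuleCat.ofHom j) ≫ f := by
    intro f
    rw [← Category.assoc, e, Linear.smul_comp, Category.id_comp]
  constructor
  · intro f g hfg
    rw [← sub_eq_zero] at hfg ⊢
    have h0 : x • (f - g) = 0 := by rw [smul_sub]; exact hfg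
    rw [hf] at h0
    have h3 := tri_inj₂ d1 (X := X⟦n⟧) (fun f => o1.shift' 1 n f) _ h0
    exact tri_inj₁ d2 (X := X⟦n⟧) (fun f => o2 n f) _ h3
  · intro f
    obtain ⟨g, hg⟩ := tri_surj₂ d1 (X := X⟦n⟧) (fun f => o1 n f) f
    obtain ⟨k, hk⟩ := tri_surj₁ d2 (X := X⟦n⟧) (fun f => (o2.shift n) 1 f) g
    refine ⟨k, (hf k).trans ?_⟩
    rw [hg, hk]
    rfl

lemma orth_list (l : List R) : ∀ (X : DerivedCategory (ModuleCat.{0} R))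
    (_ : ∀ (Y : Type) [AddCommGroup Y] [Module R Y], LT l Y → orth (SF (R := R) Y) X)
    (T : Type) [AddCommGroup T] [Module R T] (_ : ∀ x ∈ l, ∃ n : ℕ, ∀ t : T, x ^ n • t = 0),
    orth X (SF (R := R) T) := by
  induction l with
  | nil =>
    intro X hX T _ _ _ n f
    exact (isZero_of_orth X (hX R (by intro y x hx; simp at hx))).eq_of_src _ _
  | cons x l ih =>
    intro X hX T _ _ hT n f
    obtain ⟨C, g, h, hC⟩ := distinguished_cocone_triangle (x • 𝟙 X)
    have hA : ∀ (Y : Type) [AddCommGroup Y] [Module R Y], LT l Y → orth (SF (R := R) Y) C := 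
      fun Y _ _ hY => orth_cone x hC (fun n => x_bij x l X hX Y hY n)
    have hO := ih C hA T (fun y hy => hT y (List.mem_cons_of_mem _ hy))
    have hinj : ∀ f : X ⟶ (SF (R := R) T)⟦n⟧, x • f = 0 → f = 0 := by
      intro f hf
      apply tri_inj₁ hC (X := (SF (R := R) T)⟦n⟧) (fun f => hO n f) f
      change (x • 𝟙 X) ≫ f = 0
      rw [Linear.smul_comp, Category.id_comp, hf]
    obtain ⟨k, hk⟩ := hT x List.mem_cons_self
    have h0 : x ^ k • f = 0 := by
      have h1 : x ^ k • 𝟙 (ModuleCat.of R T) = 0 := by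
        apply ModuleCat.hom_ext; apply LinearMap.ext; intro t
        exact hk t
      have h2 : x ^ k • 𝟙 ((SF (R := R) T)⟦n⟧) = 0 := by
        rw [← CategoryTheory.Functor.map_id, ← CategoryTheory.Functor.map_id, ← Functor.map_smul, ← Functor.map_smul, h1, 
          Functor.map_zero, Functor.map_zero]
      rw [← Category.comp_id f, ← Linear.comp_smul, h2, comp_zero]
    clear hk
    induction k with
    | zero => simpa using h0
    | succ k ihk =>
      apply ihk
      apply hinj
      rw [smul_smul, ← pow_succ', h0]

end der

lemma lemD {R : Type} [CommRing R] [IsNoetherianRing R] (a : Ideal R) (N : Type) [AddCommGroup N] [Module R N]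
    (hN : ∀ j, V a j (ModuleCat.of R N)) (T : Type) [AddCommGroup T] [Module R T] (n : ℕ)
    (hT : ∀ r ∈ a ^ n, ∀ t : T, r • t = 0) (k : ℕ) 
    (x : Abelian.Ext (ModuleCat.of R N) (ModuleCat.of R T) k) : x = 0 := by
  let _ := HasDerivedCategory.standard (ModuleCat.{0} R)
  obtain ⟨s, hs⟩ := (IsNoetherian.noetherian a : a.FG)
  have hl : ∀ y ∈ s.toList, y ∈ a := fun y hy => hs ▸ Ideal.subset_span (by simpa using hy)
  have key := orth_list s.toList (SF (R := R) N) (by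
    intro Y _ _ hY m f
    have htors : Tors a Y := by
      intro y
      have hrad : a ≤ Ideal.radical (LinearMap.ker (LinearMap.toSpanSingleton R Y y)) := by
        conv_lhs => rw [← hs]
        rw [Ideal.span_le]
        intro z hz
        obtain ⟨n, hn⟩ := hY y z (by simpa using hz)
        exact ⟨n, hn⟩
      obtain ⟨n, hn⟩ := Ideal.exists_pow_le_of_le_radical_of_fg hrad (IsNoetherian.noetherian a)
      exact mem_Ga.2 ⟨n, fun r hr => hn hr⟩
    by_cases hm : 0 ≤ m
    · obtain ⟨m, rfl⟩ := Int.eq_ofNat_of_zero_le hm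
      have := ext_tors a (m + 1) N (fun j _ => hN j) Y htors m (by lia) (Abelian.Ext.homEquiv.symm f)
      have h2 := congrArg Abelian.Ext.hom this
      rw [Abelian.Ext.zero_hom] at h2
      rw [← h2]
      exact (Abelian.Ext.homEquiv.apply_symm_apply f).symm
    · have hge := DerivedCategory.TStructure.t.isGE_shift (SF (R := R) N) 0 m (-m) (by lia)
      exact DerivedCategory.TStructure.t.zero_of_isLE_of_isGE f 0 (-m) (by lia) inferInstance hge) T (by
    intro y hy
    exact ⟨n, hT _ (Ideal.pow_mem_pow (hl y hy) n)⟩)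
  ext
  rw [Abelian.Ext.zero_hom]
  exact key _ _
end LCB
end
end

section
open CategoryTheory
set_option maxHeartbeats 1000000
noncomputable section
namespace LCB
variable {R : Type} [CommRing R]

lemma Ga_quot [IsNoetherianRing R] (a : Ideal R) (N : Type) [AddCommGroup N] [Module R N] :
    Ga a (N ⧸ Ga a N) = ⊥ := by
  rw [eq_bot_iff]
  intro x hx
  obtain ⟨x, rfl⟩ := Submodule.mkQ_surjective _ x
  obtain ⟨n, hn⟩ := mem_Ga.1 hx
  let g : (a ^ n : Ideal R) →ₗ[R] N := (LinearMap.toSpanSingleton R N x).comp (a ^ n : Ideal R).subtype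
  obtain ⟨m, hm⟩ := exists_kill a g (by
    intro r
    have := hn r r.2
    rw [← map_smul] at this
    exact (Submodule.Quotient.mk_eq_zero _).1 this)
  refine (Submodule.Quotient.mk_eq_zero _).2 (mem_Ga.2 ⟨m + n, ?_⟩)
  intro r hr
  rw [pow_add] at hr
  refine Submodule.mul_induction_on hr ?_ ?_
  · intro s hs t ht
    rw [mul_smul]
    exact hm ⟨t, ht⟩ s hs
  · intro s t hs ht
    rw [add_smul, hs, ht, add_zero]

lemma low [IsNoetherianRing R] (a : Ideal R) (M T : Type) [AddCommGroup M] [Module R M] 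
    [AddCommGroup T] [Module R T] (φ : M →ₗ[R] T) (n : ℕ) (hT : ∀ r ∈ a ^ n, ∀ t : T, r • t = 0)
    (c : ℕ) (hM : ∀ j < c, V a j (ModuleCat.of R M)) (t : ℕ) :
    ∀ (N : Type) [AddCommGroup N] [Module R N], (∀ j, t < j → V a j (ModuleCat.of R N)) → 
    ∀ k, t + k < c → ∀ y : Abelian.Ext (ModuleCat.of R N) (ModuleCat.of R M) k,
      y.comp (Abelian.Ext.mk₀ (ModuleCat.ofHom φ)) (add_zero k) = 0 := by
  induction t with
  | zero =>
    intro N _ _ hN k hk y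
    have hS := SC_ex (Ga a N).subtype (Ga a N).mkQ (LinearMap.exact_subtype_mkQ _) 
      (Submodule.subtype_injective _) (Submodule.mkQ_surjective _)
    obtain ⟨z, rfl⟩ := Abelian.Ext.contravariant_sequence_exact₂ hS _ y 
      (ext_tors a c M hM _ (Tors_Ga a N) k (by lia) _)
    rw [Abelian.Ext.comp_assoc_of_third_deg_zero]
    have hV : ∀ j, V a j (ModuleCat.of R (N ⧸ Ga a N)) := by
      intro j
      rcases Nat.eq_zero_or_pos j with rfl | hj
      · exact V_zero_iff.2 (Ga_quot a N)
      · exact V_right hS (hN j hj) (V_tors a j _ (Tors_Ga a N))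
    have := lemD a _ hV T n hT k (z.comp (Abelian.Ext.mk₀ (ModuleCat.ofHom φ)) (add_zero k))
    rw [this, Abelian.Ext.comp_zero]
  | succ t ih =>
    intro N _ _ hN k hk y
    have hS := SC_ex (Ga a N).subtype (Ga a N).mkQ (LinearMap.exact_subtype_mkQ _) 
      (Submodule.subtype_injective _) (Submodule.mkQ_surjective _)
    obtain ⟨z, rfl⟩ := Abelian.Ext.contravariant_sequence_exact₂ hS _ y 
      (ext_tors a c M hM _ (Tors_Ga a N) k (by lia) _)
    rw [Abelian.Ext.comp_assoc_of_third_deg_zero]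
    have hV : ∀ j, t + 1 < j → V a j (ModuleCat.of R (N ⧸ Ga a N)) := 
      fun j hj => V_right hS (hN j hj) (V_tors a j _ (Tors_Ga a N))
    obtain ⟨I, _, _, hI, f, hf, hI0⟩ := exists_inj_tf a (N ⧸ Ga a N) (Ga_quot a N)
    have hS' := SQ f hf
    have hV' : ∀ j, t < j → V a j (ModuleCat.of R (I ⧸ LinearMap.range f)) := 
      fun j hj => V_right hS' (V_inj I hI0 j) (hV (j + 1) (by lia))
    have h1 := ih _ hV' (1 + k) (by lia) (hS'.extClass.comp z rfl)
    rw [Abelian.Ext.comp_assoc_of_third_deg_zero] at h1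
    obtain ⟨w, hw⟩ := Abelian.Ext.contravariant_sequence_exact₁ hS' _ 
      (z.comp (Abelian.Ext.mk₀ (ModuleCat.ofHom φ)) (add_zero k)) rfl h1
    have := lemD a I (V_inj I hI0) T n hT k w
    rw [← hw, this, Abelian.Ext.comp_zero, Abelian.Ext.comp_zero]

lemma lower [IsNoetherianRing R] [IsLocalRing R] (a : Ideal R) (ha : a ≠ ⊤) (M N : Type) 
    [AddCommGroup M] [Module R M] [Module.Finite R M] [AddCommGroup N] [Module R N] (c : ℕ)
    (hM : ∀ j < c, V a j (ModuleCat.of R M)) (hN : ∀ j, c ≤ j → V a j (ModuleCat.of R N))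
    (f : N →ₗ[R] M) : f = 0 := by
  have key : ∀ n x, f x ∈ (a ^ n • ⊤ : Submodule R M) := by
    intro n x
    let T := M ⧸ (a ^ n • ⊤ : Submodule R M)
    let φ : M →ₗ[R] T := Submodule.mkQ _
    have hT : ∀ r ∈ a ^ n, ∀ t : T, r • t = 0 := by
      intro r hr t
      obtain ⟨t, rfl⟩ := Submodule.mkQ_surjective _ t
      rw [← map_smul]
      exact (Submodule.Quotient.mk_eq_zero _).2 (Submodule.smul_mem_smul hr trivial)
    have h0 : (Abelian.Ext.mk₀ (ModuleCat.ofHom f)).comp (Abelian.Ext.mk₀ (ModuleCat.ofHom φ)) (add_zero 0) = 0 := by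
      cases c with
      | zero => exact lemD a N (fun j => hN j (by lia)) T n hT _ _
      | succ t => exact low a M T φ n hT (t + 1) hM t N (fun j hj => hN j hj) 0 (by lia) _
    rw [Abelian.Ext.mk₀_comp_mk₀, Abelian.Ext.mk₀_eq_zero_iff] at h0
    have := congrArg (fun g => g.hom x) h0
    exact (Submodule.Quotient.mk_eq_zero _).1 this
  ext x
  have h := Ideal.iInf_pow_smul_eq_bot_of_isLocalRing (M := M) a ha
  have : f x ∈ (⨅ i, a ^ i • ⊤ : Submodule R M) := Submodule.mem_iInf _ |>.2 (fun n => key n x)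
  rw [h] at this
  exact this

lemma ass_sub [IsNoetherianRing R] (M : Type) [AddCommGroup M] [Module R M] [Module.Finite R M] :
    associatedPrimes R (R ⧸ Module.annihilator R M) ⊆ associatedPrimes R M := by
  intro p hp
  obtain ⟨hpp, r, hr⟩ := isAssociatedPrime_iff.1 hp
  obtain ⟨r, rfl⟩ := Submodule.Quotient.mk_surjective _ r
  have hr' : ∀ s, s ∈ p ↔ ∀ m : M, (s * r) • m = 0 := by
    intro s
    rw [hr, Submodule.mem_colon_singleton, Submodule.mem_bot, ← Submodule.Quotient.mk_smul, 
      Submodule.Quotient.mk_eq_zero, Module.mem_annihilator]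
    rfl
  obtain ⟨S, hS⟩ := (Module.Finite.fg_top : (⊤ : Submodule R M).FG)
  have hle : S.inf (fun m => (Submodule.colon (⊥ : Submodule R M) {r • m} : Ideal R)) ≤ p := by
    intro s hs
    rw [hr']
    intro m
    have hm : m ∈ Submodule.span R (S : Set M) := hS ▸ trivial
    induction hm using Submodule.span_induction with
    | mem x hx => 
      have := (Finset.inf_le (f := fun m => (Submodule.colon (⊥ : Submodule R M) {r • m} : Ideal R)) hx) hs
      rw [Submodule.mem_colon_singleton, Submodule.mem_bot] at this
      rw [mul_smul, this]
    | zero => simp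
    | add x y _ _ hx hy => rw [smul_add, hx, hy, add_zero]
    | smul b x _ hx => rw [smul_comm, hx, smul_zero]
  obtain ⟨m, hm, hmp⟩ := (Ideal.IsPrime.inf_le' hpp).1 hle
  refine isAssociatedPrime_iff.2 ⟨hpp, r • m, le_antisymm ?_ hmp⟩
  intro s hs
  rw [Submodule.mem_colon_singleton, Submodule.mem_bot, ← mul_smul]
  exact (hr' s).1 hs m

end LCB
end
end

theorem stmt14 {R : Type} [CommRing R] [IsNoetherianRing R] [IsLocalRing R]
    (a : Ideal R) (M : ModuleCat R) [Module.Finite R M] (hM : Nontrivial M)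
    (c : ℕ) (hcd : HasCD a M c)
    (hrcm : ∀ i, i ≠ c → Subsingleton ((localCohomology a i).obj M)) :
    associatedPrimes R (R ⧸ Module.annihilator R M) ⊆
      {p | p ∈ associatedPrimes R M ∧ HasCD a (ModuleCat.of R (R ⧸ p)) c} := by
  intro p hp
  have hpM := LCB.ass_sub M hp
  obtain ⟨hpp, x, hx⟩ := isAssociatedPrime_iff.1 hpM
  have hV : ∀ i, i ≠ c → LCB.V a i (ModuleCat.of R M) := 
    fun i hi => (LCB.subsingleton_iff_V a i M).1 (hrcm i hi)
  have ha : a ≠ ⊤ := by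
    intro ha
    have := (LCB.subsingleton_iff_V a c M).2 (LCB.V_top ha)
    exact not_nontrivial_iff_subsingleton.2 this hcd.1
  have hsupp : (⟨p, hpp⟩ : PrimeSpectrum R) ∈ Module.support R M := by
    rw [Module.mem_support_iff_of_finite]
    intro s hs
    change s ∈ p
    rw [hx, Submodule.mem_colon_singleton, Submodule.mem_bot]
    exact Module.mem_annihilator.1 hs x
  have hup : ∀ i, c < i → LCB.V a i (ModuleCat.of R (R ⧸ p)) := 
    fun i hi => LCB.upper a M c (fun i hi => hV i (by lia)) ⟨p, hpp⟩ hsupp i hi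
  refine ⟨hpM, ?_, fun i hi => (LCB.subsingleton_iff_V a i _).2 (hup i hi)⟩
  by_contra hn
  rw [not_nontrivial_iff_subsingleton, LCB.subsingleton_iff_V] at hn
  have hN : ∀ j, c ≤ j → LCB.V a j (ModuleCat.of R (R ⧸ p)) := by
    intro j hj
    rcases hj.eq_or_lt with rfl | hj
    · exact hn
    · exact hup j hj
  let f : (R ⧸ p) →ₗ[R] M := Submodule.liftQ p (LinearMap.toSpanSingleton R M x) (by
    intro s hs
    rw [hx, Submodule.mem_colon_singleton, Submodule.mem_bot] at hs
    exact hs)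
  have hf := LCB.lower a ha M (R ⧸ p) c (fun j hj => hV j (by lia)) hN f
  have h1 : f (Submodule.Quotient.mk 1) = 0 := by rw [hf]; rfl
  have h2 : (1 : R) • x = 0 := h1
  apply hpp.ne_top
  rw [Ideal.eq_top_iff_one, hx, Submodule.mem_colon_singleton, Submodule.mem_bot]
  exact h2
end

section
/- Let (R, 𝔪) be a Noetherian local ring, 𝔞 an ideal, and M a relative Cohen-Macaulay R-module with respect to 𝔞 with cd(𝔞, M) = c. Then the set of minimal associated primes of M equals the set of minimal attached primes of H^c_𝔞(M). -/
open CategoryTheory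

namespace LCaux
open Opposite

section ExtRel
variable {R : Type} [CommRing R]

/-- the complex `Hom(P, M)`, in the opposite category -/
noncomputable abbrev homCx {X : ModuleCat.{0} R} (P : ProjectiveResolution X) (M : ModuleCat.{0} R) :
    ChainComplex (ModuleCat.{0} R)ᵒᵖ ℕ :=
  ((((linearYoneda R (ModuleCat.{0} R)).obj M).rightOp.mapHomologicalComplex _).obj P.complex)

/-- the computation of the derived functor -/
noncomputable def isoH {X : ModuleCat.{0} R} (P : ProjectiveResolution X) (M : ModuleCat.{0} R)
    (i : ℕ) : (((linearYoneda R (ModuleCat.{0} R)).obj M).rightOp.leftDerived i).obj X ≅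
      (homCx P M).homology i :=
  P.isoLeftDerivedObj ((linearYoneda R (ModuleCat.{0} R)).obj M).rightOp i

/-- the module of cocycles -/
noncomputable abbrev Coc {X : ModuleCat.{0} R} (P : ProjectiveResolution X) (M : ModuleCat.{0} R)
    (i : ℕ) : ModuleCat.{0} R := unop ((homCx P M).opcycles i)

/-- the map from cocycles to Ext -/
noncomputable def clsMap {X : ModuleCat.{0} R} (P : ProjectiveResolution X) (M : ModuleCat.{0} R)
    (i : ℕ) : Coc P M i ⟶ ((Ext R (ModuleCat.{0} R) i).obj (op X)).obj M :=
  ((isoH P M i).hom ≫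
    (homCx P M).homologyι i).unop

noncomputable def cocMap {X : ModuleCat.{0} R} (P : ProjectiveResolution X) (M : ModuleCat.{0} R)
    (i : ℕ) : Coc P M i ⟶ ModuleCat.of R (P.complex.X i ⟶ M) :=
  ((homCx P M).pOpcycles i).unop

lemma clsMap_surjective {X : ModuleCat.{0} R} (P : ProjectiveResolution X) (M : ModuleCat.{0} R)
    (i : ℕ) : Function.Surjective (clsMap P M i) := by
  rw [← ModuleCat.epi_iff_surjective]
  exact unop_epi_of_mono ((isoH P M i).hom ≫ (homCx P M).homologyι i)

lemma cocMap_injective {X : ModuleCat.{0} R} (P : ProjectiveResolution X) (M : ModuleCat.{0} R)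
    (i : ℕ) : Function.Injective (cocMap P M i) := by
  rw [← ModuleCat.mono_iff_injective]
  exact unop_mono_of_epi ((homCx P M).pOpcycles i)

lemma cocMap_cocycle {X : ModuleCat.{0} R} (P : ProjectiveResolution X) (M : ModuleCat.{0} R)
    (i : ℕ) (w : Coc P M i) :
    P.complex.d (i+1) i ≫ (show P.complex.X i ⟶ M from cocMap P M i w) = 0 := by
  have h := congrArg Quiver.Hom.unop ((homCx P M).d_pOpcycles (i+1) i)
  have h2 := congrArg (fun t => t.hom w) h
  exact h2

lemma exists_cocMap {X : ModuleCat.{0} R} (P : ProjectiveResolution X) (M : ModuleCat.{0} R)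
    (i : ℕ) (f : P.complex.X i ⟶ M) (hf : P.complex.d (i+1) i ≫ f = 0) :
    ∃ w, cocMap P M i w = f := by
  have hex : (ShortComplex.mk _ _ ((homCx P M).d_pOpcycles (i+1) i)).Exact :=
    ShortComplex.exact_of_g_is_cokernel _ ((homCx P M).opcyclesIsCokernel (i+1) i (by simp))
  have := hex.unop
  rw [ShortComplex.moduleCat_exact_iff] at this
  exact this f hf

lemma clsMap_eq_zero_iff {X : ModuleCat.{0} R} (P : ProjectiveResolution X) (M : ModuleCat.{0} R)
    (i : ℕ) (w : Coc P M i) :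
    clsMap P M i w = 0 ↔ ∃ g : P.complex.X ((ComplexShape.down ℕ).next i) ⟶ M,
      P.complex.d i _ ≫ g = (show P.complex.X i ⟶ M from cocMap P M i w) := by
  set k := (ComplexShape.down ℕ).next i with hk
  have hex : (ShortComplex.mk _ _ ((homCx P M).homologyι_comp_fromOpcycles i k)).Exact :=
    ShortComplex.exact_of_f_is_kernel _ ((homCx P M).homologyIsKernel i k rfl)
  have hu := hex.unop
  rw [ShortComplex.moduleCat_exact_iff] at hu
  have hp := congrArg Quiver.Hom.unop ((homCx P M).p_fromOpcycles i k)
  have key : clsMap P M i w = 0 ↔ ((homCx P M).homologyι i).unop w = 0 := by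
    let e := isoH P M i
    have hinj : Function.Injective e.hom.unop := by
      rw [← ModuleCat.mono_iff_injective]; infer_instance
    have : clsMap P M i w = e.hom.unop (((homCx P M).homologyι i).unop w) := rfl
    rw [this]
    constructor
    · intro h; apply hinj; exact h.trans (map_zero e.hom.unop.hom).symm
    · intro h; rw [h]; exact map_zero e.hom.unop.hom
  rw [key]
  constructor
  · intro h
    obtain ⟨g, hg⟩ := hu w h
    refine ⟨g, ?_⟩
    rw [← hg]
    exact (congrArg (fun t => t.hom g) hp).symm
  · rintro ⟨g, hg⟩
    have : w = ((homCx P M).fromOpcycles i k).unop g := by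
      apply cocMap_injective
      exact hg.symm.trans (congrArg (fun t => t.hom g) hp).symm
    rw [this]
    have h0 := congrArg Quiver.Hom.unop ((homCx P M).homologyι_comp_fromOpcycles i k)
    exact congrArg (fun t => t.hom g) h0

lemma cls_naturality {X Y : ModuleCat.{0} R} (u : X ⟶ Y) (P : ProjectiveResolution X)
    (Q : ProjectiveResolution Y) (φ : P.complex ⟶ Q.complex)
    (comm : φ.f 0 ≫ Q.π.f 0 = P.π.f 0 ≫ u) (M : ModuleCat.{0} R) (i : ℕ)
    (w : Coc Q M i) :
    ∃ w' : Coc P M i,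
      (show P.complex.X i ⟶ M from cocMap P M i w') =
        φ.f i ≫ (show Q.complex.X i ⟶ M from cocMap Q M i w) ∧
      clsMap P M i w' = ((Ext R (ModuleCat.{0} R) i).map u.op).app M (clsMap Q M i w) := by
  let F := ((linearYoneda R (ModuleCat.{0} R)).obj M).rightOp
  let ψ : homCx P M ⟶ homCx Q M := (F.mapHomologicalComplex _).map φ
  refine ⟨(HomologicalComplex.opcyclesMap ψ i).unop w, ?_, ?_⟩
  · have h := congrArg Quiver.Hom.unop (HomologicalComplex.p_opcyclesMap ψ i)
    exact congrArg (fun t => t.hom w) h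
  · have h1 := ProjectiveResolution.isoLeftDerivedObj_hom_naturality u P Q φ comm F i
    have h1' : (F.leftDerived i).map u ≫ (isoH Q M i).hom = (isoH P M i).hom ≫
        HomologicalComplex.homologyMap ψ i := h1
    have h2 := HomologicalComplex.homologyι_naturality ψ i
    have h3 : (F.leftDerived i).map u ≫ (isoH Q M i).hom ≫ (homCx Q M).homologyι i
        = (isoH P M i).hom ≫ (homCx P M).homologyι i ≫
          HomologicalComplex.opcyclesMap ψ i := by
      rw [← Category.assoc, h1', Category.assoc, h2]
    have h4 := congrArg Quiver.Hom.unop h3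
    exact (congrArg (fun t => t.hom w) h4).symm

lemma isZero_Ext {X : ModuleCat.{0} R} (hX : Limits.IsZero X) (M : ModuleCat.{0} R) (i : ℕ) :
    Limits.IsZero (((Ext R (ModuleCat.{0} R) i).obj (op X)).obj M) := by
  let F := ((linearYoneda R (ModuleCat.{0} R)).obj M).rightOp
  have P := projectiveResolution X
  refine Limits.IsZero.unop (X := (F.leftDerived i).obj X) ?_
  have : Projective X := ⟨fun f e _ => ⟨0, hX.eq_of_src _ _⟩⟩
  refine Limits.IsZero.of_iso ?_ ((ProjectiveResolution.self X).isoLeftDerivedObj F i)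
  erw [← HomologicalComplex.exactAt_iff_isZero_homology]
  refine ShortComplex.exact_of_isZero_X₂ _ (F.map_isZero ?_)
  cases i with
  | zero => exact hX
  | succ n => exact (HomologicalComplex.isZero_single_obj_X
    (ComplexShape.down ℕ) 0 X (n + 1) (by simp))

end ExtRel
end LCaux

namespace LCaux
open Opposite Limits
section Kill
variable {R : Type} [CommRing R] (a : Ideal R)

/-- the module `R / a^n` -/
noncomputable abbrev Xn (n : ℕ) : ModuleCat.{0} R :=
  (localCohomology.ringModIdeals (localCohomology.idealPowersDiagram a)).obj (op n)

/-- the transition map -/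
noncomputable abbrev Xmap {n m : ℕ} (h : n ≤ m) : Xn a m ⟶ Xn a n :=
  (localCohomology.ringModIdeals (localCohomology.idealPowersDiagram a)).map (homOfLE h).op

/-- a resolution of `R / a^n` -/
noncomputable abbrev Pn (n : ℕ) : ProjectiveResolution (Xn a n) := projectiveResolution (Xn a n)

/-- the augmentation -/
noncomputable def pin (n : ℕ) : (Pn a n).complex.X 0 ⟶ Xn a n := (Pn a n).π.f 0

lemma pin_epi (n : ℕ) : Epi (pin a n) := by
  have : Epi ((Pn a n).π.f 0) := inferInstance
  exact this

lemma d_pin (n : ℕ) : (Pn a n).complex.d 1 0 ≫ pin a n = 0 :=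
  (Pn a n).complex_d_comp_π_f_zero

/-- Elementary form of: `r` kills the local cohomology. -/
def Kills (r : R) (i : ℕ) (M : ModuleCat.{0} R) : Prop :=
  ∀ (n : ℕ) (f : (Pn a n).complex.X i ⟶ M), (Pn a n).complex.d (i+1) i ≫ f = 0 →
    ∃ (m : ℕ) (h : n ≤ m) (φ : (Pn a m).complex ⟶ (Pn a n).complex)
      (_ : φ.f 0 ≫ pin a n = pin a m ≫ Xmap a h)
      (g : (Pn a m).complex.X ((ComplexShape.down ℕ).next i) ⟶ M),
      (Pn a m).complex.d i _ ≫ g = r • (φ.f i ≫ f)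

/-- the diagram evaluated at `M` -/
noncomputable abbrev Dg (i : ℕ) (M : ModuleCat.{0} R) : ℕᵒᵖᵒᵖ ⥤ ModuleCat.{0} R :=
  localCohomology.diagram (localCohomology.idealPowersDiagram a) i ⋙ (evaluation _ _).obj M

lemma exists_cocone (i : ℕ) (M : ModuleCat.{0} R) :
    ∃ c : Cocone (Dg a i M), c.pt = (localCohomology a i).obj M ∧ Nonempty (IsColimit c) := by
  have := localCohomology.hasColimitDiagram.{0,0} (localCohomology.idealPowersDiagram a) i
  refine ⟨((evaluation _ _).obj M).mapCocone (colimit.cocone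
    (localCohomology.diagram (localCohomology.idealPowersDiagram a) i)), rfl,
    ⟨isColimitOfPreserves _ (colimit.isColimit _)⟩⟩

lemma kills_iff_aux (r : R) (i : ℕ) (M : ModuleCat.{0} R) (c : Cocone (Dg a i M))
    (hc : IsColimit c) : Kills a r i M ↔ ∀ z : c.pt, r • z = 0 := by
  constructor
  · intro hK z
    obtain ⟨j, y, rfl⟩ := Concrete.isColimit_exists_rep (Dg a i M) hc z
    set n : ℕ := j.unop.unop
    obtain ⟨w, hw⟩ := clsMap_surjective (Pn a n) M i y
    obtain ⟨m, h, φ, comm, g, hg⟩ := hK n _ (cocMap_cocycle (Pn a n) M i w)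
    obtain ⟨w', h1, h2⟩ := cls_naturality (Xmap a h) (Pn a m) (Pn a n) φ comm M i w
    have h3 : clsMap (Pn a m) M i (r • w') = 0 := by
      rw [clsMap_eq_zero_iff]
      refine ⟨g, ?_⟩
      rw [hg, ← h1]
      exact (map_smul (cocMap (Pn a m) M i).hom r w').symm
    rw [map_smul, h2, hw] at h3
    have h4 := congrArg (fun t => t.hom y) (c.w (homOfLE h).op.op)
    change c.ι.app (op (op m)) ((Dg a i M).map (homOfLE h).op.op y) = c.ι.app j y at h4
    rw [← h4, ← map_smul]
    have h5 : r • ((Dg a i M).map (homOfLE h).op.op y) = 0 := h3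
    rw [h5, map_zero]
  · intro hz n f hf
    obtain ⟨w, hw⟩ := exists_cocMap (Pn a n) M i f hf
    let y : (Dg a i M).obj (op (op n)) := clsMap (Pn a n) M i w
    have h0 := hz (c.ι.app (op (op n)) y)
    have h1 : c.ι.app (op (op n)) (r • y) = c.ι.app (op (op n)) 0 := by
      rw [map_smul, h0, map_zero]
    obtain ⟨k, u, v, huv⟩ := Concrete.isColimit_exists_of_rep_eq (Dg a i M) hc _ _ h1
    rw [map_zero, map_smul] at huv
    set m : ℕ := k.unop.unop
    have h : n ≤ m := leOfHom u.unop.unop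
    have comm := ProjectiveResolution.lift_commutes_zero (Xmap a h) (Pn a m) (Pn a n)
    obtain ⟨w', h1, h2⟩ := cls_naturality (Xmap a h) (Pn a m) (Pn a n) _ comm M i w
    have h3 : clsMap (Pn a m) M i (r • w') = 0 := by
      rw [map_smul, h2]
      exact huv
    rw [clsMap_eq_zero_iff] at h3
    obtain ⟨g, hg⟩ := h3
    refine ⟨m, h, _, comm, g, ?_⟩
    rw [hg, ← hw]
    refine (map_smul (cocMap (Pn a m) M i).hom r w').trans ?_
    exact congrArg (fun t => r • t) h1

lemma kills_iff (r : R) (i : ℕ) (M : ModuleCat.{0} R) :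
    Kills a r i M ↔ ∀ z : (localCohomology a i).obj M, r • z = 0 := by
  obtain ⟨c, h, ⟨hc⟩⟩ := exists_cocone a i M
  rw [kills_iff_aux a r i M c hc, h]

lemma kills_of_top (i : ℕ) (M : ModuleCat.{0} R) (ha : a = ⊤) :
    Subsingleton ((localCohomology a i).obj M) := by
  obtain ⟨c, h, ⟨hc⟩⟩ := exists_cocone a i M
  rw [← h]
  refine ⟨fun z z' => ?_⟩
  suffices ∀ z : c.pt, z = 0 by rw [this z, this z']
  intro z
  obtain ⟨j, y, rfl⟩ := Concrete.isColimit_exists_rep (Dg a i M) hc z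
  have hX : IsZero (Xn a j.unop.unop) := by
    rw [ModuleCat.isZero_iff_subsingleton]
    subst ha
    refine Ideal.Quotient.subsingleton_iff.2 ?_
    change (⊤ : Ideal R) ^ _ = ⊤
    rw [← Ideal.one_eq_top, one_pow]
  have := (isZero_Ext hX M i)
  rw [ModuleCat.isZero_iff_subsingleton] at this
  have hy : y = 0 := this.elim _ _
  rw [hy, map_zero]

lemma kills_of_smul_eq_zero (r : R) (i : ℕ) (M : ModuleCat.{0} R) (h : ∀ z : M, r • z = 0) :
    Kills a r i M := by
  intro n f hf
  refine ⟨n, le_rfl, 𝟙 _, ?_, 0, ?_⟩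
  · simp only [HomologicalComplex.id_f, Category.id_comp]
    exact ((congrArg _ ((localCohomology.ringModIdeals
      (localCohomology.idealPowersDiagram a)).map_id (op n))).trans (Category.comp_id _)).symm
  · ext z
    simp [h]

/-- The diagram chase. -/
lemma kills_of_exact (r s : R) (i : ℕ) {M₁ M₂ M₃ : ModuleCat.{0} R} (α : M₁ ⟶ M₂) (β : M₂ ⟶ M₃)
    (hα : Function.Injective α) (hβ : Function.Surjective β) (hex : Function.Exact α β)
    (h1 : Kills a r (i+1) M₁) (h2 : Kills a s i M₂) : Kills a (s * r) i M₃ := by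
  have : Mono α := (ModuleCat.mono_iff_injective _).2 hα
  have : Epi β := (ModuleCat.epi_iff_surjective _).2 hβ
  have hαβ : α ≫ β = 0 := by ext z; exact hex.apply_apply_eq_zero z
  let S := ShortComplex.mk α β hαβ
  have hS : S.Exact := (ShortComplex.moduleCat_exact_iff _).2 fun x hx => (hex x).1 hx
  intro n f hf
  have : Mono S.f := ‹Mono α›
  let ft : (Pn a n).complex.X i ⟶ M₂ := Projective.factorThru f β
  have hft : ft ≫ β = f := Projective.factorThru_comp f β
  let h : (Pn a n).complex.X (i+1) ⟶ M₁ := hS.lift ((Pn a n).complex.d (i+1) i ≫ ft)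
    (by simp [S, hft, hf])
  have hh : h ≫ α = (Pn a n).complex.d (i+1) i ≫ ft := hS.lift_f _ _
  obtain ⟨m, hm, φ, comm, hg0⟩ := h1 n h (by
    rw [← cancel_mono α]; simp [hh])
  have hnx : (ComplexShape.down ℕ).next (i+1) = i := by simp
  rw [hnx] at hg0
  obtain ⟨g, hg⟩ := hg0
  let k : (Pn a m).complex.X i ⟶ M₂ := r • (φ.f i ≫ ft) - g ≫ α
  have hk : (Pn a m).complex.d (i+1) i ≫ k = 0 := by
    have e1 : (Pn a m).complex.d (i+1) i ≫ φ.f i ≫ ft = φ.f (i+1) ≫ h ≫ α := by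
      rw [hh, ← Category.assoc, ← φ.comm, Category.assoc]
    have e2 : (Pn a m).complex.d (i+1) i ≫ g ≫ α = r • (φ.f (i+1) ≫ h ≫ α) := by
      rw [← Category.assoc, hg, Linear.smul_comp, Category.assoc]
    simp only [k]
    rw [Preadditive.comp_sub, Linear.comp_smul, e1, e2, sub_self]
  obtain ⟨m', hm', φ', comm', g', hg'⟩ := h2 m k hk
  refine ⟨m', hm.trans hm', φ' ≫ φ, ?_, g' ≫ β, ?_⟩
  · rw [HomologicalComplex.comp_f, Category.assoc, comm, ← Category.assoc, comm', Category.assoc]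
    congr 1
    simp only [Xmap]
    rw [← Functor.map_comp]
    rfl
  · have e3 : k ≫ β = r • (φ.f i ≫ f) := by
      simp only [k]
      rw [Preadditive.sub_comp, Linear.smul_comp, Category.assoc, Category.assoc, hft, hαβ,
        Limits.comp_zero, sub_zero]
    rw [← Category.assoc, hg', Linear.smul_comp, Category.assoc, e3, Linear.comp_smul,
      HomologicalComplex.comp_f, Category.assoc, mul_smul]

/-- Degree zero: `r` kills the `a`-torsion. -/
lemma smul_eq_zero_of_kills (r : R) (M : ModuleCat.{0} R) (h : Kills a r 0 M) (z : M) (n : ℕ)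
    (hz : ∀ b ∈ a ^ n, b • z = 0) : r • z = 0 := by
  let u : Xn a n ⟶ M := ModuleCat.ofHom (Submodule.liftQ (a ^ n) (LinearMap.toSpanSingleton R M z)
    (fun b hb => by rw [LinearMap.mem_ker]; exact hz b hb))
  obtain ⟨m, hm, φ, comm, g, hg⟩ := h n (pin a n ≫ u)
    (by rw [← Category.assoc, zero_add, d_pin, zero_comp])
  have hd : (Pn a m).complex.d 0 ((ComplexShape.down ℕ).next 0) = 0 := by
    apply HomologicalComplex.shape; simp
  rw [hd, zero_comp, ← Category.assoc, comm, Category.assoc] at hg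
  have h2 : r • (Xmap a hm ≫ u) = 0 := by
    have := pin_epi a m
    rw [← cancel_epi (pin a m), Linear.comp_smul, ← hg, comp_zero]
  have h3 : r • ((1 : R) • z) = 0 :=
    congrArg (fun t => t.hom (Submodule.Quotient.mk (1 : R))) h2
  rwa [one_smul] at h3
end Kill
end LCaux

namespace LCaux
section Nilp
variable {R : Type} [CommRing R]

lemma exists_smul_regular [IsNoetherianRing R] (a : Ideal R) (M : Type) [AddCommGroup M]
    [Module R M] [Module.Finite R M] (h : ∀ z : M, (∀ b ∈ a, b • z = 0) → z = 0) :
    ∃ y ∈ a, IsSMulRegular M y := by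
  by_contra hcon
  push Not at hcon
  have hsub : (a : Set R) ⊆ ⋃ p ∈ associatedPrimes R M, ((id p : Ideal R) : Set R) := by
    simp only [id]
    rw [biUnion_associatedPrimes_eq_zero_divisors]
    intro y hy
    have := hcon y hy
    rw [isSMulRegular_iff_right_eq_zero_of_smul] at this
    push Not at this
    obtain ⟨z, h1, h2⟩ := this
    exact ⟨z, h2, h1⟩
  obtain ⟨p, hp, hap⟩ := (a.subset_union_prime_finite (associatedPrimes.finite R M) (f := id)
    0 0 fun _ h _ _ => h.1).1 hsub
  rw [AssociatedPrimes.mem_iff, isAssociatedPrime_iff] at hp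
  obtain ⟨hpp, z, rfl⟩ := hp
  have hz : z = 0 := h z fun b hb => by
    have := hap hb
    simpa [Submodule.mem_colon_singleton] using this
  apply hpp.ne_top
  simp [hz]

lemma kills_quot (a : Ideal R) (r s : R) (i : ℕ) (M : Type) [AddCommGroup M] [Module R M]
    (N : Submodule R M) (h1 : Kills a r (i+1) (ModuleCat.of R N))
    (h2 : Kills a s i (ModuleCat.of R M)) : Kills a (s * r) i (ModuleCat.of R (M ⧸ N)) := by
  refine kills_of_exact a r s i (ModuleCat.ofHom N.subtype) (ModuleCat.ofHom N.mkQ)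
    N.injective_subtype N.mkQ_surjective ?_ h1 h2
  exact LinearMap.exact_subtype_mkQ N

open scoped Pointwise in
lemma kills_quotSMulTop (a : Ideal R) (r s : R) (i : ℕ) (M : Type) [AddCommGroup M] [Module R M]
    (y : R) (hy : IsSMulRegular M y) (h1 : Kills a r (i+1) (ModuleCat.of R M))
    (h2 : Kills a s i (ModuleCat.of R M)) :
    Kills a (s * r) i (ModuleCat.of R (QuotSMulTop y M)) := by
  refine kills_of_exact a r s i (ModuleCat.ofHom (LinearMap.lsmul R M y))
    (ModuleCat.ofHom (Submodule.mkQ (y • (⊤ : Submodule R M))))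
    hy (Submodule.mkQ_surjective _) ?_ h1 h2
  intro z
  change Submodule.Quotient.mk z = 0 ↔ z ∈ Set.range (fun m : M => y • m)
  rw [Submodule.Quotient.mk_eq_zero, Submodule.mem_smul_pointwise_iff_exists]
  simp

lemma nilp [IsNoetherianRing R] [IsLocalRing R] (a : Ideal R)
    (ha : a ≤ IsLocalRing.maximalIdeal R) (x : R) (d : ℕ) :
    ∀ N : ℕ, ∃ g : ℕ, ∀ (M : Type) [AddCommGroup M] [Module R M] [Module.Finite R M],
      Module.supportDim R M < d → (∀ i, Kills a (x ^ N) i (ModuleCat.of R M)) →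
      ∀ m : M, x ^ g • m = 0 := by
  induction d with
  | zero =>
    intro N
    refine ⟨0, fun M _ _ _ hd _ m => ?_⟩
    have : Subsingleton M := by
      by_contra hne
      rw [not_subsingleton_iff_nontrivial] at hne
      have : Nonempty (Module.support R M) :=
        (Module.nonempty_support_of_nontrivial (R := R) (M := M)).to_subtype
      have h0 : (0 : WithBot ℕ∞) ≤ Module.supportDim R M := Order.krullDim_nonneg
      exact absurd hd (not_lt.2 (by simpa using h0))
    exact Subsingleton.elim _ _
  | succ d ih =>
    intro N
    obtain ⟨g, hg⟩ := ih ((N + N) + (N + N))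
    refine ⟨g + N, fun M _ _ _ hd hK m => ?_⟩
    let T : ℕ →o Submodule R M :=
      { toFun := fun n => Submodule.torsionBySet R M (a ^ n : Ideal R)
        monotone' := fun n n' h => Submodule.torsionBySet_le_torsionBySet_of_subset
          (Ideal.pow_le_pow_right h) }
    obtain ⟨n, hn⟩ := monotone_stabilizes_iff_noetherian.2 (inferInstanceAs (IsNoetherian R M)) T
    let G := T n
    have hG : ∀ z : M, z ∈ G ↔ ∀ b ∈ a ^ n, b • z = 0 := fun z => by
      change z ∈ Submodule.torsionBySet R M (a ^ n : Ideal R) ↔ _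
      rw [Submodule.mem_torsionBySet_iff]
      simp
    have hxG : ∀ z ∈ G, x ^ N • z = 0 := fun z hz =>
      smul_eq_zero_of_kills a (x ^ N) (ModuleCat.of R M) (hK 0) z n ((hG z).1 hz)
    have hKG : ∀ i, Kills a (x ^ N) i (ModuleCat.of R G) := fun i =>
      kills_of_smul_eq_zero a _ i _ fun z => Subtype.ext (hxG z.1 z.2)
    have hKQ : ∀ i, Kills a (x ^ (N + N)) i (ModuleCat.of R (M ⧸ G)) := fun i => by
      rw [pow_add]
      exact kills_quot a _ _ i M G (hKG (i+1)) (hK i)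
    have htf : ∀ z : M ⧸ G, (∀ b ∈ a, b • z = 0) → z = 0 := by
      intro z hz
      obtain ⟨z, rfl⟩ := G.mkQ_surjective z
      rw [Submodule.mkQ_apply, Submodule.Quotient.mk_eq_zero]
      change z ∈ T n
      rw [hn (n+1) (Nat.le_succ n)]
      change z ∈ Submodule.torsionBySet R M (a ^ (n + 1) : Ideal R)
      rw [Submodule.mem_torsionBySet_iff]
      rintro ⟨b, hb⟩
      change b • z = 0
      rw [SetLike.mem_coe, pow_succ] at hb
      refine Submodule.mul_induction_on hb (fun b hb c hc => ?_) (fun b c h1 h2 => ?_)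
      · rw [mul_smul]
        refine (hG _).1 ?_ b hb
        have := hz c hc
        rwa [Submodule.mkQ_apply, ← Submodule.Quotient.mk_smul,
          Submodule.Quotient.mk_eq_zero] at this
      · rw [add_smul, h1, h2, add_zero]
    obtain ⟨y, hya, hy⟩ := exists_smul_regular a (M ⧸ G) htf
    have hdim : Module.supportDim R (M ⧸ G) ≤ Module.supportDim R M :=
      Module.supportDim_le_of_surjective G.mkQ G.mkQ_surjective
    have key : ∀ (z : M ⧸ G) (j : ℕ), x ^ g • z ∈ (Ideal.span {y}) ^ j • (⊤ : Submodule R (M ⧸ G)) := by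
      intro z j
      cases j with
      | zero => simp
      | succ j =>
        have hyj : IsSMulRegular (M ⧸ G) (y ^ (j+1)) := hy.pow _
        have hmem : y ^ (j+1) ∈ IsLocalRing.maximalIdeal R :=
          Ideal.pow_mem_of_mem _ (ha hya) _ (Nat.succ_pos j)
        have hs := Module.supportDim_quotSMulTop_succ_eq_supportDim hyj hmem
        have h1 := hg (QuotSMulTop (y ^ (j+1)) (M ⧸ G)) (by
          have h2 := (hs.le.trans hdim).trans_lt hd
          rw [Nat.cast_succ] at h2
          exact lt_of_add_lt_add_right h2) (fun i => by
            rw [pow_add x (N + N)]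
            exact kills_quotSMulTop a _ _ i _ _ hyj (hKQ (i+1)) (hKQ i)) (Submodule.Quotient.mk z)
        rw [← Submodule.Quotient.mk_smul, Submodule.Quotient.mk_eq_zero] at h1
        rwa [Ideal.span_singleton_pow, Submodule.ideal_span_singleton_smul]
    have hkr := Ideal.iInf_pow_smul_eq_bot_of_isLocalRing (M := M ⧸ G) (Ideal.span {y}) (by
      rw [Ne, Ideal.span_singleton_eq_top]
      exact (ha hya))
    have hfin : x ^ g • (G.mkQ m) = 0 := by
      rw [← Submodule.mem_bot R, ← hkr, Submodule.mem_iInf]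
      exact key _
    rw [Submodule.mkQ_apply, ← Submodule.Quotient.mk_smul, Submodule.Quotient.mk_eq_zero] at hfin
    rw [add_comm, pow_add, mul_smul]
    exact hxG _ hfin

lemma exists_mul_pow [IsNoetherianRing R] (p I : Ideal R) (hp : p ∈ I.minimalPrimes) :
    ∃ s ∉ p, ∃ k : ℕ, ∀ b ∈ p ^ k, s * b ∈ I := by
  classical
  have hpp : p.IsPrime := hp.1.1
  have hfin : I.minimalPrimes.Finite := I.finite_minimalPrimes_of_isNoetherianRing R
  obtain ⟨k, hk⟩ := I.exists_radical_pow_le_of_fg (IsNoetherian.noetherian _)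
  let F := hfin.toFinset.erase p
  obtain ⟨s, hsF, hs⟩ : ∃ s ∈ F.inf id, s ∉ p := by
    by_contra hcon
    push Not at hcon
    have hle : F.inf id ≤ p := hcon
    rw [hpp.inf_le'] at hle
    obtain ⟨q, hq, hqp⟩ := hle
    rw [Finset.mem_erase, Set.Finite.mem_toFinset] at hq
    exact hq.1 (le_antisymm hqp (hp.2 hq.2.1 hqp))
  refine ⟨s ^ k, fun h => hs (hpp.mem_of_pow_mem k h), k, fun b hb => hk ?_⟩
  have hle : Ideal.span {s} * p ≤ I.radical := by
    rw [← Ideal.sInf_minimalPrimes]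
    refine le_sInf fun q hq => ?_
    by_cases hqp : q = p
    · rw [hqp]; exact Ideal.mul_le_right
    · refine Ideal.mul_le_left.trans ?_
      rw [Ideal.span_singleton_le_iff_mem]
      have : F.inf id ≤ id q := Finset.inf_le (by simp [F, hqp, hq])
      exact this hsF
  refine Ideal.pow_right_mono hle k ?_
  rw [mul_pow]
  exact Ideal.mul_mem_mul (Ideal.pow_mem_pow (Ideal.mem_span_singleton_self s) k) hb

/-- minimal primes of the annihilator are attached -/
lemma exists_attached [IsNoetherianRing R] (A : Type) [AddCommGroup A] [Module R A] (p : Ideal R)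
    (hp : p ∈ (Module.annihilator R A).minimalPrimes) :
    p = Module.annihilator R (A ⧸ (p • (⊤ : Submodule R A))) := by
  have hpp : p.IsPrime := hp.1.1
  set J := Module.annihilator R (A ⧸ (p • (⊤ : Submodule R A))) with hJ
  apply le_antisymm
  · intro b hb
    rw [hJ, Module.mem_annihilator]
    intro z
    obtain ⟨z, rfl⟩ := Submodule.mkQ_surjective _ z
    rw [Submodule.mkQ_apply, ← Submodule.Quotient.mk_smul, Submodule.Quotient.mk_eq_zero]
    exact Submodule.smul_mem_smul hb trivial
  · have hJA : J • (⊤ : Submodule R A) ≤ p • ⊤ := by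
      rw [Submodule.smul_le]
      intro b hb z _
      rw [hJ, Module.mem_annihilator] at hb
      have := hb (Submodule.Quotient.mk z)
      rwa [← Submodule.Quotient.mk_smul, Submodule.Quotient.mk_eq_zero] at this
    have hpow : ∀ k : ℕ, J ^ k • (⊤ : Submodule R A) ≤ p ^ k • ⊤ := by
      intro k
      induction k with
      | zero => simp
      | succ k ih =>
        rw [pow_succ, pow_succ, ← smul_eq_mul, ← smul_eq_mul, Submodule.smul_assoc,
          Submodule.smul_assoc]
        calc J ^ k • J • (⊤ : Submodule R A) ≤ J ^ k • p • ⊤ := smul_mono_right _ hJA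
          _ = p • J ^ k • ⊤ := by
              rw [← Submodule.smul_assoc, smul_eq_mul, mul_comm, ← smul_eq_mul,
                Submodule.smul_assoc]
          _ ≤ p • p ^ k • ⊤ := smul_mono_right _ ih
          _ = p ^ k • p • ⊤ := by
              rw [← Submodule.smul_assoc, smul_eq_mul, mul_comm, ← smul_eq_mul,
                Submodule.smul_assoc]
    obtain ⟨s, hs, k, hk⟩ : ∃ s ∉ p, ∃ k : ℕ, ∀ b ∈ p ^ k, s * b ∈ Module.annihilator R A :=
      exists_mul_pow p _ hp
    have hle : ∀ b ∈ J ^ k, s * b ∈ Module.annihilator R A := by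
      intro b hb
      rw [Module.mem_annihilator]
      intro z
      rw [mul_smul]
      have hbz : b • z ∈ p ^ k • (⊤ : Submodule R A) :=
        hpow k (Submodule.smul_mem_smul hb trivial)
      refine Submodule.smul_induction_on hbz (fun c hc w _ => ?_) (fun u v h1 h2 => ?_)
      · rw [← mul_smul]
        exact Module.mem_annihilator.1 (hk c hc) w
      · rw [smul_add, h1, h2, add_zero]
    intro b hb
    have h1 := hp.1.2 (hle _ (Ideal.pow_mem_pow hb k))
    exact hpp.mem_of_pow_mem k ((hpp.mem_or_mem h1).resolve_left hs)

lemma minimal_eq (S : Set (Ideal R)) (I : Ideal R) (h1 : ∀ p ∈ S, p.IsPrime ∧ I ≤ p)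
    (h2 : I.minimalPrimes ⊆ S) : {p | p ∈ S ∧ ∀ q ∈ S, q ≤ p → q = p} = I.minimalPrimes := by
  ext p
  constructor
  · rintro ⟨hp, hmin⟩
    have := (h1 p hp).1
    obtain ⟨q, hq, hqp⟩ := Ideal.exists_minimalPrimes_le (h1 p hp).2
    rw [← hmin q (h2 hq) hqp]
    exact hq
  · intro hp
    exact ⟨h2 hp, fun q hq hqp => le_antisymm hqp (hp.2 (h1 q hq) hqp)⟩
end Nilp
end LCaux

theorem stmt15 {R : Type} [CommRing R] [IsNoetherianRing R] [IsLocalRing R]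
    (a : Ideal R) (M : ModuleCat R) [Module.Finite R M] (hM : Nontrivial M)
    (c : ℕ) (hcd : HasCD a M c)
    (hrcm : ∀ i, i ≠ c → Subsingleton ((localCohomology a i).obj M)) :
    {p | p ∈ associatedPrimes R M ∧ ∀ q ∈ associatedPrimes R M, q ≤ p → q = p} =
      {p | p ∈ attachedPrimes R ((localCohomology a c).obj M) ∧
        ∀ q ∈ attachedPrimes R ((localCohomology a c).obj M), q ≤ p → q = p} := by
  obtain ⟨hnt, -⟩ := hcd
  have hann : (Module.annihilator R M).radical =
      (Module.annihilator R ((localCohomology a c).obj M)).radical := by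
    apply le_antisymm
    · refine Ideal.radical_mono fun r hr => ?_
      rw [Module.mem_annihilator] at hr ⊢
      exact (LCaux.kills_iff a r c M).1 (LCaux.kills_of_smul_eq_zero a r c M hr)
    · rw [Ideal.radical_le_radical_iff]
      intro x hx
      rw [Module.mem_annihilator] at hx
      have hne : a ≠ ⊤ := fun h => by
        have := LCaux.kills_of_top a c M h
        exact not_subsingleton _ this
      have hK : ∀ i, LCaux.Kills a (x ^ 1) i (ModuleCat.of R M) := by
        intro i
        rw [pow_one]
        refine (LCaux.kills_iff a x i M).2 fun z => ?_
        by_cases hi : i = c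
        · subst hi; exact hx z
        · have := hrcm i hi
          exact Subsingleton.elim _ _
      have hlt : Module.supportDim R M < ⊤ :=
        (Module.supportDim_le_ringKrullDim R M).trans_lt ringKrullDim_lt_top
      obtain ⟨d, hd⟩ : ∃ d : ℕ, Module.supportDim R M < d := by
        generalize Module.supportDim R M = e at hlt
        induction e with
        | bot => exact ⟨0, WithBot.bot_lt_coe _⟩
        | coe e =>
          induction e with
          | top => exact absurd hlt (lt_irrefl _)
          | coe e => exact ⟨e + 1, by exact_mod_cast Nat.lt_succ_self e⟩
      obtain ⟨g, hg⟩ := LCaux.nilp a (IsLocalRing.le_maximalIdeal hne) x d 1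
      exact ⟨g, Module.mem_annihilator.2 (hg M hd hK)⟩
  rw [LCaux.minimal_eq (associatedPrimes R M) (Module.annihilator R M)
      (fun p hp => ⟨hp.1, Submodule.annihilator_top.symm.le.trans
        (IsAssociatedPrime.annihilator_le hp)⟩)
      (Module.associatedPrimes.minimalPrimes_annihilator_subset_associatedPrimes R M),
    LCaux.minimal_eq (attachedPrimes R ((localCohomology a c).obj M))
      (Module.annihilator R ((localCohomology a c).obj M)) ?_ ?_,
    ← Ideal.radical_minimalPrimes, hann, Ideal.radical_minimalPrimes]
  · rintro p ⟨hp, B, rfl⟩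
    exact ⟨hp, LinearMap.annihilator_le_of_surjective B.mkQ B.mkQ_surjective⟩
  · intro p hp
    exact ⟨hp.1.1, _, LCaux.exists_attached _ p hp⟩
end
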